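/- Klein paradox asymptotics: Assume V satisfies assumption (A), m > 0, and the energy E lies in region III, i.e. V⁻ + mc² < E < V⁺ − mc². Suppose m²c⁴ − (V(x) − E)² has exactly two real zeros t₁(E) < t₂(E), both simple. Then there exist classical analytic symbols φ₁(h), φ₂(h), φ₃(h) of non-negative order such that the coefficients of the scattering matrix satisfy: s₁₁ = s₂₂ = (1 + hφ₁(h))·exp(−S(E)/h)·exp(iT(E)/h); s₂₁ = (i + hφ₂(h))·exp{(2i/h)(t₁(E)·√(E⁻) + ∫_{−∞}^{t₁(E)} Q⁻(t,E) dt)}; and s₁₂ = (i + hφ₃(h))·exp{(2i/h)(t₂(E)·√(E⁺) − ∫_{t₂(E)}^{+∞} Q⁺(t,E) dt)}. Here S(E) = ∫_{t₁(E)}^{t₂(E)} √((m²c⁴ − (V(t)−E)²)/c²) dt is the classical action between the turning points, E^± = (−m²c⁴ + (V^± − E)²)/c², Q⁻(t,E) = √((−m²c⁴ + (V(t)−E)²)/c²) − √(E⁻) for t < t₁(E), Q⁺(t,E) = √((−m²c⁴ + (V(t)−E)²)/c²) − √(E⁺) for t > t₂(E), and T(E) = ∫_{−∞}^{t₁(E)}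 Q⁻(t,E) dt − ∫_{t₂(E)}^{+∞} Q⁺(t,E) dt + t₁(E)√(E⁻) + t₂(E)√(E⁺). -/

import Mathlib

open Complex Filter Topology MeasureTheory Set

noncomputable section

/-- The sector `𝒮 = {x ∈ ℂ : |Im x| < ε|Re x| + η}`. -/
def Sector (ε η : ℝ) : Set ℂ := {x : ℂ | |x.im| < ε * |x.re| + η}

/-- Assumption (A): `V` is real on the real axis, analytic in a sector `𝒮`
around the real axis, and tends to constants `V^±` at `±∞` in `𝒮` at rate
`⟨x⟩^{-δ}`, `δ > 1`, with `V⁻ < V⁺`. -/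
structure AssumptionA (V : ℂ → ℂ) (Vm Vp : ℝ) : Prop where
  lt : Vm < Vp
  real_on_real : ∀ x : ℝ, (V x).im = 0
  sector : ∃ ε > (0 : ℝ), ∃ η > (0 : ℝ), ∃ δ > (1 : ℝ),
    AnalyticOnNhd ℂ V (Sector ε η) ∧
    (∃ C R : ℝ, ∀ x ∈ Sector ε η, R ≤ x.re →
      ‖V x - (Vp : ℂ)‖ ≤ C * (1 + ‖x‖ ^ 2) ^ (-(δ / 2))) ∧
    (∃ C R : ℝ, ∀ x ∈ Sector ε η, x.re ≤ -R →
      ‖V x - (Vm : ℂ)‖ ≤ C * (1 + ‖x‖ ^ 2) ^ (-(δ / 2)))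

/-- `u = (u₁,u₂)` solves the one-dimensional Dirac equation
`(-i h c σ₁ d/dx + m c² σ₃ + V(x) I₂) u = E u` on `ℝ`. -/
structure IsDiracSolution (hp m c : ℝ) (V : ℂ → ℂ) (E : ℝ) (u : ℝ → ℂ × ℂ) : Prop where
  diff1 : Differentiable ℝ fun x : ℝ => (u x).1
  diff2 : Differentiable ℝ fun x : ℝ => (u x).2
  eq1 : ∀ x : ℝ,
    -Complex.I * (hp : ℂ) * (c : ℂ) * deriv (fun y : ℝ => (u y).2) x
      + ((m : ℂ) * (c : ℂ) ^ 2 + V x) * (u x).1 = (E : ℂ) * (u x).1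
  eq2 : ∀ x : ℝ,
    -Complex.I * (hp : ℂ) * (c : ℂ) * deriv (fun y : ℝ => (u y).1) x
      + (-((m : ℂ) * (c : ℂ) ^ 2) + V x) * (u x).2 = (E : ℂ) * (u x).2

/-- `Φ(λ) = sgn(λ) √(λ² − m²c⁴)`. -/
def PhiF (m c lam : ℝ) : ℝ := Real.sign lam * Real.sqrt (lam ^ 2 - m ^ 2 * c ^ 4)

/-- `A(λ) = ((λ + mc²)/(λ − mc²))^{1/4}`. -/
def AmpF (m c lam : ℝ) : ℝ := ((lam + m * c ^ 2) / (lam - m * c ^ 2)) ^ ((1 : ℝ) / 4)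

/-- `u(x)` behaves exactly like `e^{θ x} v` along the filter `l`,
i.e. `u(x) e^{-θ x} → v`. -/
def JostAsymp (u : ℝ → ℂ × ℂ) (θ : ℂ) (v : ℂ × ℂ) (l : Filter ℝ) : Prop :=
  Tendsto (fun x : ℝ => (u x).1 * Complex.exp (-(θ * (x : ℂ)))) l (𝓝 v.1) ∧
  Tendsto (fun x : ℝ => (u x).2 * Complex.exp (-(θ * (x : ℂ)))) l (𝓝 v.2)

/-- `u` behaves exactly like `exp(s (i/(hc)) Φ(E−V₀) x) · (A(E−V₀), s' A(E−V₀)⁻¹)`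
along `l`.  The Jost solutions `ω_in^±` correspond to `s = s' = ∓1`, `l = at±∞`,
and `ω_out^±` to `s = s' = ±1`, `l = at±∞`. -/
def JostCond (hp m c E V0 s s' : ℝ) (l : Filter ℝ) (u : ℝ → ℂ × ℂ) : Prop :=
  JostAsymp u ((s : ℂ) * Complex.I / ((hp : ℂ) * (c : ℂ)) * ((PhiF m c (E - V0) : ℝ) : ℂ))
    (((AmpF m c (E - V0) : ℝ) : ℂ), (s' : ℂ) * (((AmpF m c (E - V0) : ℝ) : ℂ))⁻¹) l

/-- `B^± = ((mc² + E − V^±)/(mc² − E + V^±))^{1/4}`. -/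
def Bsym (m c E W : ℝ) : ℝ := ((m * c ^ 2 + E - W) / (m * c ^ 2 - E + W)) ^ ((1 : ℝ) / 4)

/-- The decaying Jost solution `ω_d^±` (for `s = ±1`, `l = at±∞`):
`ω_d^± ~ exp(∓ (1/(hc)) √(m²c⁴ − (V^± − E)²) x) (∓ i B^±, (B^±)⁻¹)`. -/
def DecayCond (hp m c E W s : ℝ) (l : Filter ℝ) (u : ℝ → ℂ × ℂ) : Prop :=
  JostAsymp u (-(s : ℂ) * ((Real.sqrt (m ^ 2 * c ^ 4 - (W - E) ^ 2) : ℝ) : ℂ) / ((hp : ℂ) * (c : ℂ)))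
    (-(s : ℂ) * Complex.I * ((Bsym m c E W : ℝ) : ℂ), (((Bsym m c E W : ℝ) : ℂ))⁻¹) l

/-- The defining relation `(ω_in^−, ω_in^+) = (ω_out^+, ω_out^−) · 𝕊` of the
scattering matrix. -/
def ScatRel (ωinm ωinp ωoutp ωoutm : ℝ → ℂ × ℂ) (S : Matrix (Fin 2) (Fin 2) ℂ) : Prop :=
  (∀ x : ℝ, ωinm x = S 0 0 • ωoutp x + S 1 0 • ωoutm x) ∧
  (∀ x : ℝ, ωinp x = S 0 1 • ωoutp x + S 1 1 • ωoutm x)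

/-- A classical analytic symbol (of non-negative order `mo`) in the semiclassical
parameter `h`: there are coefficients `a j` with `‖a j‖ ≤ C^{j+1} j^j` such that
`f(h) − ∑_{0 ≤ j ≤ h⁻¹/(e C₁)} a j h^{mo+j}` is `O(e^{-ρ/h})` for every `C₁ > C`. -/
def IsCAS (f : ℝ → ℂ) : Prop :=
  ∃ (mo : ℕ) (a : ℕ → ℂ) (C : ℝ), 0 < C ∧
    (∀ j : ℕ, ‖a j‖ ≤ C ^ (j + 1) * (j : ℝ) ^ j) ∧
    ∀ C₁ : ℝ, C < C₁ → ∃ ρ > (0 : ℝ), ∃ M : ℝ,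
      ∀ h : ℝ, 0 < h → h < 1 →
        ‖f h - ∑ j ∈ Finset.range (⌊1 / (h * Real.exp 1 * C₁)⌋₊ + 1), a j * (h : ℂ) ^ (mo + j)‖
          ≤ M * Real.exp (-ρ / h)

/-- `E^± = (−m²c⁴ + (V^± − E)²)/c²`. -/
def Esym (m c E W : ℝ) : ℝ := (-(m ^ 2 * c ^ 4) + (W - E) ^ 2) / c ^ 2

/-- `Q^±(t,E) = √((−m²c⁴ + (V(t) − E)²)/c²) − √(E^±)` (here `W = V^±`). -/
def Qsym (m c E W : ℝ) (V : ℂ → ℂ) (t : ℝ) : ℝ :=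
  Real.sqrt ((-(m ^ 2 * c ^ 4) + ((V t).re - E) ^ 2) / c ^ 2) - Real.sqrt (Esym m c E W)

/-- `Q₋^±(t,E) = √((m²c⁴ − (V(t) − E)²)/c²) − √(−E^±)` (here `W = V^±`). -/
def Qminus (m c E W : ℝ) (V : ℂ → ℂ) (t : ℝ) : ℝ :=
  Real.sqrt ((m ^ 2 * c ^ 4 - ((V t).re - E) ^ 2) / c ^ 2) - Real.sqrt (-(Esym m c E W))

/-- The classical action `S(E)` between the turning points. -/
def SAct (m c E : ℝ) (V : ℂ → ℂ) (t₁ t₂ : ℝ) : ℝ :=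
  ∫ t in t₁..t₂, Real.sqrt ((m ^ 2 * c ^ 4 - ((V t).re - E) ^ 2) / c ^ 2)

/-- The phase `T(E)`. -/
def TPhase (m c E Vm Vp : ℝ) (V : ℂ → ℂ) (t₁ t₂ : ℝ) : ℝ :=
  (∫ t in Set.Iic t₁, Qsym m c E Vm V t) - (∫ t in Set.Ici t₂, Qsym m c E Vp V t)
    + t₁ * Real.sqrt (Esym m c E Vm) + t₂ * Real.sqrt (Esym m c E Vp)

/-- The Wronskian of two vectors in `ℂ²`. -/
def Wron (u v : ℂ × ℂ) : ℂ := u.1 * v.2 - u.2 * v.1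

end

namespace KleinWKB

section

open scoped Nat in
/-- `f` has the Gevrey-1 asymptotic expansion `∑ a j h ^ j` on `(0, h₀)`. -/
structure Gevrey (h₀ C : ℝ) (f : ℝ → ℂ) (a : ℕ → ℂ) : Prop where
  coeff : ∀ j, ‖a j‖ ≤ C ^ (j + 1) * (j !)
  rem : ∀ N h, 0 < h → h < h₀ →
    ‖f h - ∑ j ∈ Finset.range N, a j * (h : ℂ) ^ j‖ ≤ C ^ (N + 1) * (N !) * h ^ N

namespace Gevrey

open scoped Nat

variable {h₀ C : ℝ} {f g : ℝ → ℂ} {a b : ℕ → ℂ}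

theorem mono (hf : Gevrey h₀ C f a) (hC : 0 ≤ C) {C' h₁ : ℝ} (hCC : C ≤ C') (hh : h₁ ≤ h₀) :
    Gevrey h₁ C' f a where
  coeff j := (hf.coeff j).trans (by gcongr)
  rem N h h0 h1 := (hf.rem N h h0 (h1.trans_le hh)).trans (by gcongr)

theorem norm_le (hf : Gevrey h₀ C f a) {h : ℝ} (h0 : 0 < h) (h1 : h < h₀) : ‖f h‖ ≤ C := by
  simpa using hf.rem 0 h h0 h1

theorem conj (hf : Gevrey h₀ C f a) :
    Gevrey h₀ C (fun h => (starRingEnd ℂ) (f h)) (fun j => (starRingEnd ℂ) (a j)) where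
  coeff j := by simpa using hf.coeff j
  rem N h h0 h1 := by
    have := hf.rem N h h0 h1
    rw [← Complex.norm_conj] at this
    simpa [map_sum] using this

theorem add (hf : Gevrey h₀ C f a) (hg : Gevrey h₀ C g b) (hC : 0 ≤ C) :
    Gevrey h₀ (2 * C) (fun h => f h + g h) (fun j => a j + b j) := by
  have key : ∀ j : ℕ, C ^ (j + 1) * j ! + C ^ (j + 1) * j ! ≤ (2 * C) ^ (j + 1) * j ! := by
    intro j
    have h1 : (1 : ℝ) ≤ 2 ^ j := one_le_pow₀ (by norm_num)
    have h2 : 0 ≤ C ^ (j + 1) * j ! := by positivity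
    calc _ = 2 * (1 * (C ^ (j + 1) * j !)) := by ring
      _ ≤ 2 * (2 ^ j * (C ^ (j + 1) * j !)) := by gcongr
      _ = _ := by rw [mul_pow, pow_succ 2]; ring
  refine ⟨fun j => ?_, fun N h h0 h1 => ?_⟩
  · exact (norm_add_le _ _).trans ((add_le_add (hf.coeff j) (hg.coeff j)).trans (key j))
  · have e : f h + g h - ∑ j ∈ Finset.range N, (a j + b j) * (h : ℂ) ^ j
        = (f h - ∑ j ∈ Finset.range N, a j * (h : ℂ) ^ j)
          + (g h - ∑ j ∈ Finset.range N, b j * (h : ℂ) ^ j) := by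
      simp only [add_mul, Finset.sum_add_distrib]; ring
    rw [e]
    refine (norm_add_le _ _).trans ((add_le_add (hf.rem N h h0 h1) (hg.rem N h h0 h1)).trans ?_)
    have := mul_le_mul_of_nonneg_right (key N) (pow_nonneg h0.le N)
    linarith

/-- Splitting of the truncated product of two expansions. -/
theorem mul_sub_sum (x y z : ℂ) (a b : ℕ → ℂ) (N : ℕ) :
    x * y - ∑ j ∈ Finset.range N, (∑ i ∈ Finset.range (j + 1), a i * b (j - i)) * z ^ j
      = ∑ i ∈ Finset.range N, a i * z ^ i * (y - ∑ k ∈ Finset.range (N - i), b k * z ^ k)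
        + (x - ∑ i ∈ Finset.range N, a i * z ^ i) * y := by
  have h1 : ∑ j ∈ Finset.range N, (∑ i ∈ Finset.range (j + 1), a i * b (j - i)) * z ^ j
      = ∑ i ∈ Finset.range N, ∑ k ∈ Finset.range (N - i), (a i * z ^ i) * (b k * z ^ k) := by
    rw [← Finset.sum_range_diag_flip N fun i k => (a i * z ^ i) * (b k * z ^ k)]
    refine Finset.sum_congr rfl fun j _ => ?_
    rw [Finset.sum_mul]
    refine Finset.sum_congr rfl fun i hi => ?_
    have : j = i + (j - i) := by have := Finset.mem_range.1 hi; omega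
    conv_lhs => rw [show z ^ j = z ^ i * z ^ (j - i) by rw [← pow_add, ← this]]
    ring
  rw [h1]
  simp only [← Finset.mul_sum, mul_sub, Finset.sum_sub_distrib, sub_mul, Finset.sum_mul]
  ring

theorem factorial_mul_le {i N : ℕ} (hi : i ≤ N) : (i ! : ℝ) * (N - i)! ≤ N ! := by
  exact_mod_cast Nat.le_of_dvd (Nat.factorial_pos _) (Nat.factorial_mul_factorial_dvd_factorial hi)

theorem mul (hf : Gevrey h₀ C f a) (hg : Gevrey h₀ C g b) (hC : 1 ≤ C) :
    Gevrey h₀ (2 * C ^ 2) (fun h => f h * g h)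
      (fun j => ∑ i ∈ Finset.range (j + 1), a i * b (j - i)) := by
  have hC0 : 0 ≤ C := by linarith
  have key : ∀ j : ℕ, (j + 1 : ℝ) * (C ^ (j + 2) * j !) ≤ (2 * C ^ 2) ^ (j + 1) * j ! := by
    intro j
    have h1 : (j + 1 : ℝ) ≤ 2 ^ (j + 1) := by exact_mod_cast (Nat.lt_two_pow_self (n := j + 1)).le
    have h2 : C ^ (j + 2) ≤ C ^ (2 * (j + 1)) := pow_le_pow_right₀ hC (by omega)
    rw [mul_pow, ← pow_mul, ← mul_assoc]
    gcongr
  have term : ∀ (i N : ℕ), i ≤ N →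
      C ^ (i + 1) * i ! * (C ^ (N - i + 1) * (N - i)!) ≤ C ^ (N + 2) * N ! := by
    intro i N hi
    have e : C ^ (i + 1) * i ! * (C ^ (N - i + 1) * (N - i)!)
        = C ^ (N + 2) * ((i ! : ℝ) * (N - i)!) := by
      have : N + 2 = (i + 1) + (N - i + 1) := by omega
      rw [this, pow_add]; ring
    rw [e]
    gcongr
    exact factorial_mul_le hi
  refine ⟨fun j => ?_, fun N h h0 h1 => ?_⟩
  · refine (norm_sum_le _ _).trans (le_trans ?_ (key j))
    have := Finset.sum_le_card_nsmul (Finset.range (j + 1)) (fun i => ‖a i * b (j - i)‖)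
      (C ^ (j + 2) * j !) (fun i hi => by
        rw [norm_mul]
        refine (mul_le_mul (hf.coeff i) (hg.coeff _) (norm_nonneg _) (by positivity)).trans ?_
        exact term i j (by have := Finset.mem_range.1 hi; omega))
    simpa [nsmul_eq_mul] using this
  · rw [mul_sub_sum]
    have e1 : ‖∑ i ∈ Finset.range N,
        a i * (h : ℂ) ^ i * (g h - ∑ k ∈ Finset.range (N - i), b k * (h : ℂ) ^ k)‖
        ≤ N * (C ^ (N + 2) * N ! * h ^ N) := by
      refine (norm_sum_le _ _).trans ?_
      have := Finset.sum_le_card_nsmul (Finset.range N) (fun i => ‖a i * (h : ℂ) ^ i *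
        (g h - ∑ k ∈ Finset.range (N - i), b k * (h : ℂ) ^ k)‖) (C ^ (N + 2) * N ! * h ^ N)
        (fun i hi => by
          have hi' : i ≤ N := (Finset.mem_range.1 hi).le
          rw [norm_mul, norm_mul, norm_pow, Complex.norm_real, Real.norm_of_nonneg h0.le]
          calc ‖a i‖ * h ^ i * ‖g h - ∑ k ∈ Finset.range (N - i), b k * (h : ℂ) ^ k‖
              ≤ C ^ (i + 1) * i ! * h ^ i * (C ^ (N - i + 1) * (N - i)! * h ^ (N - i)) := by
                gcongr
                · exact hf.coeff i
                · exact hg.rem _ h h0 h1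
            _ = C ^ (i + 1) * i ! * (C ^ (N - i + 1) * (N - i)!) * h ^ N := by
                rw [show h ^ N = h ^ i * h ^ (N - i) by rw [← pow_add]; congr 1; omega]; ring
            _ ≤ _ := mul_le_mul_of_nonneg_right (term i N hi') (by positivity))
      simpa [nsmul_eq_mul] using this
    have e2 : ‖(f h - ∑ i ∈ Finset.range N, a i * (h : ℂ) ^ i) * g h‖
        ≤ C ^ (N + 2) * N ! * h ^ N := by
      rw [norm_mul]
      calc _ ≤ (C ^ (N + 1) * N ! * h ^ N) * C := by
            gcongr
            · exact hf.rem N h h0 h1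
            · exact hg.norm_le h0 h1
        _ = _ := by ring
    refine (norm_add_le _ _).trans ((add_le_add e1 e2).trans ?_)
    have := mul_le_mul_of_nonneg_right (key N) (pow_nonneg h0.le N)
    linarith

theorem inv (hf : Gevrey h₀ C f a) (hC : 1 ≤ C) (ha : a 0 = 1) :
    ∃ b D, b 0 = 1 ∧ 1 ≤ D ∧ Gevrey (min h₀ (1 / (2 * C ^ 2))) D (fun h => (f h)⁻¹) b ∧
      ∀ h, 0 < h → h < min h₀ (1 / (2 * C ^ 2)) → f h ≠ 0 := by
  have hC0 : 0 < C := by linarith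
  set P : PowerSeries ℂ := PowerSeries.mk a with hP
  have hc0 : PowerSeries.constantCoeff P ≠ 0 := by
    simp [hP, ← PowerSeries.coeff_zero_eq_constantCoeff_apply, ha]
  set b : ℕ → ℂ := fun j => PowerSeries.coeff j P⁻¹ with hb
  have conv : ∀ j, ∑ i ∈ Finset.range (j + 1), b i * a (j - i) = if j = 0 then 1 else 0 := by
    intro j
    have := congrArg (PowerSeries.coeff j) (PowerSeries.inv_mul_cancel P hc0)
    rw [PowerSeries.coeff_mul, PowerSeries.coeff_one,
      Finset.Nat.sum_antidiagonal_eq_sum_range_succ_mk] at this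
    simpa [hP, hb] using this
  have hb0 : b 0 = 1 := by simpa [ha] using conv 0
  set D : ℝ := 2 * C ^ 2 + C with hD
  have hDC : C ≤ D := by rw [hD]; nlinarith
  have hD0 : 0 < D := by linarith
  have geo : ∀ N, C * ∑ j ∈ Finset.range N, D ^ j * C ^ (N - j) ≤ D ^ N / 2 := by
    intro N
    have h1 := geom_sum₂_mul D C N
    have h2 : ∑ j ∈ Finset.range N, D ^ j * C ^ (N - j)
        = C * ∑ j ∈ Finset.range N, D ^ j * C ^ (N - 1 - j) := by
      rw [Finset.mul_sum]
      refine Finset.sum_congr rfl fun j hj => ?_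
      have : N - j = N - 1 - j + 1 := by have := Finset.mem_range.1 hj; omega
      rw [this, pow_succ]; ring
    rw [h2]
    have h3 : D - C = 2 * C ^ 2 := by rw [hD]; ring
    rw [h3] at h1
    have : 0 ≤ C ^ N := by positivity
    nlinarith
  have bnd : ∀ N, ‖b N‖ ≤ D ^ N * N ! := by
    intro N
    induction N using Nat.strong_induction_on with
    | _ N ih =>
      rcases Nat.eq_zero_or_pos N with rfl | hN
      · simp [hb0]
      · have h1 := conv N
        rw [Finset.sum_range_succ, if_neg hN.ne', Nat.sub_self, ha, mul_one] at h1
        have h2 : b N = -∑ i ∈ Finset.range N, b i * a (N - i) := by linear_combination h1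
        rw [h2, norm_neg]
        calc ‖∑ i ∈ Finset.range N, b i * a (N - i)‖
            ≤ ∑ i ∈ Finset.range N, C * (D ^ i * C ^ (N - i)) * N ! := by
              refine (norm_sum_le _ _).trans (Finset.sum_le_sum fun i hi => ?_)
              have hi' := Finset.mem_range.1 hi
              rw [norm_mul]
              calc ‖b i‖ * ‖a (N - i)‖ ≤ (D ^ i * i !) * (C ^ (N - i + 1) * (N - i)!) := by
                    gcongr
                    · exact ih i hi'
                    · exact hf.coeff _
                _ = C * (D ^ i * C ^ (N - i)) * ((i ! : ℝ) * (N - i)!) := by rw [pow_succ]; ring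
                _ ≤ _ := by gcongr; exact factorial_mul_le hi'.le
          _ = (C * ∑ i ∈ Finset.range N, D ^ i * C ^ (N - i)) * N ! := by
              rw [Finset.mul_sum, Finset.sum_mul]
          _ ≤ D ^ N / 2 * N ! := by gcongr; exact geo N
          _ ≤ D ^ N * N ! := by
              have : 0 ≤ D ^ N * (N ! : ℝ) := by positivity
              linarith
  have lower : ∀ h, 0 < h → h < min h₀ (1 / (2 * C ^ 2)) → 1 / 2 ≤ ‖f h‖ := by
    intro h h0 h1
    have h2 := hf.rem 1 h h0 (h1.trans_le (min_le_left _ _))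
    simp [ha] at h2
    have h3 : h * (2 * C ^ 2) < 1 := by
      have := h1.trans_le (min_le_right _ _)
      rwa [lt_div_iff₀ (by positivity)] at this
    have h4 : ‖(1 : ℂ)‖ ≤ ‖f h‖ + ‖f h - 1‖ := by
      have := norm_sub_le (f h) (f h - 1)
      simpa using this
    rw [norm_one] at h4
    nlinarith
  have hne : ∀ h, 0 < h → h < min h₀ (1 / (2 * C ^ 2)) → f h ≠ 0 := fun h h0 h1 h2 => by
    have := lower h h0 h1
    rw [h2, norm_zero] at this
    norm_num at this
  have hD1 : 2 ≤ D := by rw [hD]; nlinarith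
  refine ⟨b, D, hb0, by linarith, ⟨fun j => (bnd j).trans ?_, fun N h h0 h1 => ?_⟩, hne⟩
  · gcongr
    · linarith
    · omega
  have hinv : ‖(f h)⁻¹‖ ≤ 2 := by
    rw [norm_inv]
    exact inv_le_of_inv_le₀ (by norm_num) (by have := lower h h0 h1; norm_num at this ⊢; linarith)
  rcases Nat.eq_zero_or_pos N with rfl | hN
  · simpa using hinv.trans hD1
  have hsum : ∑ j ∈ Finset.range N, (∑ i ∈ Finset.range (j + 1), b i * a (j - i)) * (h : ℂ) ^ j
      = 1 := by
    obtain ⟨M, rfl⟩ : ∃ M, N = M + 1 := ⟨N - 1, by omega⟩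
    rw [Finset.sum_range_succ']
    simp only [conv]
    simp
  have h2 := mul_sub_sum (f h)⁻¹ (f h) h b a N
  rw [hsum, inv_mul_cancel₀ (hne h h0 h1), sub_self] at h2
  have h3 : (f h)⁻¹ - ∑ i ∈ Finset.range N, b i * (h : ℂ) ^ i
      = -(f h)⁻¹ * ∑ i ∈ Finset.range N, b i * (h : ℂ) ^ i *
        (f h - ∑ k ∈ Finset.range (N - i), a k * (h : ℂ) ^ k) := by
    have := mul_inv_cancel₀ (hne h h0 h1)
    linear_combination -(f h)⁻¹ * h2 + (∑ i ∈ Finset.range N, b i * (h : ℂ) ^ i - (f h)⁻¹) * this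
  rw [h3, norm_mul, norm_neg]
  have h4 : ‖∑ i ∈ Finset.range N, b i * (h : ℂ) ^ i *
        (f h - ∑ k ∈ Finset.range (N - i), a k * (h : ℂ) ^ k)‖ ≤ D ^ N / 2 * N ! * h ^ N := by
    calc _ ≤ ∑ i ∈ Finset.range N, C * (D ^ i * C ^ (N - i)) * N ! * h ^ N := by
          refine (norm_sum_le _ _).trans (Finset.sum_le_sum fun i hi => ?_)
          have hi' := Finset.mem_range.1 hi
          rw [norm_mul, norm_mul, norm_pow, Complex.norm_real, Real.norm_of_nonneg h0.le]
          calc ‖b i‖ * h ^ i * ‖f h - ∑ k ∈ Finset.range (N - i), a k * (h : ℂ) ^ k‖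
              ≤ (D ^ i * i !) * h ^ i * (C ^ (N - i + 1) * (N - i)! * h ^ (N - i)) := by
                gcongr
                · exact bnd i
                · exact hf.rem _ h h0 (h1.trans_le (min_le_left _ _))
            _ = C * (D ^ i * C ^ (N - i)) * ((i ! : ℝ) * (N - i)!) * h ^ N := by
                rw [show h ^ N = h ^ i * h ^ (N - i) by rw [← pow_add]; congr 1; omega,
                  pow_succ]; ring
            _ ≤ _ := by gcongr; exact factorial_mul_le hi'.le
      _ = (C * ∑ i ∈ Finset.range N, D ^ i * C ^ (N - i)) * N ! * h ^ N := by
          rw [Finset.mul_sum, Finset.sum_mul, Finset.sum_mul]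
      _ ≤ _ := by gcongr; exact geo N
  calc _ ≤ 2 * (D ^ N / 2 * N ! * h ^ N) := by gcongr
    _ = D ^ N * N ! * h ^ N := by ring
    _ ≤ _ := by
      gcongr
      · linarith
      · omega

/-- The quotient `(f - a 0) / h`. -/
theorem tail (hf : Gevrey h₀ C f a) (hC : 1 ≤ C) :
    Gevrey h₀ (2 * C ^ 2) (fun h => (f h - a 0) / h) (fun j => a (j + 1)) := by
  have hC0 : 0 ≤ C := by linarith
  have key : ∀ j : ℕ, C ^ (j + 2) * (j + 1)! ≤ (2 * C ^ 2) ^ (j + 1) * j ! := by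
    intro j
    have h1 : (j + 1 : ℝ) ≤ 2 ^ (j + 1) := by exact_mod_cast (Nat.lt_two_pow_self (n := j + 1)).le
    have h2 : C ^ (j + 2) ≤ C ^ (2 * (j + 1)) := pow_le_pow_right₀ hC (by omega)
    rw [mul_pow, ← pow_mul, Nat.factorial_succ]
    push_cast
    calc _ = (j + 1 : ℝ) * C ^ (j + 2) * j ! := by ring
      _ ≤ _ := by gcongr
  refine ⟨fun j => (hf.coeff _).trans (key j), fun N h h0 h1 => ?_⟩
  have hne : (h : ℂ) ≠ 0 := by exact_mod_cast h0.ne'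
  have e : (f h - a 0) / h - ∑ j ∈ Finset.range N, a (j + 1) * (h : ℂ) ^ j
      = (f h - ∑ j ∈ Finset.range (N + 1), a j * (h : ℂ) ^ j) / h := by
    rw [Finset.sum_range_succ', eq_div_iff hne, sub_mul, div_mul_cancel₀ _ hne, Finset.sum_mul]
    simp only [pow_succ, pow_zero, mul_one, mul_assoc]
    ring
  rw [e, norm_div, Complex.norm_real, Real.norm_of_nonneg h0.le, div_le_iff₀ h0]
  refine (hf.rem (N + 1) h h0 h1).trans ?_
  have := mul_le_mul_of_nonneg_right (key N) (pow_nonneg h0.le (N + 1))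
  calc _ = C ^ (N + 2) * (N + 1)! * h ^ (N + 1) := by ring
    _ ≤ _ := this
    _ = _ := by ring

theorem const_mul (hf : Gevrey h₀ C f a) (z : ℂ) (hz : ‖z‖ = 1) :
    Gevrey h₀ C (fun h => z * f h) (fun j => z * a j) where
  coeff j := by simpa [hz] using hf.coeff j
  rem N h h0 h1 := by
    have := hf.rem N h h0 h1
    have e : z * f h - ∑ j ∈ Finset.range N, z * a j * (h : ℂ) ^ j
        = z * (f h - ∑ j ∈ Finset.range N, a j * (h : ℂ) ^ j) := by
      rw [mul_sub, Finset.mul_sum]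
      simp only [mul_assoc]
    rwa [e, norm_mul, hz, one_mul]

/-- A Gevrey-1 expansion on `(0, h₀)` makes the function, cut off to `0` beyond `h₀`,
a classical analytic symbol. -/
theorem isCAS (hf : Gevrey h₀ C f a) (hC : 0 < C) (hh : 0 < h₀) :
    IsCAS fun h => if h < h₀ then f h else 0 := by
  refine ⟨0, a, C, hC, fun j => (hf.coeff j).trans ?_, fun C₁ hC₁ => ?_⟩
  · gcongr
    exact_mod_cast Nat.factorial_le_pow j
  have hC₁0 : 0 < C₁ := hC.trans hC₁
  have he : 0 < Real.exp 1 := Real.exp_pos 1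
  set ρ : ℝ := 1 / (Real.exp 1 * C₁) with hρ
  have hρ0 : 0 < ρ := by positivity
  set B : ℝ := ∑ j ∈ Finset.range (⌊ρ / h₀⌋₊ + 1), ‖a j‖ with hB
  have hB0 : 0 ≤ B := Finset.sum_nonneg fun _ _ => norm_nonneg _
  refine ⟨ρ, hρ0, C ^ 2 * (ρ + 1) * Real.exp 1 + B * Real.exp (ρ / h₀), fun h h0 h1 => ?_⟩
  have hn : 1 / (h * Real.exp 1 * C₁) = ρ / h := by rw [hρ]; field_simp
  simp only [hn, zero_add]
  set n := ⌊ρ / h⌋₊ with hndef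
  have hn1 : (n : ℝ) ≤ ρ / h := Nat.floor_le (by positivity)
  have hn2 : ρ / h < n + 1 := Nat.lt_floor_add_one _
  have hnh : (n : ℝ) * h ≤ ρ := by rwa [le_div_iff₀ h0] at hn1
  by_cases hlt : h < h₀
  · rw [if_pos hlt]
    refine (hf.rem (n + 1) h h0 hlt).trans ?_
    have h3 : C * (n * h) ≤ Real.exp (-1) := by
      calc C * (n * h) ≤ C₁ * ρ := by gcongr
        _ = Real.exp (-1) := by rw [hρ, Real.exp_neg]; field_simp
    have h4 : (C * (n * h)) ^ n ≤ Real.exp 1 * Real.exp (-ρ / h) := by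
      calc (C * (n * h)) ^ n ≤ Real.exp (-1) ^ n := by gcongr
        _ = Real.exp (-n) := by rw [← Real.exp_nat_mul]; ring_nf
        _ ≤ Real.exp (1 + -ρ / h) := Real.exp_le_exp.2 (by rw [neg_div]; linarith)
        _ = _ := Real.exp_add _ _
    calc C ^ (n + 1 + 1) * (n + 1)! * h ^ (n + 1)
        = C ^ 2 * ((n + 1) * h) * (C ^ n * n ! * h ^ n) := by
          rw [Nat.factorial_succ]; push_cast; ring
      _ ≤ C ^ 2 * (ρ + 1) * (C ^ n * (n : ℝ) ^ n * h ^ n) := by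
          gcongr
          · linarith
          · exact_mod_cast Nat.factorial_le_pow n
      _ = C ^ 2 * (ρ + 1) * (C * (n * h)) ^ n := by simp only [mul_pow]; ring
      _ ≤ C ^ 2 * (ρ + 1) * (Real.exp 1 * Real.exp (-ρ / h)) := by gcongr
      _ = C ^ 2 * (ρ + 1) * Real.exp 1 * Real.exp (-ρ / h) := by ring
      _ ≤ _ := by
        gcongr
        have : 0 ≤ B * Real.exp (ρ / h₀) := by positivity
        linarith
  · rw [if_neg hlt, zero_sub, norm_neg]
    rw [not_lt] at hlt
    have h5 : ‖∑ j ∈ Finset.range (n + 1), a j * (h : ℂ) ^ j‖ ≤ B := by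
      calc _ ≤ ∑ j ∈ Finset.range (n + 1), ‖a j‖ := by
            refine (norm_sum_le _ _).trans (Finset.sum_le_sum fun j _ => ?_)
            rw [norm_mul, norm_pow, Complex.norm_real, Real.norm_of_nonneg h0.le]
            exact mul_le_of_le_one_right (norm_nonneg _) (pow_le_one₀ h0.le h1.le)
        _ ≤ B := by
            refine Finset.sum_le_sum_of_subset_of_nonneg ?_ fun _ _ _ => norm_nonneg _
            refine Finset.range_subset_range.2 (Nat.succ_le_succ (Nat.floor_le_floor ?_))
            gcongr
    have h6 : 1 ≤ Real.exp (ρ / h₀) * Real.exp (-ρ / h) := by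
      rw [← Real.exp_add, Real.one_le_exp_iff]
      have : ρ / h ≤ ρ / h₀ := by gcongr
      rw [neg_div]; linarith
    calc _ ≤ B * 1 := by simpa using h5
      _ ≤ B * (Real.exp (ρ / h₀) * Real.exp (-ρ / h)) := by gcongr
      _ ≤ _ := by
        rw [add_mul, ← mul_assoc]
        have : 0 ≤ C ^ 2 * (ρ + 1) * Real.exp 1 * Real.exp (-ρ / h) := by positivity
        linarith

end Gevrey

end

section

/-- The half strip `{-r < Re s, |Im s| < r}`. -/
def HS (r : ℝ) : Set ℂ := {s | -r < s.re ∧ |s.im| < r}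

theorem isOpen_HS (r : ℝ) : IsOpen (HS r) :=
  (isOpen_lt continuous_const continuous_re).inter
    (isOpen_lt (continuous_abs.comp continuous_im) continuous_const)

theorem HS_mono {r r' : ℝ} (h : r ≤ r') : HS r ⊆ HS r' := fun s hs =>
  ⟨by linarith [hs.1], hs.2.trans_le h⟩

theorem convex_HS (r : ℝ) : Convex ℝ (HS r) := by
  have : HS r = re ⁻¹' Ioi (-r) ∩ im ⁻¹' Ioo (-r) r := by
    ext s; simp [HS, abs_lt]
  rw [this]
  exact ((convex_Ioi _).linear_preimage reLm).inter ((convex_Ioo _ _).linear_preimage imLm)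

theorem ofReal_mem_HS {r s : ℝ} (hr : 0 < r) (hs : 0 ≤ s) : (s : ℂ) ∈ HS r := by
  constructor <;> simp <;> linarith

theorem add_ofReal_mem_HS {r t : ℝ} {s : ℂ} (hs : s ∈ HS r) (ht : 0 ≤ t) : s + t ∈ HS r := by
  have h1 := hs.1
  have h2 := hs.2
  constructor <;> simp <;> linarith

theorem closedBall_subset_HS {σ d : ℝ} {s : ℂ} (hs : s ∈ HS σ) :
    Metric.closedBall s d ⊆ HS (σ + d) := by
  intro z hz
  rw [Metric.mem_closedBall, dist_eq_norm] at hz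
  have h1 := (abs_re_le_norm (z - s)).trans hz
  have h2 := (abs_im_le_norm (z - s)).trans hz
  have h3 := hs.1
  have h4 := hs.2
  simp only [sub_re, sub_im, abs_le] at h1 h2
  rw [abs_lt] at h4
  exact ⟨by linarith, by rw [abs_lt]; constructor <;> linarith⟩

theorem exists_mem_HS {r : ℝ} {s : ℂ} (hs : s ∈ HS r) : ∃ σ < r, s ∈ HS σ := by
  have h1 := hs.1
  have h2 := hs.2
  refine ⟨(r + max (-s.re) |s.im|) / 2, ?_, ?_, ?_⟩
  · have : max (-s.re) |s.im| < r := max_lt (by linarith) h2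
    linarith
  · have := le_max_left (-s.re) |s.im|
    linarith
  · have := le_max_right (-s.re) |s.im|
    linarith

theorem pos_of_mem_HS {r : ℝ} {s : ℂ} (hs : s ∈ HS r) : 0 < r := (abs_nonneg _).trans_lt hs.2

/-- `(x+2)^{-δ}` at nearby points is comparable. -/
theorem rpow_shift_le {δ x y : ℝ} (hδ : 0 ≤ δ) (hx : -1 ≤ x) (h : x - 1 / 2 ≤ y) :
    (y + 2) ^ (-δ) ≤ 2 ^ δ * (x + 2) ^ (-δ) := by
  have h1 : 0 < (x + 2) / 2 := by linarith
  calc (y + 2) ^ (-δ) ≤ ((x + 2) / 2) ^ (-δ) :=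
        Real.rpow_le_rpow_of_nonpos h1 (by linarith) (by linarith)
    _ = _ := by
      rw [Real.div_rpow (by linarith) (by norm_num), Real.rpow_neg (by norm_num : (0 : ℝ) ≤ 2),
        div_inv_eq_mul, mul_comm]

theorem norm_deriv_le_HS {σ σ' B δ : ℝ} {f : ℂ → ℂ} (hδ : 0 ≤ δ) (hB : 0 ≤ B) (h1 : σ < σ')
    (h2 : σ' ≤ 1 / 2)
    (hf : DifferentiableOn ℂ f (HS σ')) (hb : ∀ s ∈ HS σ', ‖f s‖ ≤ B * (s.re + 2) ^ (-δ))
    {s : ℂ} (hs : s ∈ HS σ) : ‖deriv f s‖ ≤ 2 ^ δ * B * (s.re + 2) ^ (-δ) / (σ' - σ) := by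
  have hσ := pos_of_mem_HS hs
  have hsub : Metric.closedBall s (σ' - σ) ⊆ HS σ' := by
    have := closedBall_subset_HS (d := σ' - σ) hs
    rwa [add_sub_cancel] at this
  refine Complex.norm_deriv_le_of_forall_mem_sphere_norm_le (by linarith)
    ((hf.mono hsub).diffContOnCl_ball subset_rfl) fun z hz => ?_
  refine (hb z (hsub (Metric.sphere_subset_closedBall hz))).trans ?_
  have h3 := hs.1
  have hz' : |(z - s).re| ≤ σ' - σ := by
    refine (abs_re_le_norm _).trans ?_
    rw [mem_sphere_iff_norm] at hz
    exact hz.le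
  rw [sub_re, abs_le] at hz'
  calc B * (z.re + 2) ^ (-δ) ≤ B * (2 ^ δ * (s.re + 2) ^ (-δ)) := by
        gcongr
        exact rpow_shift_le hδ (by linarith) (by linarith)
    _ = _ := by ring

theorem tendsto_rpow_shift {δ : ℝ} (hδ : 0 < δ) (x : ℝ) :
    Tendsto (fun t : ℝ => (x + t + 2) ^ (-δ)) atTop (𝓝 0) := by
  refine (tendsto_rpow_neg_atTop hδ).comp ?_
  exact tendsto_atTop_add_const_right _ _ (tendsto_atTop_add_const_left _ _ tendsto_id)

/-- A primitive of `(x+t+2)^{-δ}`. -/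
noncomputable def kprim (δ x t : ℝ) : ℝ := -((x + t + 2) ^ (1 - δ) / (δ - 1))

theorem hasDerivAt_kprim {δ x t : ℝ} (hδ : 1 < δ) (h : 0 < x + t + 2) :
    HasDerivAt (kprim δ x) ((x + t + 2) ^ (-δ)) t := by
  have h1 : HasDerivAt (fun t : ℝ => x + t + 2) 1 t := ((hasDerivAt_id t).const_add x).add_const 2
  have h2 := ((h1.rpow_const (p := 1 - δ) (Or.inl h.ne')).div_const (δ - 1)).neg
  have h3 : δ - 1 ≠ 0 := by linarith
  refine HasDerivAt.congr_deriv (f := kprim δ x) h2 ?_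
  rw [show 1 - δ - 1 = -δ by ring]
  field_simp
  ring

theorem tendsto_kprim {δ : ℝ} (hδ : 1 < δ) (x : ℝ) : Tendsto (kprim δ x) atTop (𝓝 0) := by
  have := ((tendsto_rpow_shift (δ := δ - 1) (by linarith) x).div_const (δ - 1)).neg
  change Tendsto (fun t => -((x + t + 2) ^ (1 - δ) / (δ - 1))) atTop (𝓝 0)
  simpa [neg_sub] using this

theorem integrableOn_rpow_shift {δ x : ℝ} (hδ : 1 < δ) (hx : -2 < x) :
    IntegrableOn (fun t : ℝ => (x + t + 2) ^ (-δ)) (Ioi 0) :=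
  integrableOn_Ioi_deriv_of_nonneg' (g := kprim δ x)
    (fun t ht => hasDerivAt_kprim hδ (by linarith [mem_Ici.1 ht]))
    (fun t ht => Real.rpow_nonneg (by linarith [mem_Ioi.1 ht]) _) (tendsto_kprim hδ x)

theorem integral_rpow_shift {δ x : ℝ} (hδ : 1 < δ) (hx : -2 < x) :
    ∫ t in Ioi (0 : ℝ), (x + t + 2) ^ (-δ) = (x + 2) ^ (1 - δ) / (δ - 1) := by
  rw [integral_Ioi_of_hasDerivAt_of_nonneg' (g := kprim δ x)
    (fun t ht => hasDerivAt_kprim hδ (by linarith [mem_Ici.1 ht]))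
    (fun t ht => Real.rpow_nonneg (by linarith [mem_Ioi.1 ht]) _) (tendsto_kprim hδ x)]
  simp [kprim]

/-- The ray integral `∫_0^∞ f (s + t) dt`. -/
noncomputable def rayInt (f : ℂ → ℂ) (s : ℂ) : ℂ := ∫ t in Ioi (0 : ℝ), f (s + t)

theorem norm_rayInt_le {σ B δ : ℝ} {f : ℂ → ℂ} (hδ : 1 < δ) (hσ : σ ≤ 1 / 2)
    (hb : ∀ s ∈ HS σ, ‖f s‖ ≤ B * (s.re + 2) ^ (-δ)) {s : ℂ} (hs : s ∈ HS σ) :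
    ‖rayInt f s‖ ≤ B * ((s.re + 2) ^ (1 - δ) / (δ - 1)) := by
  have hx : -2 < s.re := by linarith [hs.1]
  rw [← integral_rpow_shift hδ hx, ← integral_const_mul]
  refine norm_integral_le_of_norm_le ((integrableOn_rpow_shift hδ hx).const_mul B) ?_
  refine (ae_restrict_mem measurableSet_Ioi).mono fun t ht => ?_
  simpa using hb _ (add_ofReal_mem_HS hs (le_of_lt ht))

theorem continuousOn_ray {σ : ℝ} {f : ℂ → ℂ} (hf : ContinuousOn f (HS σ)) {s : ℂ}
    (hs : s ∈ HS σ) : ContinuousOn (fun t : ℝ => f (s + t)) (Ici 0) :=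
  hf.comp (by fun_prop) fun t ht => add_ofReal_mem_HS hs ht

theorem hasDerivAt_rayInt {σ B δ : ℝ} {f : ℂ → ℂ} (hδ : 1 < δ) (hσ : σ ≤ 1 / 2)
    (hf : DifferentiableOn ℂ f (HS σ))
    (hb : ∀ s ∈ HS σ, ‖f s‖ ≤ B * (s.re + 2) ^ (-δ)) {s : ℂ} (hs : s ∈ HS σ) :
    HasDerivAt (rayInt f) (-f s) s := by
  have hB : 0 ≤ B := by
    have h1 := (norm_nonneg _).trans (hb s hs)
    have h2 : 0 < (s.re + 2) ^ (-δ) := Real.rpow_pos_of_pos (by linarith [hs.1]) _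
    exact nonneg_of_mul_nonneg_left h1 h2
  obtain ⟨τ, hτσ, hτ⟩ := exists_mem_HS hs
  have hτ0 := pos_of_mem_HS hτ
  have hx : -2 < s.re := by linarith [hs.1]
  have hdiff : ∀ z ∈ HS σ, DifferentiableAt ℂ f z := fun z hz =>
    hf.differentiableAt ((isOpen_HS σ).mem_nhds hz)
  set τ' := (τ + σ) / 2
  set M := 2 ^ δ * (2 ^ δ * B) / (σ - τ')
  have hball : Metric.ball s (τ' - τ) ⊆ HS τ' := by
    have := (Metric.ball_subset_closedBall).trans (closedBall_subset_HS (d := τ' - τ) hτ)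
    rwa [add_sub_cancel] at this
  have hτ'σ : τ' < σ := by simp only [τ']; linarith
  have hττ' : τ < τ' := by simp only [τ']; linarith
  have hcont : ∀ z ∈ HS σ, AEStronglyMeasurable (fun t : ℝ => f (z + t))
      (volume.restrict (Ioi 0)) := fun z hz =>
    ((continuousOn_ray hf.continuousOn hz).mono Ioi_subset_Ici_self).aestronglyMeasurable
      measurableSet_Ioi
  have hfd : DifferentiableOn ℂ (deriv f) (HS σ) := hf.deriv (isOpen_HS σ)
  have main := hasDerivAt_integral_of_dominated_loc_of_deriv_le (𝕜 := ℂ)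
    (μ := volume.restrict (Ioi (0 : ℝ))) (F := fun z (t : ℝ) => f (z + t))
    (F' := fun z (t : ℝ) => deriv f (z + t)) (x₀ := s) (s := Metric.ball s (τ' - τ))
    (bound := fun t => M * (s.re + t + 2) ^ (-δ))
    (Metric.ball_mem_nhds _ (by linarith))
    (by
      filter_upwards [(isOpen_HS σ).mem_nhds hs] with z hz using hcont z hz)
    (by
      refine Integrable.mono' ((integrableOn_rpow_shift hδ hx).const_mul B) (hcont s hs) ?_
      refine (ae_restrict_mem measurableSet_Ioi).mono fun t ht => ?_
      simpa using hb _ (add_ofReal_mem_HS hs (le_of_lt ht)))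
    (((continuousOn_ray hfd.continuousOn hs).mono Ioi_subset_Ici_self).aestronglyMeasurable
      measurableSet_Ioi)
    (by
      refine (ae_restrict_mem measurableSet_Ioi).mono fun t ht z hz => ?_
      have ht0 : (0 : ℝ) ≤ t := le_of_lt ht
      have h1 := norm_deriv_le_HS (by linarith) hB hτ'σ hσ hf hb
        (add_ofReal_mem_HS (hball hz) ht0)
      refine h1.trans ?_
      have h2 : |(z - s).re| < τ' - τ := (abs_re_le_norm _).trans_lt (mem_ball_iff_norm.1 hz)
      rw [sub_re, abs_lt] at h2
      have h3 := rpow_shift_le (δ := δ) (x := s.re + t) (y := (z + t).re) (by linarith)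
        (by linarith [hs.1]) (by simp; linarith)
      have h4 : 0 < σ - τ' := by linarith
      calc _ ≤ 2 ^ δ * B * (2 ^ δ * (s.re + t + 2) ^ (-δ)) / (σ - τ') := by gcongr
        _ = _ := by simp only [M]; ring)
    ((integrableOn_rpow_shift hδ hx).const_mul M)
    (by
      refine (ae_restrict_mem measurableSet_Ioi).mono fun t ht z hz => ?_
      have := (hdiff _ (HS_mono hτ'σ.le (add_ofReal_mem_HS (hball hz) (le_of_lt ht)))).hasDerivAt
      exact this.comp_add_const z t)
  have hval : ∫ t in Ioi (0 : ℝ), deriv f (s + t) = -f s := by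
    have h1 := integral_Ioi_of_hasDerivAt_of_tendsto (f := fun t : ℝ => f (s + t))
      (f' := fun t : ℝ => deriv f (s + t)) (a := 0) (m := 0)
      ((continuousOn_ray hf.continuousOn hs) 0 self_mem_Ici)
      (fun t ht => by
        have h2 := (hdiff _ (add_ofReal_mem_HS hs (le_of_lt ht))).hasDerivAt
        have h3 : HasDerivAt (fun t : ℝ => s + (t : ℂ)) 1 t :=
          (ofRealCLM.hasDerivAt (x := t)).const_add s
        simpa [Function.comp_def] using h2.comp t h3)
      main.1
      (by
        refine squeeze_zero_norm' ?_
          (by simpa using (tendsto_rpow_shift (by linarith : 0 < δ) s.re).const_mul B)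
        filter_upwards [eventually_ge_atTop 0] with t ht
        simpa using hb _ (add_ofReal_mem_HS hs ht))
    rw [h1]; simp
  rw [← hval]
  exact main.2

end

section

/-- Data of the model system `e' = -q o`, `o' = (2i/h) P o - q e`. -/
structure CoreData (r δ c₀ C₀ G : ℝ) (P q : ℂ → ℂ) : Prop where
  r_pos : 0 < r
  r_le : r ≤ 1 / 2
  δ_gt : 1 < δ
  c₀_pos : 0 < c₀
  G_nonneg : 0 ≤ G
  P_diff : DifferentiableOn ℂ P (HS r)
  q_diff : DifferentiableOn ℂ q (HS r)
  P_ge : ∀ s ∈ HS r, c₀ ≤ ‖P s‖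
  P_le : ∀ s ∈ HS r, ‖P s‖ ≤ C₀
  q_le : ∀ s ∈ HS r, ‖q s‖ ≤ G * (s.re + 2) ^ (-δ)
  P_im : ∀ s : ℝ, 0 ≤ s → (P s).im ≤ 0

/-- The formal solution, as pairs `(e_j, o_j)`. -/
noncomputable def formal (P q : ℂ → ℂ) : ℕ → (ℂ → ℂ) × (ℂ → ℂ)
  | 0 => (fun _ => 1, fun _ => 0)
  | j + 1 =>
    let o := fun s => (deriv (formal P q j).2 s + q s * (formal P q j).1 s) / (2 * I * P s)
    (rayInt fun s => q s * o s, o)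

theorem formal_zero (P q : ℂ → ℂ) : formal P q 0 = (fun _ => 1, fun _ => 0) := by
  rw [formal]

theorem formal_succ_snd (P q : ℂ → ℂ) (j : ℕ) : (formal P q (j + 1)).2 =
    fun s => (deriv (formal P q j).2 s + q s * (formal P q j).1 s) / (2 * I * P s) := by
  rw [formal]

theorem formal_succ_fst (P q : ℂ → ℂ) (j : ℕ) : (formal P q (j + 1)).1 =
    rayInt fun s => q s * (formal P q (j + 1)).2 s := by
  rw [formal_succ_snd, formal]

namespace CoreData

variable {r δ c₀ C₀ G : ℝ} {P q : ℂ → ℂ}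

theorem P_ne (H : CoreData r δ c₀ C₀ G P q) {s : ℂ} (hs : s ∈ HS r) : P s ≠ 0 := fun h => by
  have := H.P_ge s hs
  rw [h, norm_zero] at this
  linarith [H.c₀_pos]

theorem rpow_le_one {x : ℝ} (hδ : 1 < δ) (hx : -1 ≤ x) : (x + 2) ^ (-δ) ≤ 1 :=
  Real.rpow_le_one_of_one_le_of_nonpos (by linarith) (by linarith)

/-- Holomorphy and factorial bounds for the formal solution. -/
theorem formal_bound (H : CoreData r δ c₀ C₀ G P q) (j : ℕ) :
    DifferentiableOn ℂ (formal P q j).1 (HS r) ∧ DifferentiableOn ℂ (formal P q j).2 (HS r) ∧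
    ∀ σ < r, ∀ s ∈ HS σ,
      ‖(formal P q j).1 s‖ ≤ max 1 (G / (δ - 1)) *
        ((2 ^ δ + G * max 1 (G / (δ - 1))) / (2 * c₀) * j / (r - σ)) ^ j ∧
      ‖(formal P q j).2 s‖ ≤
        ((2 ^ δ + G * max 1 (G / (δ - 1))) / (2 * c₀) * j / (r - σ)) ^ j * (s.re + 2) ^ (-δ) := by
  obtain ⟨hr, hr2, hδ, hc₀, hG, hPd, hqd, hPl, hPu, hqb, -⟩ := id H
  set I' := max 1 (G / (δ - 1)) with hI'
  set K := (2 ^ δ + G * I') / (2 * c₀) with hK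
  have hI1 : 1 ≤ I' := le_max_left _ _
  have hK0 : 0 ≤ K := by positivity
  induction j with
  | zero =>
    simp only [formal_zero]
    refine ⟨differentiableOn_const _, differentiableOn_const _, fun σ hσ s hs => ⟨?_, ?_⟩⟩
    · simpa using hI1
    · simpa using Real.rpow_nonneg (by linarith [hs.1] : 0 ≤ s.re + 2) (-δ)
  | succ j ih =>
    obtain ⟨ih1, ih2, ih3⟩ := ih
    have ho : DifferentiableOn ℂ (formal P q (j + 1)).2 (HS r) := by
      rw [formal_succ_snd]
      refine ((ih2.deriv (isOpen_HS r)).add (hqd.mul ih1)).div (hPd.const_mul _) fun s hs => ?_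
      simpa using H.P_ne hs
    have hob : ∀ σ < r, ∀ s ∈ HS σ, ‖(formal P q (j + 1)).2 s‖ ≤
        (K * (j + 1 : ℕ) / (r - σ)) ^ (j + 1) * (s.re + 2) ^ (-δ) := by
      intro σ hσ s hs
      have hσ0 := pos_of_mem_HS hs
      have hsr := HS_mono hσ.le hs
      have hrσ : 0 < r - σ := by linarith
      have hj1 : (0 : ℝ) < j + 1 := by positivity
      have hk0 : 0 ≤ (s.re + 2) ^ (-δ) := Real.rpow_nonneg (by linarith [hs.1]) _
      set L := K * (j + 1) / (r - σ) with hL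
      have hL0 : 0 ≤ L := by positivity
      set σ' := σ + (r - σ) / (j + 1) with hσ'
      have e1 : σ' - σ = (r - σ) / (j + 1) := by rw [hσ']; ring
      have e2 : r - σ' = (r - σ) * j / (j + 1) := by rw [hσ']; field_simp; ring
      have hσσ' : σ < σ' := by
        have : 0 < (r - σ) / (j + 1) := by positivity
        linarith
      have ih4 : (K * j / (r - σ')) ^ j = L ^ j := by
        rcases Nat.eq_zero_or_pos j with rfl | hj
        · simp
        · have hj' : (0 : ℝ) < j := by exact_mod_cast hj
          rw [e2, hL]; congr 1; field_simp
      have d1 : ‖deriv (formal P q j).2 s‖ ≤ 2 ^ δ * L ^ j * (s.re + 2) ^ (-δ) / (σ' - σ) := by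
        rcases Nat.eq_zero_or_pos j with rfl | hj
        · simp only [formal_zero, deriv_const, norm_zero]
          have : 0 < σ' - σ := by linarith
          positivity
        have hj' : (0 : ℝ) < j := by exact_mod_cast hj
        have hσ'r : σ' < r := by
          have : 0 < (r - σ) * j / (j + 1) := by positivity
          linarith
        refine norm_deriv_le_HS (by linarith) (by positivity) hσσ' (by linarith)
          (ih2.mono (HS_mono hσ'r.le)) (fun z hz => ?_) hs
        rw [← ih4]
        exact (ih3 σ' hσ'r z hz).2
      have d2 : ‖q s * (formal P q j).1 s‖ ≤
          G * I' * L ^ j * (s.re + 2) ^ (-δ) / (σ' - σ) := by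
        rw [norm_mul]
        have h1 := (ih3 σ hσ s hs).1
        have h2 : (K * j / (r - σ)) ^ j ≤ L ^ j := by
          rw [hL]; gcongr; linarith
        have h3 : σ' - σ ≤ 1 := by
          rw [e1, div_le_one hj1]
          have : (0 : ℝ) ≤ j := by positivity
          linarith
        rw [le_div_iff₀ (by linarith)]
        calc ‖q s‖ * ‖(formal P q j).1 s‖ * (σ' - σ)
            ≤ (G * (s.re + 2) ^ (-δ)) * (I' * L ^ j) * 1 := by
              gcongr
              · exact hqb s hsr
              · exact h1.trans (by gcongr)
          _ = _ := by ring
      rw [formal_succ_snd]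
      simp only [norm_div, norm_mul, Complex.norm_ofNat, norm_I, mul_one]
      have hP0 : 0 < ‖P s‖ := hc₀.trans_le (hPl s hsr)
      rw [div_le_iff₀ (by positivity)]
      calc _ ≤ 2 ^ δ * L ^ j * (s.re + 2) ^ (-δ) / (σ' - σ)
            + G * I' * L ^ j * (s.re + 2) ^ (-δ) / (σ' - σ) := (norm_add_le _ _).trans
              (add_le_add d1 d2)
        _ = (L ^ (j + 1) * (s.re + 2) ^ (-δ)) * (2 * c₀) := by
          rw [e1, pow_succ]
          nth_rewrite 4 [hL]
          rw [hK]
          field_simp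
        _ ≤ L ^ (j + 1) * (s.re + 2) ^ (-δ) * (2 * ‖P s‖) := by
          gcongr
          exact hPl s hsr
        _ = _ := by rw [hL]; push_cast; ring
    have hqo : ∀ σ < r, ∀ s ∈ HS σ, ‖q s * (formal P q (j + 1)).2 s‖ ≤
        (G * (K * (j + 1 : ℕ) / (r - σ)) ^ (j + 1)) * (s.re + 2) ^ (-δ) := by
      intro σ hσ s hs
      have hσ0 := pos_of_mem_HS hs
      have hrσ : 0 < r - σ := by linarith
      have hk0 : 0 ≤ (s.re + 2) ^ (-δ) := Real.rpow_nonneg (by linarith [hs.1]) _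
      have hk1 : (s.re + 2) ^ (-δ) ≤ 1 := rpow_le_one hδ (by linarith [hs.1])
      rw [norm_mul]
      calc _ ≤ (G * 1) * ((K * (j + 1 : ℕ) / (r - σ)) ^ (j + 1) * (s.re + 2) ^ (-δ)) := by
            gcongr
            · exact (hqb s (HS_mono hσ.le hs)).trans (by gcongr)
            · exact hob σ hσ s hs
        _ = _ := by ring
    refine ⟨?_, ho, fun σ hσ s hs => ⟨?_, hob σ hσ s hs⟩⟩
    · intro s hs
      obtain ⟨σ, hσ, hs'⟩ := exists_mem_HS hs
      rw [formal_succ_fst]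
      exact (hasDerivAt_rayInt hδ (by linarith)
        ((hqd.mul ho).mono (HS_mono hσ.le)) (hqo σ hσ) hs').differentiableAt.differentiableWithinAt
    · rw [formal_succ_fst]
      have hσ0 := pos_of_mem_HS hs
      have hrσ : 0 < r - σ := by linarith
      refine (norm_rayInt_le hδ (by linarith) (hqo σ hσ) hs).trans ?_
      have hδ1 : 0 < δ - 1 := by linarith
      have h1 : (s.re + 2) ^ (1 - δ) ≤ 1 :=
        Real.rpow_le_one_of_one_le_of_nonpos (by linarith [hs.1]) (by linarith)
      calc _ ≤ G * (K * (j + 1 : ℕ) / (r - σ)) ^ (j + 1) * (1 / (δ - 1)) := by gcongr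
        _ = G / (δ - 1) * (K * (j + 1 : ℕ) / (r - σ)) ^ (j + 1) := by ring
        _ ≤ _ := by gcongr; exact le_max_right _ _

/-- Growth constant of the formal solution on the real half line. -/
noncomputable def rate (r δ c₀ G : ℝ) : ℝ :=
  (2 ^ δ + G * max 1 (G / (δ - 1))) / (2 * c₀) * (2 / r)

open scoped Nat in
theorem formal_bound_real (H : CoreData r δ c₀ C₀ G P q) (j : ℕ) {s : ℝ} (hs : 0 ≤ s) :
    ‖(formal P q j).1 s‖ ≤
      max 1 (G / (δ - 1)) * ((rate r δ c₀ G * Real.exp 1) ^ j * (j !)) ∧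
    ‖(formal P q j).2 s‖ ≤ (rate r δ c₀ G * Real.exp 1) ^ j * (j !) * (s + 2) ^ (-δ) := by
  obtain ⟨hr, hr2, hδ, hc₀, hG, -⟩ := id H
  have h1 := (H.formal_bound j).2.2 (r / 2) (by linarith) s (ofReal_mem_HS (by linarith) hs)
  have h0 : 0 ≤ rate r δ c₀ G := by unfold rate; positivity
  have h2 : ((2 ^ δ + G * max 1 (G / (δ - 1))) / (2 * c₀) * j / (r - r / 2)) ^ j
      ≤ (rate r δ c₀ G * Real.exp 1) ^ j * (j !) := by
    have e : (2 ^ δ + G * max 1 (G / (δ - 1))) / (2 * c₀) * j / (r - r / 2)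
        = rate r δ c₀ G * j := by unfold rate; field_simp; ring
    have h3 := Real.pow_div_factorial_le_exp (j : ℝ) (by positivity) j
    rw [div_le_iff₀ (by positivity)] at h3
    rw [e, mul_pow, mul_pow, mul_assoc]
    gcongr
    rwa [← Real.exp_nat_mul, mul_one]
  rw [ofReal_re] at h1
  refine ⟨h1.1.trans ?_, h1.2.trans ?_⟩
  · gcongr
  · have : 0 ≤ (s + 2) ^ (-δ) := Real.rpow_nonneg (by linarith) _
    gcongr

theorem hasDerivAt_formal_fst (H : CoreData r δ c₀ C₀ G P q) (j : ℕ) {s : ℝ} (hs : 0 ≤ s) :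
    HasDerivAt (fun t : ℝ => (formal P q j).1 t) (-(q s * (formal P q j).2 s)) s := by
  obtain ⟨hr, hr2, hδ, hc₀, hG, hPd, hqd, hPl, hPu, hqb, -⟩ := id H
  cases j with
  | zero => simpa [formal_zero] using hasDerivAt_const s (1 : ℂ)
  | succ j =>
    have hr' : (r / 2) < r := by linarith
    have hb := H.formal_bound (j + 1)
    set B := ((2 ^ δ + G * max 1 (G / (δ - 1))) / (2 * c₀) * (j + 1 : ℕ) / (r - r / 2)) ^ (j + 1)
    have hB : 0 ≤ B := by
      have : 0 < r - r / 2 := by linarith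
      positivity
    have h1 := hasDerivAt_rayInt (σ := r / 2) (B := G * B) hδ (by linarith)
      ((hqd.mul hb.2.1).mono (HS_mono hr'.le)) (fun z hz => by
        have hk0 : 0 ≤ (z.re + 2) ^ (-δ) := Real.rpow_nonneg (by linarith [hz.1]) _
        have hk1 : (z.re + 2) ^ (-δ) ≤ 1 := rpow_le_one hδ (by linarith [hz.1])
        simp only [Pi.mul_apply, norm_mul]
        calc _ ≤ (G * 1) * (B * (z.re + 2) ^ (-δ)) := by
              gcongr
              · exact (hqb z (HS_mono hr'.le hz)).trans (by gcongr)
              · exact (hb.2.2 _ hr' z hz).2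
          _ = _ := by ring) (ofReal_mem_HS (by linarith) hs)
    rw [formal_succ_fst]
    exact h1.comp_ofReal

theorem hasDerivAt_formal_snd (H : CoreData r δ c₀ C₀ G P q) (j : ℕ) {s : ℝ} (hs : 0 ≤ s) :
    HasDerivAt (fun t : ℝ => (formal P q j).2 t)
      (2 * I * P s * (formal P q (j + 1)).2 s - q s * (formal P q j).1 s) s := by
  have hmem := ofReal_mem_HS H.r_pos hs
  have h1 := ((H.formal_bound j).2.1.differentiableAt
    ((isOpen_HS r).mem_nhds hmem)).hasDerivAt.comp_ofReal
  refine h1.congr_deriv ?_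
  have h2 := H.P_ne hmem
  rw [formal_succ_snd]
  have hI := I_ne_zero
  field_simp
  ring

theorem tendsto_formal_fst (H : CoreData r δ c₀ C₀ G P q) (j : ℕ) :
    Tendsto (fun s : ℝ => (formal P q j).1 s) atTop (𝓝 (if j = 0 then 1 else 0)) := by
  obtain ⟨hr, hr2, hδ, hc₀, hG, hPd, hqd, hPl, hPu, hqb, -⟩ := id H
  cases j with
  | zero => simp [formal_zero]
  | succ j =>
    have hr' : (r / 2) < r := by linarith
    have hb := H.formal_bound (j + 1)
    set B := ((2 ^ δ + G * max 1 (G / (δ - 1))) / (2 * c₀) * (j + 1 : ℕ) / (r - r / 2)) ^ (j + 1)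
    have hB : 0 ≤ B := by
      have : 0 < r - r / 2 := by linarith
      positivity
    have hbd : ∀ z ∈ HS (r / 2), ‖q z * (formal P q (j + 1)).2 z‖ ≤ G * B * (z.re + 2) ^ (-δ) := by
      intro z hz
      have hk0 : 0 ≤ (z.re + 2) ^ (-δ) := Real.rpow_nonneg (by linarith [hz.1]) _
      have hk1 : (z.re + 2) ^ (-δ) ≤ 1 := rpow_le_one hδ (by linarith [hz.1])
      simp only [norm_mul]
      calc _ ≤ (G * 1) * (B * (z.re + 2) ^ (-δ)) := by
            gcongr
            · exact (hqb z (HS_mono hr'.le hz)).trans (by gcongr)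
            · exact (hb.2.2 _ hr' z hz).2
        _ = _ := by ring
    rw [formal_succ_fst, if_neg (Nat.succ_ne_zero j)]
    have hlim := (tendsto_kprim hδ 0).const_mul (-(G * B))
    rw [mul_zero] at hlim
    refine squeeze_zero_norm' ?_ hlim
    filter_upwards [eventually_ge_atTop 0] with s hs
    have := norm_rayInt_le hδ (by linarith) hbd (ofReal_mem_HS (by linarith) hs)
    refine this.trans (le_of_eq ?_)
    simp [kprim]

theorem tendsto_formal_snd (H : CoreData r δ c₀ C₀ G P q) (j : ℕ) :
    Tendsto (fun s : ℝ => (formal P q j).2 s) atTop (𝓝 0) := by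
  have hlim := (tendsto_rpow_shift (by linarith [H.δ_gt] : 0 < δ) 0).const_mul
    ((rate r δ c₀ G * Real.exp 1) ^ j * (j.factorial))
  rw [mul_zero] at hlim
  refine squeeze_zero_norm' ?_ hlim
  filter_upwards [eventually_ge_atTop 0] with s hs
  simpa using (H.formal_bound_real j hs).2

end CoreData

end

section

namespace CoreData

variable {r δ c₀ C₀ G : ℝ} {P q : ℂ → ℂ}

/-- Energy estimate, integrated from infinity. -/
theorem energy (H : CoreData r δ c₀ C₀ G P q) {h η : ℝ} (h0 : 0 < h)
    {E O f : ℝ → ℂ}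
    (hE : ∀ s : ℝ, 0 ≤ s → HasDerivAt E (-(q s * O s)) s)
    (hO : ∀ s : ℝ, 0 ≤ s → HasDerivAt O (2 * I / h * P s * O s - q s * E s + f s) s)
    (hf : ∀ s : ℝ, 0 ≤ s → ‖f s‖ ≤ η * (s + 2) ^ (-δ))
    (hE0 : Tendsto E atTop (𝓝 0)) (hO0 : Tendsto O atTop (𝓝 0)) :
    ‖E 0‖ ^ 2 + ‖O 0‖ ^ 2 ≤ η ^ 2 * Real.exp ((2 * G + 1) * (2 ^ (1 - δ) / (δ - 1))) := by
  obtain ⟨hr, hr2, hδ, hc₀, hG, hPd, hqd, hPl, hPu, hqb, him⟩ := id H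
  set X : ℝ → ℝ := fun s => ‖E s‖ ^ 2 + ‖O s‖ ^ 2 with hX
  set Y : ℝ → ℝ := fun s => Real.exp ((2 * G + 1) * kprim δ 0 s) * (X s + η ^ 2) with hY
  set X' : ℝ → ℝ := fun s => 2 * inner ℝ (E s) (-(q s * O s)) +
    2 * inner ℝ (O s) (2 * I / h * P s * O s - q s * E s + f s) with hX'
  have hXd : ∀ s : ℝ, 0 ≤ s → HasDerivAt X (X' s) s := fun s hs =>
    (hE s hs).norm_sq.add (hO s hs).norm_sq
  have hkd : ∀ s : ℝ, 0 ≤ s → HasDerivAt (kprim δ 0) ((s + 2) ^ (-δ)) s := fun s hs => by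
    simpa using hasDerivAt_kprim (x := 0) hδ (by linarith : 0 < 0 + s + 2)
  have hYd : ∀ s : ℝ, 0 ≤ s → HasDerivAt Y (Real.exp ((2 * G + 1) * kprim δ 0 s) *
      ((2 * G + 1) * (s + 2) ^ (-δ) * (X s + η ^ 2) + X' s)) s := fun s hs => by
    have := (((hkd s hs).const_mul (2 * G + 1)).exp).mul ((hXd s hs).add_const (η ^ 2))
    refine this.congr_deriv ?_
    ring
  have hXl : ∀ s : ℝ, 0 ≤ s → 0 ≤ (2 * G + 1) * (s + 2) ^ (-δ) * (X s + η ^ 2) + X' s := by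
    intro s hs
    set k := (s + 2) ^ (-δ) with hk
    have hk0 : 0 ≤ k := Real.rpow_nonneg (by linarith) _
    have hq : ‖q s‖ ≤ G * k := by simpa using hqb s (ofReal_mem_HS hr hs)
    have a1 : -(‖E s‖ * (G * k * ‖O s‖)) ≤ inner ℝ (E s) (-(q s * O s)) := by
      rw [inner_neg_right]
      refine neg_le_neg ((real_inner_le_norm _ _).trans ?_)
      rw [norm_mul]; gcongr
    have a2 : -(‖O s‖ * (G * k * ‖E s‖)) ≤ -inner ℝ (O s) (q s * E s) := by
      refine neg_le_neg ((real_inner_le_norm _ _).trans ?_)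
      rw [norm_mul]; gcongr
    have a3 : -(‖O s‖ * (η * k)) ≤ inner ℝ (O s) (f s) := by
      have := (abs_le.1 (abs_real_inner_le_norm (O s) (f s))).1
      have h2 : ‖O s‖ * ‖f s‖ ≤ ‖O s‖ * (η * k) := by gcongr; exact hf s hs
      linarith
    have a4 : 0 ≤ inner ℝ (O s) (2 * I / h * P s * O s) := by
      rw [Complex.inner]
      have : (starRingEnd ℂ) (O s) * (2 * I / h * P s * O s)
          = ((2 / h * ‖O s‖ ^ 2 : ℝ) : ℂ) * (I * P s) := by
        have h1 := Complex.conj_mul' (O s)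
        push_cast
        rw [← h1]; ring
      have h2 := him s hs
      rw [mul_comm (2 * I / h * P s * O s), this, re_ofReal_mul]
      simp only [I_mul_re]
      exact mul_nonneg (by positivity) (by linarith)
    have a5 : X' s = 2 * inner ℝ (E s) (-(q s * O s)) + 2 * (inner ℝ (O s) (2 * I / h * P s * O s)
        - inner ℝ (O s) (q s * E s) + inner ℝ (O s) (f s)) := by
      rw [hX']
      simp only [inner_add_right, inner_sub_right]
    have a6 : 0 ≤ k * G * (‖E s‖ - ‖O s‖) ^ 2 := by positivity
    have a7 : 0 ≤ k * (‖O s‖ - η) ^ 2 := by positivity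
    have a8 : 0 ≤ k * ‖E s‖ ^ 2 := by positivity
    have a9 : 0 ≤ k * G * η ^ 2 := by positivity
    rw [a5]
    simp only [hX]
    nlinarith
  have hmono : MonotoneOn Y (Ici 0) := by
    refine monotoneOn_of_hasDerivWithinAt_nonneg (convex_Ici 0)
      (fun s hs => (hYd s hs).continuousAt.continuousWithinAt)
      (fun s hs => (hYd s (interior_subset hs)).hasDerivWithinAt) fun s hs => ?_
    exact mul_nonneg (Real.exp_pos _).le (hXl s (interior_subset hs))
  have hlim : Tendsto Y atTop (𝓝 (η ^ 2)) := by
    have h1 := ((tendsto_kprim hδ 0).const_mul (2 * G + 1)).rexp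
    have h2 := ((hE0.norm.pow 2).add (hO0.norm.pow 2)).add_const (η ^ 2)
    simpa using h1.mul h2
  have hY0 : Y 0 ≤ η ^ 2 := ge_of_tendsto hlim ((eventually_ge_atTop 0).mono fun s hs =>
    hmono self_mem_Ici hs hs)
  have hexp : Real.exp ((2 * G + 1) * kprim δ 0 0)
      * Real.exp ((2 * G + 1) * (2 ^ (1 - δ) / (δ - 1))) = 1 := by
    rw [← Real.exp_add, Real.exp_eq_one_iff]
    simp [kprim]
  have h3 : X 0 ≤ X 0 + η ^ 2 := by linarith [sq_nonneg η]
  calc X 0 ≤ X 0 + η ^ 2 := h3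
    _ = Y 0 * Real.exp ((2 * G + 1) * (2 ^ (1 - δ) / (δ - 1))) := by
      simp only [hY]
      linear_combination (-(X 0 + η ^ 2)) * hexp
    _ ≤ _ := by gcongr

open scoped Nat in
/-- Bounded solutions of the model system have Gevrey-1 expansions at `0`. -/
theorem gevrey (H : CoreData r δ c₀ C₀ G P q) :
    ∃ C a b, 1 ≤ C ∧ a 0 = 1 ∧ b 0 = 0 ∧ ∀ we wo : ℝ → ℝ → ℂ,
      (∀ h, 0 < h → ∀ s : ℝ, 0 ≤ s → HasDerivAt (we h) (-(q s * wo h s)) s) →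
      (∀ h, 0 < h → ∀ s : ℝ, 0 ≤ s → HasDerivAt (wo h) (2 * I / h * P s * wo h s - q s * we h s) s) →
      (∀ h, 0 < h → Tendsto (we h) atTop (𝓝 1)) →
      (∀ h, 0 < h → Tendsto (wo h) atTop (𝓝 0)) →
      Gevrey 1 C (fun h => we h 0) a ∧ Gevrey 1 C (fun h => wo h 0) b := by
  obtain ⟨hr, hr2, hδ, hc₀, hG, hPd, hqd, hPl, hPu, hqb, him⟩ := id H
  set I' := max 1 (G / (δ - 1)) with hI'
  set L := rate r δ c₀ G * Real.exp 1 with hL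
  have hI1 : 1 ≤ I' := le_max_left _ _
  have hL0 : 0 ≤ L := by
    have : 0 ≤ rate r δ c₀ G := by unfold rate; positivity
    positivity
  have hC₀ : 0 ≤ C₀ := (norm_nonneg _).trans (hPu 0 (by simpa using ofReal_mem_HS hr le_rfl))
  set D := Real.exp ((2 * G + 1) * (2 ^ (1 - δ) / (δ - 1)) / 2) with hD
  have hD0 : 0 < D := Real.exp_pos _
  set C := 2 * C₀ * D * L + I' + 2 * L with hC
  have hC1 : 1 ≤ C := by
    have : 0 ≤ 2 * C₀ * D * L := by positivity
    linarith
  have hC0 : 0 ≤ C := by linarith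
  have hIC : I' ≤ C := by
    have : 0 ≤ 2 * C₀ * D * L := by positivity
    linarith
  have hLC : L ≤ C := by
    have : 0 ≤ 2 * C₀ * D * L := by positivity
    linarith
  have hbe : ∀ j, ‖(formal P q j).1 0‖ ≤ I' * (L ^ j * j !) := fun j => by
    simpa using (H.formal_bound_real j (le_refl 0)).1
  have hbo : ∀ j, ‖(formal P q j).2 0‖ ≤ I' * (L ^ j * j !) := fun j => by
    have h1 := (H.formal_bound_real j (le_refl 0)).2
    have h2 : ((0 : ℝ) + 2) ^ (-δ) ≤ 1 := rpow_le_one hδ (by norm_num)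
    rw [ofReal_zero] at h1
    refine h1.trans ?_
    rw [mul_comm]
    gcongr
    exact h2.trans hI1
  have hcf : ∀ j, I' * (L ^ j * j !) ≤ C ^ (j + 1) * j ! := fun j => by
    rw [pow_succ', mul_assoc]
    gcongr
  refine ⟨C, fun j => (formal P q j).1 0, fun j => (formal P q j).2 0, hC1, by simp [formal_zero],
    by simp [formal_zero], fun we wo hwe hwo hwe1 hwo0 => ?_⟩
  have rem : ∀ N h, 0 < h →
      ‖we h 0 - ∑ j ∈ Finset.range (N + 1), (formal P q j).1 0 * (h : ℂ) ^ j‖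
        ≤ 2 * C₀ * h ^ N * (L ^ (N + 1) * (N + 1)!) * D ∧
      ‖wo h 0 - ∑ j ∈ Finset.range (N + 1), (formal P q j).2 0 * (h : ℂ) ^ j‖
        ≤ 2 * C₀ * h ^ N * (L ^ (N + 1) * (N + 1)!) * D := by
    intro N h h0
    have hne : (h : ℂ) ≠ 0 := by exact_mod_cast h0.ne'
    set η := 2 * C₀ * h ^ N * (L ^ (N + 1) * (N + 1)!) with hη
    have hη0 : 0 ≤ η := by positivity
    set E : ℝ → ℂ := fun s => we h s - ∑ j ∈ Finset.range (N + 1), (formal P q j).1 s * (h : ℂ) ^ j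
      with hEdef
    set O : ℝ → ℂ := fun s => wo h s - ∑ j ∈ Finset.range (N + 1), (formal P q j).2 s * (h : ℂ) ^ j
      with hOdef
    have hEd : ∀ s : ℝ, 0 ≤ s → HasDerivAt E (-(q s * O s)) s := fun s hs => by
      refine ((hwe h h0 s hs).sub (HasDerivAt.fun_sum fun j _ =>
        (H.hasDerivAt_formal_fst j hs).mul_const ((h : ℂ) ^ j))).congr_deriv ?_
      simp only [hOdef, neg_mul, Finset.sum_neg_distrib, mul_sub, Finset.mul_sum, mul_assoc]
      ring
    have hOd : ∀ s : ℝ, 0 ≤ s → HasDerivAt O (2 * I / h * P s * O s - q s * E s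
        + (-(2 * I * P s * (h : ℂ) ^ N * (formal P q (N + 1)).2 s))) s := fun s hs => by
      refine ((hwo h h0 s hs).sub (HasDerivAt.fun_sum fun j _ =>
        (H.hasDerivAt_formal_snd j hs).mul_const ((h : ℂ) ^ j))).congr_deriv ?_
      have key : (h : ℂ) * ∑ j ∈ Finset.range (N + 1), (formal P q (j + 1)).2 s * (h : ℂ) ^ j
          = ∑ j ∈ Finset.range (N + 1), (formal P q j).2 s * (h : ℂ) ^ j
            + (formal P q (N + 1)).2 s * (h : ℂ) ^ (N + 1) := by
        rw [← Finset.sum_range_succ, Finset.sum_range_succ' _ (N + 1), Finset.mul_sum]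
        simp only [formal_zero, zero_mul, add_zero]
        exact Finset.sum_congr rfl fun j _ => by ring
      have e1 : ∑ j ∈ Finset.range (N + 1), (2 * I * P s * (formal P q (j + 1)).2 s
            - q s * (formal P q j).1 s) * (h : ℂ) ^ j
          = 2 * I * P s * ∑ j ∈ Finset.range (N + 1), (formal P q (j + 1)).2 s * (h : ℂ) ^ j
            - q s * ∑ j ∈ Finset.range (N + 1), (formal P q j).1 s * (h : ℂ) ^ j := by
        rw [Finset.mul_sum, Finset.mul_sum, ← Finset.sum_sub_distrib]
        exact Finset.sum_congr rfl fun j _ => by ring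
      rw [e1]
      simp only [hOdef, hEdef]
      field_simp
      linear_combination (-2 * I * P s) * key
    have hlimE : Tendsto E atTop (𝓝 0) := by
      have h1 := (hwe1 h h0).sub (tendsto_finsetSum (Finset.range (N + 1)) fun j _ =>
        (H.tendsto_formal_fst j).mul_const ((h : ℂ) ^ j))
      have h2 : (1 : ℂ) - ∑ j ∈ Finset.range (N + 1), (if j = 0 then 1 else 0) * (h : ℂ) ^ j = 0 := by
        rw [Finset.sum_range_succ']; simp
      rwa [h2] at h1
    have hlimO : Tendsto O atTop (𝓝 0) := by
      have h1 := (hwo0 h h0).sub (tendsto_finsetSum (Finset.range (N + 1)) fun j _ =>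
        (H.tendsto_formal_snd j).mul_const ((h : ℂ) ^ j))
      simpa using h1
    have hen := H.energy (η := η) h0 hEd hOd (fun s hs => by
      have hk0 : 0 ≤ (s + 2) ^ (-δ) := Real.rpow_nonneg (by linarith) _
      simp only [norm_neg, norm_mul, Complex.norm_ofNat, norm_I, mul_one, norm_pow,
        Complex.norm_real, Real.norm_of_nonneg h0.le]
      calc _ ≤ 2 * C₀ * h ^ N * (L ^ (N + 1) * (N + 1)! * (s + 2) ^ (-δ)) := by
            gcongr
            · exact hPu s (ofReal_mem_HS hr hs)
            · exact (H.formal_bound_real (N + 1) hs).2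
        _ = _ := by rw [hη]; ring) hlimE hlimO
    have hD2 : Real.exp ((2 * G + 1) * (2 ^ (1 - δ) / (δ - 1))) = D ^ 2 := by
      rw [hD, ← Real.exp_nat_mul]; congr 1; push_cast; ring
    rw [hD2, ← mul_pow] at hen
    have hE0 : ‖E 0‖ ≤ η * D := by
      refine le_of_sq_le_sq ?_ (by positivity)
      nlinarith [sq_nonneg ‖O 0‖]
    have hO0 : ‖O 0‖ ≤ η * D := by
      refine le_of_sq_le_sq ?_ (by positivity)
      nlinarith [sq_nonneg ‖E 0‖]
    simpa [hEdef, hOdef] using And.intro hE0 hO0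
  have fin : ∀ (w : ℝ → ℂ) (a : ℕ → ℂ) (N : ℕ) (h : ℝ), 0 < h →
      ‖w h - ∑ j ∈ Finset.range (N + 1), a j * (h : ℂ) ^ j‖
        ≤ 2 * C₀ * h ^ N * (L ^ (N + 1) * (N + 1)!) * D →
      ‖a N‖ ≤ I' * (L ^ N * N !) →
      ‖w h - ∑ j ∈ Finset.range N, a j * (h : ℂ) ^ j‖ ≤ C ^ (N + 1) * N ! * h ^ N := by
    intro w a N h h0 h1 h2
    have e : w h - ∑ j ∈ Finset.range N, a j * (h : ℂ) ^ j
        = (w h - ∑ j ∈ Finset.range (N + 1), a j * (h : ℂ) ^ j) + a N * (h : ℂ) ^ N := by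
      rw [Finset.sum_range_succ]; ring
    have h3 : (N + 1 : ℝ) ≤ 2 ^ N := by exact_mod_cast Nat.lt_two_pow_self (n := N)
    rw [e]
    calc _ ≤ 2 * C₀ * h ^ N * (L ^ (N + 1) * (N + 1)!) * D + I' * (L ^ N * N !) * h ^ N := by
          refine (norm_add_le _ _).trans (add_le_add h1 ?_)
          rw [norm_mul, norm_pow, Complex.norm_real, Real.norm_of_nonneg h0.le]
          gcongr
      _ = (2 * C₀ * D * L * ((N + 1) * L ^ N) + I' * (1 * L) ^ N) * (N ! * h ^ N) := by
          rw [Nat.factorial_succ]; push_cast; ring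
      _ ≤ (2 * C₀ * D * L * (2 ^ N * L ^ N) + I' * (2 * L) ^ N) * (N ! * h ^ N) := by
          gcongr; norm_num
      _ = (2 * C₀ * D * L + I') * (2 * L) ^ N * (N ! * h ^ N) := by rw [mul_pow]; ring
      _ ≤ C * C ^ N * (N ! * h ^ N) := by
          gcongr
          · linarith
          · have : 0 ≤ 2 * C₀ * D * L := by positivity
            linarith
      _ = _ := by ring
  refine ⟨⟨fun j => (hbe j).trans (hcf j), fun N h h0 _ => fin (fun h => we h 0) _ N h h0 (rem N h h0).1 (hbe N)⟩,
    ⟨fun j => (hbo j).trans (hcf j), fun N h h0 _ => fin (fun h => wo h 0) _ N h h0 (rem N h h0).2 (hbo N)⟩⟩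

end CoreData

end

section

/-- The primitive of `f` obtained by integrating along segments from `z₀`. -/
noncomputable def sprim (z₀ : ℂ) (f : ℂ → ℂ) (x : ℂ) : ℂ :=
  ∫ τ in (0 : ℝ)..1, (x - z₀) * f (z₀ + τ * (x - z₀))

theorem starConvex_mem {z₀ : ℂ} {U : Set ℂ} (hs : StarConvex ℝ z₀ U) {x : ℂ} (hx : x ∈ U)
    {τ : ℝ} (h0 : 0 ≤ τ) (h1 : τ ≤ 1) : z₀ + τ * (x - z₀) ∈ U := by
  have := hs.add_smul_sub_mem hx h0 h1
  simpa using this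

theorem hasDerivAt_sprim {z₀ : ℂ} {U : Set ℂ} (hU : IsOpen U) (hs : StarConvex ℝ z₀ U)
    {f : ℂ → ℂ} (hf : DifferentiableOn ℂ f U) {x : ℂ} (hx : x ∈ U) :
    HasDerivAt (sprim z₀ f) (f x) x := by
  obtain ⟨ρ, hρ, hball⟩ := Metric.nhds_basis_closedBall.mem_iff.1 (hU.mem_nhds hx)
  have hdiff : ∀ z ∈ U, DifferentiableAt ℂ f z := fun z hz =>
    hf.differentiableAt (hU.mem_nhds hz)
  have hfd : ContinuousOn (deriv f) U := (hf.deriv hU).continuousOn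
  set F : ℂ → ℝ → ℂ := fun z τ => (z - z₀) * f (z₀ + τ * (z - z₀)) with hF
  set F' : ℂ → ℝ → ℂ := fun z τ =>
    f (z₀ + τ * (z - z₀)) + (z - z₀) * (deriv f (z₀ + τ * (z - z₀)) * τ) with hF'
  have hmaps : MapsTo (fun y : ℂ × ℝ => z₀ + (y.2 : ℂ) * (y.1 - z₀))
      (Metric.closedBall x ρ ×ˢ Icc (0 : ℝ) 1) U := fun y hy =>
    starConvex_mem hs (hball hy.1) hy.2.1 hy.2.2
  have hF'cont : ContinuousOn (fun y : ℂ × ℝ => F' y.1 y.2)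
      (Metric.closedBall x ρ ×ˢ Icc (0 : ℝ) 1) := by
    have h1 : ContinuousOn (fun y : ℂ × ℝ => f (z₀ + (y.2 : ℂ) * (y.1 - z₀)))
      (Metric.closedBall x ρ ×ˢ Icc (0 : ℝ) 1) := hf.continuousOn.comp (by fun_prop) hmaps
    have h2 : ContinuousOn (fun y : ℂ × ℝ => deriv f (z₀ + (y.2 : ℂ) * (y.1 - z₀)))
      (Metric.closedBall x ρ ×ˢ Icc (0 : ℝ) 1) := hfd.comp (by fun_prop) hmaps
    exact h1.add ((by fun_prop : ContinuousOn (fun y : ℂ × ℝ => y.1 - z₀) _).mul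
      (h2.mul (by fun_prop)))
  obtain ⟨M, hM⟩ := ((isCompact_closedBall x ρ).prod isCompact_Icc).exists_bound_of_continuousOn
    hF'cont
  have hF'x : ContinuousOn (F' x) (uIcc 0 1) := by
    rw [uIcc_of_le zero_le_one]
    exact hF'cont.comp (f := fun τ : ℝ => (x, τ)) (by fun_prop) fun τ hτ =>
      ⟨Metric.mem_closedBall_self hρ.le, hτ⟩
  have hFc : ∀ z ∈ Metric.closedBall x ρ, ContinuousOn (F z) (uIcc 0 1) := fun z hz => by
    rw [uIcc_of_le zero_le_one]
    refine ContinuousOn.mul continuousOn_const (hf.continuousOn.comp (by fun_prop) fun τ hτ => ?_)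
    exact starConvex_mem hs (hball hz) hτ.1 hτ.2
  have hsub : (uIoc (0 : ℝ) 1) ⊆ Icc 0 1 := by
    rw [uIoc_of_le zero_le_one]; exact Ioc_subset_Icc_self
  have hsub' : (uIoc (0 : ℝ) 1) ⊆ uIcc 0 1 := uIoc_subset_uIcc
  have main := intervalIntegral.hasDerivAt_integral_of_dominated_loc_of_deriv_le (𝕜 := ℂ)
    (μ := volume) (a := (0 : ℝ)) (b := 1) (F := F) (F' := F') (x₀ := x)
    (s := Metric.closedBall x ρ) (bound := fun _ => M) (Metric.closedBall_mem_nhds x hρ)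
    (by
      filter_upwards [Metric.closedBall_mem_nhds x hρ] with z hz
      exact ((hFc z hz).mono hsub').aestronglyMeasurable measurableSet_uIoc)
    ((hFc x (Metric.mem_closedBall_self hρ.le)).intervalIntegrable)
    ((hF'x.mono hsub').aestronglyMeasurable measurableSet_uIoc)
    (Eventually.of_forall fun τ hτ z hz => hM (z, τ) ⟨hz, hsub hτ⟩)
    intervalIntegrable_const
    (Eventually.of_forall fun τ hτ z hz => by
      have hm := starConvex_mem hs (hball hz) (hsub hτ).1 (hsub hτ).2
      have h1 : HasDerivAt (fun z : ℂ => z₀ + τ * (z - z₀)) (τ : ℂ) z := by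
        simpa using (((hasDerivAt_id z).sub_const z₀).const_mul (τ : ℂ)).const_add z₀
      have h2 := (hdiff _ hm).hasDerivAt.comp z h1
      have h3 := ((hasDerivAt_id z).sub_const z₀).mul h2
      exact h3.congr_deriv (by simp [hF']))
  have hval : ∫ τ in (0 : ℝ)..1, F' x τ = f x := by
    have h1 := intervalIntegral.integral_eq_sub_of_hasDerivAt
      (f := fun τ : ℝ => (τ : ℂ) * f (z₀ + τ * (x - z₀))) (f' := F' x) (a := 0) (b := 1)
      (fun τ hτ => by
        rw [uIcc_of_le zero_le_one] at hτ
        have hm := starConvex_mem hs hx hτ.1 hτ.2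
        have h0 : HasDerivAt (fun τ : ℝ => (τ : ℂ)) 1 τ := ofRealCLM.hasDerivAt
        have h1 : HasDerivAt (fun τ : ℝ => z₀ + τ * (x - z₀)) (x - z₀) τ := by
          simpa using (h0.mul_const (x - z₀)).const_add z₀
        have h2 := (hdiff _ hm).hasDerivAt.comp τ h1
        have h3 := h0.mul h2
        refine h3.congr_deriv ?_
        simp only [hF', Function.comp_def]
        ring) hF'x.intervalIntegrable
    rw [h1]; simp
  rw [← hval]
  exact main.2

/-- Picard iterates of the linear system `u' = a v`, `v' = b u`. -/
noncomputable def picard (a b : ℂ → ℂ) (u₀ v₀ : ℂ) : ℕ → (ℂ → ℂ) × (ℂ → ℂ)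
  | 0 => (fun _ => u₀, fun _ => v₀)
  | n + 1 => (sprim 0 fun x => a x * (picard a b u₀ v₀ n).2 x,
      sprim 0 fun x => b x * (picard a b u₀ v₀ n).1 x)

theorem norm_sprim_le {U : Set ℂ} (hs : StarConvex ℝ 0 U) {f : ℂ → ℂ} {M : ℝ} {n : ℕ}
    (hM : ∀ x ∈ U, ‖f x‖ ≤ M * ‖x‖ ^ n) {x : ℂ} (hx : x ∈ U) :
    ‖sprim 0 f x‖ ≤ M * ‖x‖ ^ (n + 1) / (n + 1) := by
  have h1 : ∫ τ in (0 : ℝ)..1, M * ‖x‖ ^ (n + 1) * τ ^ n = M * ‖x‖ ^ (n + 1) / (n + 1) := by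
    rw [intervalIntegral.integral_const_mul, integral_pow]; simp; ring
  rw [← h1, sprim]
  refine intervalIntegral.norm_integral_le_of_norm_le zero_le_one ?_
    ((by fun_prop : Continuous fun τ : ℝ => M * ‖x‖ ^ (n + 1) * τ ^ n).intervalIntegrable _ _)
  refine Eventually.of_forall fun τ hτ => ?_
  have := hM _ (starConvex_mem hs hx hτ.1.le hτ.2)
  simp only [sub_zero, zero_add, norm_mul, norm_real, Real.norm_of_nonneg hτ.1.le] at this ⊢
  calc _ ≤ ‖x‖ * (M * (τ * ‖x‖) ^ n) := by gcongr
    _ = _ := by ring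

theorem picard_bound {U : Set ℂ} (hU : IsOpen U) (hs : StarConvex ℝ 0 U) {a b : ℂ → ℂ}
    (ha : DifferentiableOn ℂ a U) (hb : DifferentiableOn ℂ b U) {M : ℝ}
    (haM : ∀ x ∈ U, ‖a x‖ ≤ M) (hbM : ∀ x ∈ U, ‖b x‖ ≤ M) (u₀ v₀ : ℂ) (n : ℕ) :
    (∀ x ∈ U, DifferentiableAt ℂ (picard a b u₀ v₀ n).1 x) ∧
    (∀ x ∈ U, DifferentiableAt ℂ (picard a b u₀ v₀ n).2 x) ∧
    (∀ x ∈ U, ‖(picard a b u₀ v₀ n).1 x‖ ≤ (‖u₀‖ + ‖v₀‖) * M ^ n / n.factorial * ‖x‖ ^ n) ∧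
    (∀ x ∈ U, ‖(picard a b u₀ v₀ n).2 x‖ ≤ (‖u₀‖ + ‖v₀‖) * M ^ n / n.factorial * ‖x‖ ^ n) := by
  induction n with
  | zero => simp [picard]
  | succ n ih =>
    obtain ⟨i1, i2, i3, i4⟩ := ih
    have d1 : DifferentiableOn ℂ (fun x => a x * (picard a b u₀ v₀ n).2 x) U :=
      ha.mul fun x hx => (i2 x hx).differentiableWithinAt
    have d2 : DifferentiableOn ℂ (fun x => b x * (picard a b u₀ v₀ n).1 x) U :=
      hb.mul fun x hx => (i1 x hx).differentiableWithinAt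
    have e : ∀ x : ℂ, (‖u₀‖ + ‖v₀‖) * M ^ (n + 1) / (n + 1).factorial * ‖x‖ ^ (n + 1)
        = (M * ((‖u₀‖ + ‖v₀‖) * M ^ n / n.factorial)) * ‖x‖ ^ (n + 1) / (n + 1) := by
      intro x
      rw [Nat.factorial_succ]; push_cast
      field_simp
      ring
    refine ⟨fun x hx => (hasDerivAt_sprim hU hs d1 hx).differentiableAt,
      fun x hx => (hasDerivAt_sprim hU hs d2 hx).differentiableAt, fun x hx => ?_, fun x hx => ?_⟩
    · rw [e]
      refine norm_sprim_le hs (fun z hz => ?_) hx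
      have hM : 0 ≤ M := (norm_nonneg _).trans (haM z hz)
      rw [norm_mul, mul_assoc]
      gcongr
      exacts [haM z hz, i4 z hz]
    · rw [e]
      refine norm_sprim_le hs (fun z hz => ?_) hx
      have hM : 0 ≤ M := (norm_nonneg _).trans (haM z hz)
      rw [norm_mul, mul_assoc]
      gcongr
      exacts [hbM z hz, i3 z hz]

theorem exists_holomorphic_solution {U : Set ℂ} (hU : IsOpen U) (hc : Convex ℝ U)
    (h0 : (0 : ℂ) ∈ U) {a b : ℂ → ℂ}
    (ha : DifferentiableOn ℂ a U) (hb : DifferentiableOn ℂ b U) {M : ℝ}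
    (haM : ∀ x ∈ U, ‖a x‖ ≤ M) (hbM : ∀ x ∈ U, ‖b x‖ ≤ M) (u₀ v₀ : ℂ) :
    ∃ u v : ℂ → ℂ, u 0 = u₀ ∧ v 0 = v₀ ∧ (∀ x ∈ U, HasDerivAt u (a x * v x) x) ∧
      ∀ x ∈ U, HasDerivAt v (b x * u x) x := by
  have hs : StarConvex ℝ 0 U := hc.starConvex h0
  have hM0 : 0 ≤ M := (norm_nonneg _).trans (haM 0 h0)
  have hp := picard_bound hU hs ha hb haM hbM u₀ v₀
  set p := picard a b u₀ v₀ with hpdef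
  set W := ‖u₀‖ + ‖v₀‖ with hW
  have hW0 : 0 ≤ W := by positivity
  have hsum : ∀ R : ℝ, Summable fun n : ℕ => W * M ^ n / n.factorial * R ^ n := fun R => by
    refine ((Real.summable_pow_div_factorial (M * R)).mul_left W).congr fun n => ?_
    rw [mul_pow]; ring
  have hd1 : ∀ n, ∀ x ∈ U, HasDerivAt (p (n + 1)).1 (a x * (p n).2 x) x := fun n x hx =>
    hasDerivAt_sprim hU hs (ha.mul fun x hx => ((hp n).2.1 x hx).differentiableWithinAt) hx
  have hd2 : ∀ n, ∀ x ∈ U, HasDerivAt (p (n + 1)).2 (b x * (p n).1 x) x := fun n x hx =>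
    hasDerivAt_sprim hU hs (hb.mul fun x hx => ((hp n).1 x hx).differentiableWithinAt) hx
  have hz : ∀ n, (p (n + 1)).1 0 = 0 ∧ (p (n + 1)).2 0 = 0 := fun n => by
    simp [hpdef, picard, sprim]
  refine ⟨fun x => u₀ + ∑' n, (p (n + 1)).1 x, fun x => v₀ + ∑' n, (p (n + 1)).2 x,
    by simp [hz], by simp [hz], fun x hx => ?_, fun x hx => ?_⟩
  all_goals
    set R := ‖x‖ + 1
    have hR : 0 ≤ R := by positivity
    have hxt : x ∈ U ∩ Metric.ball 0 R := ⟨hx, by simp [R]⟩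
    have h0t : (0 : ℂ) ∈ U ∩ Metric.ball 0 R := ⟨h0, by
      simp only [Metric.mem_ball, dist_self, R]; positivity⟩
    have hto : IsOpen (U ∩ Metric.ball 0 R) := hU.inter Metric.isOpen_ball
    have htc : IsPreconnected (U ∩ Metric.ball 0 R) :=
      (hc.inter (convex_ball 0 R)).isPreconnected
    have hzR : ∀ z ∈ U ∩ Metric.ball 0 R, ‖z‖ ≤ R := fun z hz => (mem_ball_zero_iff.1 hz.2).le
  · have h1 := hasDerivAt_tsum_of_isPreconnected ((hsum R).mul_left M) hto htc
      (g := fun n => (p (n + 1)).1) (g' := fun n x => a x * (p n).2 x)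
      (fun n z hz => hd1 n z hz.1)
      (fun n z hz => by
        rw [norm_mul]
        refine mul_le_mul (haM z hz.1) (((hp n).2.2.2 z hz.1).trans ?_) (norm_nonneg _) hM0
        have := hzR z hz
        gcongr) h0t (by simp [hz]) hxt
    refine (h1.const_add u₀).congr_deriv ?_
    rw [tsum_mul_left]
    have hsm : Summable fun n => (p n).2 x := Summable.of_norm_bounded (hsum R) fun n => by
      refine ((hp n).2.2.2 x hx).trans ?_
      have := hzR x hxt
      gcongr
    rw [hsm.tsum_eq_zero_add]
    simp [hpdef, picard]
  · have h1 := hasDerivAt_tsum_of_isPreconnected ((hsum R).mul_left M) hto htc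
      (g := fun n => (p (n + 1)).2) (g' := fun n x => b x * (p n).1 x)
      (fun n z hz => hd2 n z hz.1)
      (fun n z hz => by
        rw [norm_mul]
        refine mul_le_mul (hbM z hz.1) (((hp n).2.2.1 z hz.1).trans ?_) (norm_nonneg _) hM0
        have := hzR z hz
        gcongr) h0t (by simp [hz]) hxt
    refine (h1.const_add v₀).congr_deriv ?_
    rw [tsum_mul_left]
    have hsm : Summable fun n => (p n).1 x := Summable.of_norm_bounded (hsum R) fun n => by
      refine ((hp n).2.2.1 x hx).trans ?_
      have := hzR x hxt
      gcongr
    rw [hsm.tsum_eq_zero_add]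
    simp [hpdef, picard]

/-- Gronwall bound for a perturbed linear system on `[0, Y]`. -/
theorem pair_gronwall {z w z' w' : ℝ → ℂ} {K ε d Y : ℝ}
    (hz : ∀ y ∈ Icc 0 Y, HasDerivAt z (z' y) y) (hw : ∀ y ∈ Icc 0 Y, HasDerivAt w (w' y) y)
    (hz' : ∀ y ∈ Icc 0 Y, ‖z' y‖ ≤ K * max ‖z y‖ ‖w y‖ + ε)
    (hw' : ∀ y ∈ Icc 0 Y, ‖w' y‖ ≤ K * max ‖z y‖ ‖w y‖ + ε)
    (hz0 : ‖z 0‖ ≤ d) (hw0 : ‖w 0‖ ≤ d) {y : ℝ} (hy : y ∈ Icc 0 Y) :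
    ‖z y‖ ≤ gronwallBound d K ε y ∧ ‖w y‖ ≤ gronwallBound d K ε y := by
  have h := norm_le_gronwallBound_of_norm_deriv_right_le (f := fun y => (z y, w y))
    (f' := fun y => (z' y, w' y)) (δ := d) (K := K) (ε := ε) (a := 0) (b := Y)
    (fun y hy => ((hz y hy).prodMk (hw y hy)).continuousAt.continuousWithinAt)
    (fun y hy => ((hz y (Ico_subset_Icc_self hy)).prodMk
      (hw y (Ico_subset_Icc_self hy))).hasDerivWithinAt)
    (by simpa [Prod.norm_def] using ⟨hz0, hw0⟩)
    (fun y hy => by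
      have := Ico_subset_Icc_self hy
      simpa [Prod.norm_def] using ⟨hz' y this, hw' y this⟩) y hy
  rw [sub_zero, Prod.norm_def] at h
  exact ⟨(le_max_left _ _).trans h, (le_max_right _ _).trans h⟩

end

section

/-- Data of a Dirac-type system `u₁' = -(i/h) τ g u₂`, `u₂' = -(i/h) b u₁` on a half strip, where
`τ(x) = (x - t)/(x + 1)`, with one simple turning point at `t`. -/
structure TPData (r δ t c C α β : ℝ) (g b : ℂ → ℂ) : Prop where
  r_pos : 0 < r
  r_le : r ≤ 1 / 2
  δ_gt : 1 < δ
  δ_le : δ ≤ 2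
  t_pos : 0 < t
  c_pos : 0 < c
  α_pos : 0 < α
  β_pos : 0 < β
  g_diff : DifferentiableOn ℂ g (HS r)
  b_diff : DifferentiableOn ℂ b (HS r)
  g_re : ∀ x ∈ HS r, c ≤ (g x).re
  b_re : ∀ x ∈ HS r, c ≤ (b x).re
  g_le : ∀ x ∈ HS r, ‖g x‖ ≤ C
  b_le : ∀ x ∈ HS r, ‖b x‖ ≤ C
  g_deriv : ∀ x ∈ HS r, ‖deriv g x‖ ≤ C * (x.re + 2) ^ (-δ)
  b_deriv : ∀ x ∈ HS r, ‖deriv b x‖ ≤ C * (x.re + 2) ^ (-δ)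
  g_real : ∀ x : ℝ, 0 ≤ x → (g x).im = 0
  b_real : ∀ x : ℝ, 0 ≤ x → (b x).im = 0
  g_lim : ∀ x ∈ HS r, ‖(x - t) / (x + 1) * g x - α‖ ≤ C * (x.re + 2) ^ (-δ)
  b_lim : ∀ x ∈ HS r, ‖b x - β‖ ≤ C * (x.re + 2) ^ (-δ)

/-- The half strip slit upwards from the turning point. -/
def slitHS (r t : ℝ) : Set ℂ := HS r ∩ {x | I * (x - t) ∈ slitPlane}

/-- A logarithm of `(x - t)/(x + 1)` on the slit half strip. -/
noncomputable def ell (t : ℝ) (x : ℂ) : ℂ :=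
  log (I * (x - t)) - Real.pi / 2 * I - log (x + 1)

/-- The momentum. -/
noncomputable def mom (t : ℝ) (g b : ℂ → ℂ) (x : ℂ) : ℂ :=
  exp ((ell t x + log (g x) + log (b x)) / 2)

/-- The WKB amplitude. -/
noncomputable def amp (t : ℝ) (g b : ℂ → ℂ) (x : ℂ) : ℂ :=
  exp ((ell t x + log (g x) - log (b x)) / 4)

/-- The logarithmic derivative of the amplitude. -/
noncomputable def coup (t : ℝ) (g b : ℂ → ℂ) (x : ℂ) : ℂ :=
  ((1 + t) / ((x - t) * (x + 1)) + deriv g x / g x - deriv b x / b x) / 4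

theorem isOpen_slitHS (r t : ℝ) : IsOpen (slitHS r t) :=
  (isOpen_HS r).inter (isOpen_slitPlane.preimage (by fun_prop))

theorem starConvex_slitHS {r t : ℝ} (hr : 0 < r) (ht : 0 < t) :
    StarConvex ℝ (t - I * (r / 2) : ℂ) (slitHS r t) := by
  refine StarConvex.inter ((convex_HS r).starConvex ⟨by simp; linarith, by
    simp; rw [abs_of_pos (by linarith)]; linarith⟩) ?_
  have h := starConvex_ofReal_slitPlane (x := r / 2) (by linarith)
  intro x hx a b ha hb hab
  have := h hx ha hb hab
  have hab' : (a : ℂ) + b = 1 := by exact_mod_cast hab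
  simp only [mem_ofPred_eq, real_smul] at this ⊢
  convert this using 1
  push_cast
  linear_combination (-(a : ℂ) * r / 2) * I_sq + I * t * hab'

theorem mem_slitHS_lower {r t : ℝ} {x : ℂ} (hx : x ∈ HS r) (h : x.im < 0 ∨ x.re ≠ t) :
    x ∈ slitHS r t := by
  refine ⟨hx, ?_⟩
  simp only [mem_ofPred_eq, mem_slitPlane_iff]
  rcases h with h | h
  · left; simp; linarith
  · right; simpa [sub_eq_zero] using h

variable {r δ t c C α β : ℝ} {g b : ℂ → ℂ}

theorem sub_ne_of_mem_slitHS {x : ℂ} (hx : x ∈ slitHS r t) : x - t ≠ 0 := by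
  rintro h
  have := hx.2
  simp [h] at this

theorem add_one_mem_slit (hr : r ≤ 1) {x : ℂ} (hx : x ∈ HS r) : x + 1 ∈ slitPlane := by
  left; simp; linarith [hx.1]

theorem hasDerivAt_ell (hr : r ≤ 1) {x : ℂ} (hx : x ∈ slitHS r t) :
    HasDerivAt (ell t) ((1 + t) / ((x - t) * (x + 1))) x := by
  have h1 : HasDerivAt (fun x : ℂ => I * (x - t)) I x := by
    simpa using ((hasDerivAt_id x).sub_const (t : ℂ)).const_mul I
  have h2 : HasDerivAt (fun x : ℂ => x + 1) 1 x := by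
    simpa using (hasDerivAt_id x).add_const (1 : ℂ)
  have h3 := sub_ne_of_mem_slitHS hx
  have h4 := slitPlane_ne_zero (add_one_mem_slit hr hx.1)
  refine (((h1.clog hx.2).sub_const (Real.pi / 2 * I : ℂ)).sub
    (h2.clog (add_one_mem_slit hr hx.1))).congr_deriv ?_
  field_simp
  ring

theorem exp_ell (hr : r ≤ 1) {x : ℂ} (hx : x ∈ HS r) (hxt : x - t ≠ 0) :
    exp (ell t x) = (x - t) / (x + 1) := by
  have h4 := slitPlane_ne_zero (add_one_mem_slit hr hx)
  rw [ell, exp_sub, exp_sub, exp_log (mul_ne_zero I_ne_zero hxt), exp_log h4, exp_pi_div_two_mul_I]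
  field_simp

namespace TPData

theorem C_pos (D : TPData r δ t c C α β g b) : 0 < C := by
  have h := ofReal_mem_HS D.r_pos le_rfl
  exact D.c_pos.trans_le ((D.g_re _ h).trans ((re_le_norm _).trans (D.g_le _ h)))

theorem r_le_one (D : TPData r δ t c C α β g b) : r ≤ 1 := by linarith [D.r_le]

theorem g_slit (D : TPData r δ t c C α β g b) {x : ℂ} (hx : x ∈ HS r) : g x ∈ slitPlane :=
  Or.inl (D.c_pos.trans_le (D.g_re x hx))

theorem b_slit (D : TPData r δ t c C α β g b) {x : ℂ} (hx : x ∈ HS r) : b x ∈ slitPlane :=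
  Or.inl (D.c_pos.trans_le (D.b_re x hx))

theorem hasDerivAt_g (D : TPData r δ t c C α β g b) {x : ℂ} (hx : x ∈ HS r) :
    HasDerivAt g (deriv g x) x :=
  (D.g_diff.differentiableAt ((isOpen_HS r).mem_nhds hx)).hasDerivAt

theorem hasDerivAt_b (D : TPData r δ t c C α β g b) {x : ℂ} (hx : x ∈ HS r) :
    HasDerivAt b (deriv b x) x :=
  (D.b_diff.differentiableAt ((isOpen_HS r).mem_nhds hx)).hasDerivAt

theorem hasDerivAt_amp (D : TPData r δ t c C α β g b) {x : ℂ} (hx : x ∈ slitHS r t) :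
    HasDerivAt (amp t g b) (coup t g b x * amp t g b x) x := by
  have h1 := hasDerivAt_ell D.r_le_one hx
  have h2 := (D.hasDerivAt_g hx.1).clog (D.g_slit hx.1)
  have h3 := (D.hasDerivAt_b hx.1).clog (D.b_slit hx.1)
  refine (((h1.add h2).sub h3).div_const 4).cexp.congr_deriv ?_
  simp only [coup, amp, Pi.add_apply, Pi.sub_apply]
  ring

theorem differentiableAt_mom (D : TPData r δ t c C α β g b) {x : ℂ} (hx : x ∈ slitHS r t) :
    DifferentiableAt ℂ (mom t g b) x := by
  have h1 := hasDerivAt_ell D.r_le_one hx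
  have h2 := (D.hasDerivAt_g hx.1).clog (D.g_slit hx.1)
  have h3 := (D.hasDerivAt_b hx.1).clog (D.b_slit hx.1)
  exact (((h1.add h2).add h3).div_const 2).cexp.differentiableAt

theorem differentiableAt_coup (D : TPData r δ t c C α β g b) {x : ℂ} (hx : x ∈ slitHS r t) :
    DifferentiableAt ℂ (coup t g b) x := by
  have o := (isOpen_HS r).mem_nhds hx.1
  have h2 := (D.g_diff.deriv (isOpen_HS r)).differentiableAt o
  have h3 := (D.b_diff.deriv (isOpen_HS r)).differentiableAt o
  have h4 := slitPlane_ne_zero (D.g_slit hx.1)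
  have h5 := slitPlane_ne_zero (D.b_slit hx.1)
  have h6 := sub_ne_of_mem_slitHS hx
  have h7 := slitPlane_ne_zero (add_one_mem_slit D.r_le_one hx.1)
  have h8 : DifferentiableAt ℂ (fun x : ℂ => (1 + t : ℂ) / ((x - t) * (x + 1))) x :=
    (differentiableAt_const _).div (by fun_prop) (mul_ne_zero h6 h7)
  exact ((h8.add (h2.div (D.hasDerivAt_g hx.1).differentiableAt h4)).sub
    (h3.div (D.hasDerivAt_b hx.1).differentiableAt h5)).div_const 4

theorem mom_sq (D : TPData r δ t c C α β g b) {x : ℂ} (hx : x ∈ HS r) (hxt : x - t ≠ 0) :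
    mom t g b x ^ 2 = (x - t) / (x + 1) * g x * b x := by
  rw [mom, ← exp_nat_mul, ← exp_ell D.r_le_one hx hxt]
  conv_rhs => rw [← exp_log (slitPlane_ne_zero (D.g_slit hx)),
    ← exp_log (slitPlane_ne_zero (D.b_slit hx)), ← exp_add, ← exp_add]
  congr 1; push_cast; ring

theorem mom_mul_amp_sq (D : TPData r δ t c C α β g b) {x : ℂ} (hx : x ∈ HS r) (hxt : x - t ≠ 0) :
    mom t g b x * amp t g b x ^ 2 = (x - t) / (x + 1) * g x := by
  rw [mom, amp, ← exp_nat_mul, ← exp_ell D.r_le_one hx hxt, ← exp_add]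
  conv_rhs => rw [← exp_log (slitPlane_ne_zero (D.g_slit hx)), ← exp_add]
  congr 1; push_cast; ring

theorem b_mul_amp_sq (D : TPData r δ t c C α β g b) {x : ℂ} (hx : x ∈ HS r) :
    b x * amp t g b x ^ 2 = mom t g b x := by
  have e := exp_log (slitPlane_ne_zero (D.b_slit hx))
  calc b x * amp t g b x ^ 2 = exp (log (b x)) * amp t g b x ^ 2 := by rw [e]
    _ = mom t g b x := by
      rw [mom, amp, ← exp_nat_mul, ← exp_add]
      congr 1; push_cast; ring

theorem amp_ne (t : ℝ) (g b : ℂ → ℂ) (x : ℂ) : amp t g b x ≠ 0 := exp_ne_zero _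

theorem norm_tau_le (ht : 0 < t) (hr : r ≤ 1 / 2) {x : ℂ} (hx : x ∈ HS r) :
    ‖(x - t) / (x + 1)‖ ≤ 3 + 2 * t := by
  have h1 : (1 : ℝ) / 2 ≤ ‖x + 1‖ := by
    refine le_trans ?_ (re_le_norm _)
    simp; linarith [hx.1]
  rw [norm_div, div_le_iff₀ (by linarith)]
  have h2 : ‖x - t‖ ≤ ‖x + 1‖ + (1 + t) := by
    have := norm_sub_le (x + 1) ((1 + t : ℝ) : ℂ)
    rw [norm_real, Real.norm_of_nonneg (by linarith)] at this
    rwa [show x + 1 - ((1 + t : ℝ) : ℂ) = x - t by push_cast; ring] at this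
  nlinarith

theorem le_norm_tau (ht : 0 < t) {d : ℝ} (hd : 0 < d) {x : ℂ} (h : d ≤ ‖x - t‖)
    (h0 : x + 1 ≠ 0) : d / (d + 1 + t) ≤ ‖(x - t) / (x + 1)‖ := by
  have h1 : 0 < ‖x + 1‖ := norm_pos_iff.2 h0
  rw [norm_div, div_le_div_iff₀ (by linarith) h1]
  have h2 : ‖x + 1‖ ≤ ‖x - t‖ + (1 + t) := by
    have := norm_add_le (x - t) ((1 + t : ℝ) : ℂ)
    rw [norm_real, Real.norm_of_nonneg (by linarith)] at this
    rwa [show x - t + ((1 + t : ℝ) : ℂ) = x + 1 by push_cast; ring] at this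
  nlinarith

theorem norm_mom_sq (D : TPData r δ t c C α β g b) {x : ℂ} (hx : x ∈ HS r) (hxt : x - t ≠ 0) :
    ‖mom t g b x‖ ^ 2 = ‖(x - t) / (x + 1)‖ * ‖g x‖ * ‖b x‖ := by
  rw [← norm_pow, D.mom_sq hx hxt, norm_mul, norm_mul]

theorem mom_le (D : TPData r δ t c C α β g b) {x : ℂ} (hx : x ∈ HS r) (hxt : x - t ≠ 0) :
    ‖mom t g b x‖ ≤ Real.sqrt ((3 + 2 * t) * C * C) := by
  refine Real.le_sqrt_of_sq_le ?_
  rw [D.norm_mom_sq hx hxt]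
  have := norm_tau_le D.t_pos D.r_le hx
  have := D.g_le x hx
  have := D.b_le x hx
  have := D.C_pos
  have := D.t_pos
  gcongr

theorem le_mom (D : TPData r δ t c C α β g b) {d : ℝ} (hd : 0 < d) {x : ℂ} (hx : x ∈ HS r)
    (h : d ≤ ‖x - t‖) : Real.sqrt (d / (d + 1 + t) * c * c) ≤ ‖mom t g b x‖ := by
  have hxt : x - t ≠ 0 := norm_pos_iff.1 (hd.trans_le h)
  refine Real.sqrt_le_iff.2 ⟨norm_nonneg _, ?_⟩
  rw [D.norm_mom_sq hx hxt]
  have := le_norm_tau D.t_pos hd h (slitPlane_ne_zero (add_one_mem_slit D.r_le_one hx))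
  have := (D.g_re x hx).trans (re_le_norm _)
  have := (D.b_re x hx).trans (re_le_norm _)
  have := D.c_pos
  have := D.t_pos
  gcongr

theorem norm_coup_le (D : TPData r δ t c C α β g b) {d : ℝ} (hd : 0 < d) {x : ℂ} (hx : x ∈ HS r)
    (h : d ≤ ‖x - t‖) :
    ‖coup t g b x‖ ≤ ((1 + t) * (9 * ((d + 1 + t) / d)) + C / c + C / c) / 4
      * (x.re + 2) ^ (-δ) := by
  have hxt : x - t ≠ 0 := norm_pos_iff.1 (hd.trans_le h)
  have hx1 := slitPlane_ne_zero (add_one_mem_slit D.r_le_one hx)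
  have ht := D.t_pos
  have hre : -(1 / 2) < x.re := by linarith [hx.1, D.r_le]
  have hτ := le_norm_tau ht hd h hx1
  have hc := D.c_pos
  have hC := D.C_pos
  have e1 : ‖(1 + t : ℂ) / ((x - t) * (x + 1))‖
      ≤ (1 + t) * (9 * ((d + 1 + t) / d)) * (x.re + 2) ^ (-δ) := by
    have hk : (x.re + 2) ^ (-2 : ℝ) ≤ (x.re + 2) ^ (-δ) :=
      Real.rpow_le_rpow_of_exponent_le (by linarith) (by linarith [D.δ_le])
    have e : (x - t) * (x + 1) = (x - t) / (x + 1) * (x + 1) ^ 2 := by field_simp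
    have h1 : (x.re + 2) / 3 ≤ ‖x + 1‖ := by
      refine le_trans ?_ (re_le_norm _)
      simp; linarith
    have h2 : d / (d + 1 + t) * ((x.re + 2) / 3) ^ 2 ≤ ‖(x - t) * (x + 1)‖ := by
      rw [e, norm_mul, norm_pow]
      have : 0 ≤ x.re + 2 := by linarith
      gcongr
    have h3 : ‖(1 + t : ℂ)‖ = 1 + t := by
      rw [show (1 + t : ℂ) = ((1 + t : ℝ) : ℂ) by push_cast; rfl, norm_real,
        Real.norm_of_nonneg (by linarith)]
    rw [norm_div, h3]
    have h4 : 0 < x.re + 2 := by linarith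
    calc (1 + t) / ‖(x - t) * (x + 1)‖ ≤ (1 + t) / (d / (d + 1 + t) * ((x.re + 2) / 3) ^ 2) := by
          gcongr
      _ = (1 + t) * (9 * ((d + 1 + t) / d)) * (x.re + 2) ^ (-2 : ℝ) := by
          rw [Real.rpow_neg h4.le, Real.rpow_two]
          field_simp
          ring
      _ ≤ _ := by gcongr
  have e2 : ‖deriv g x / g x‖ ≤ C / c * (x.re + 2) ^ (-δ) := by
    rw [norm_div, div_mul_eq_mul_div]
    exact div_le_div₀ ((norm_nonneg _).trans (D.g_deriv x hx)) (D.g_deriv x hx) hc ((D.g_re x hx).trans (re_le_norm _))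
  have e3 : ‖deriv b x / b x‖ ≤ C / c * (x.re + 2) ^ (-δ) := by
    rw [norm_div, div_mul_eq_mul_div]
    exact div_le_div₀ ((norm_nonneg _).trans (D.b_deriv x hx)) (D.b_deriv x hx) hc ((D.b_re x hx).trans (re_le_norm _))
  have e4 := norm_sub_le ((1 + t : ℂ) / ((x - t) * (x + 1)) + deriv g x / g x) (deriv b x / b x)
  have e5 := norm_add_le ((1 + t : ℂ) / ((x - t) * (x + 1))) (deriv g x / g x)
  rw [coup, norm_div]
  simp only [norm_ofNat]
  linarith

end TPData

/-- The imaginary part of `ell` in the lower half strip. -/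
theorem ell_im_lower (ht : 0 < t) {x : ℂ} (h1 : -1 < x.re) (h2 : x.im ≤ 0) (hxt : x - t ≠ 0)
    (hx : x ∈ HS 1) : -Real.pi ≤ (ell t x).im ∧ (ell t x).im ≤ 0 := by
  have e : (ell t x).im = arg (I * (x - t)) - Real.pi / 2 - arg (x + 1) := by
    simp [ell, log_im]
  have a1 : |arg (I * (x - t))| ≤ Real.pi / 2 := abs_arg_le_pi_div_two_iff.2 (by simpa using h2)
  have a2 : |arg (x + 1)| ≤ Real.pi / 2 := abs_arg_le_pi_div_two_iff.2 (by simp; linarith)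
  have a3 : arg (x + 1) ≤ 0 := by
    rcases h2.lt_or_eq with h | h
    · exact (arg_neg_iff.2 (by simpa using h)).le
    · rw [show x + 1 = ((x.re + 1 : ℝ) : ℂ) by apply Complex.ext <;> simp [h],
        arg_ofReal_of_nonneg (by linarith)]
  rw [abs_le] at a1 a2
  refine ⟨by rw [e]; linarith, ?_⟩
  by_contra! hpos
  have hlt : (ell t x).im < Real.pi := by rw [e]; linarith [Real.pi_pos]
  have hs := Real.sin_pos_of_pos_of_lt_pi hpos hlt
  have him : (exp (ell t x)).im ≤ 0 := by
    rw [exp_ell le_rfl hx hxt, div_im]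
    have h0 : 0 < normSq (x + 1) := normSq_pos.2 (slitPlane_ne_zero (add_one_mem_slit le_rfl hx))
    rw [← sub_div]
    refine div_nonpos_of_nonpos_of_nonneg ?_ h0.le
    simp
    nlinarith
  rw [exp_im] at him
  have := mul_pos (Real.exp_pos (ell t x).re) hs
  linarith

/-- The argument of a function with positive real part that is real on the axis. -/
theorem log_im_lower {f : ℂ → ℂ} (hc : 0 < c) (hf : DifferentiableOn ℂ f (HS r))
    (hre : ∀ x ∈ HS r, c ≤ (f x).re) (hd : ∀ x ∈ HS r, ‖deriv f x‖ ≤ C * (x.re + 2) ^ (-δ))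
    (hreal : ∀ x : ℝ, 0 ≤ x → (f x).im = 0) {s y : ℝ} (hs : 0 ≤ s) (hy : 0 ≤ y) (hyr : y < r) :
    |(log (f (s - I * y))).im| ≤ C / c * (s + 2) ^ (-δ) * y := by
  have hm : ∀ v ∈ Icc 0 y, (s - I * v : ℂ) ∈ HS r := fun v hv => by
    refine ⟨by simp; linarith, ?_⟩
    simp [abs_of_nonneg hv.1]; linarith [hv.2]
  have hder : ∀ v ∈ Icc 0 y, HasDerivWithinAt (fun v : ℝ => log (f (s - I * v)))
      (deriv f (s - I * v) * (-I) / f (s - I * v)) (Icc 0 y) v := fun v hv => by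
    have h1 : HasDerivAt (fun v : ℝ => (s - I * v : ℂ)) (-I) v := by
      simpa using ((ofRealCLM.hasDerivAt (x := v)).const_mul I).const_sub (s : ℂ)
    have h2 := (hf.differentiableAt ((isOpen_HS r).mem_nhds (hm v hv))).hasDerivAt.comp v h1
    exact (h2.clog_real (Or.inl (hc.trans_le (hre _ (hm v hv))))).hasDerivWithinAt
  have := (convex_Icc 0 y).norm_image_sub_le_of_norm_hasDerivWithin_le hder
    (C := C / c * (s + 2) ^ (-δ)) (fun v hv => by
      rw [norm_div, norm_mul, norm_neg, norm_I, mul_one, div_mul_eq_mul_div]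
      have h1 := hd _ (hm v hv)
      simp only [sub_re, ofReal_re, mul_re, I_re, zero_mul, I_im, ofReal_im, mul_zero, sub_zero]
        at h1
      exact div_le_div₀ ((norm_nonneg _).trans h1) h1 hc
        ((hre _ (hm v hv)).trans (re_le_norm _))) (left_mem_Icc.2 hy) (right_mem_Icc.2 hy)
  have h0 : (log (f s)).im = 0 := by
    have := hre _ (hm 0 (left_mem_Icc.2 hy))
    simp only [ofReal_zero, mul_zero, sub_zero] at this
    rw [log_im, show f s = ((f s).re : ℂ) from Complex.ext rfl (by simpa using hreal s hs),
      arg_ofReal_of_nonneg (hc.le.trans this)]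
  simp only [ofReal_zero, mul_zero, sub_zero, Real.norm_of_nonneg hy] at this
  refine le_trans ?_ this
  have := abs_im_le_norm (log (f (s - I * y)) - log (f s))
  rwa [sub_im, h0, sub_zero] at this

/-- The momentum along the lower half strip, in polar form. -/
theorem TPData.mom_polar (D : TPData r δ t c C α β g b) {s y : ℝ} (hs : 0 ≤ s) (hy : 0 ≤ y)
    (hyr : y < r) (hst : s ≠ t ∨ 0 < y) : ∃ ρ θ : ℝ, 0 ≤ ρ ∧
      mom t g b (s - I * y) = ρ * exp (θ * I) ∧
      -(Real.pi / 2) - C / c * (s + 2) ^ (-δ) * y ≤ θ ∧ θ ≤ C / c * (s + 2) ^ (-δ) * y := by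
  have hr := D.r_le
  set L := ell t (s - I * y) + log (g (s - I * y)) + log (b (s - I * y)) with hL
  have h1 := log_im_lower D.c_pos D.g_diff D.g_re D.g_deriv D.g_real hs hy hyr
  have h2 := log_im_lower D.c_pos D.b_diff D.b_re D.b_deriv D.b_real hs hy hyr
  have h3 := ell_im_lower D.t_pos (x := s - I * y) (by simp; linarith) (by simpa using hy)
    (fun h => by
      have e1 := congrArg re h
      have e2 := congrArg im h
      simp [sub_eq_zero] at e1 e2
      rcases hst with h | h
      · exact h e1
      · exact h.ne' e2) (by
      refine ⟨by simp; linarith, ?_⟩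
      simp [abs_of_nonneg hy]; linarith)
  rw [abs_le] at h1 h2
  refine ⟨Real.exp (L.re / 2), L.im / 2, (Real.exp_pos _).le, ?_, ?_, ?_⟩
  · rw [mom, ← hL, ofReal_exp, ← exp_add]
    congr 1
    conv_lhs => rw [← re_add_im L]
    push_cast; ring
  · simp only [hL, add_im]; linarith [h3.1]
  · simp only [hL, add_im]; linarith [h3.2]

end

section

variable {r δ t c C α β : ℝ} {g b : ℂ → ℂ}

theorem eq_sqrt_sub_I_sqrt {z : ℂ} {w : ℝ} (h1 : 0 ≤ z.re) (h2 : z.im ≤ 0) (h : z ^ 2 = w) :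
    z = Real.sqrt w - I * Real.sqrt (-w) := by
  have e1 := congrArg re h
  have e2 := congrArg im h
  simp only [sq, mul_re, mul_im, ofReal_re, ofReal_im] at e1 e2
  have e3 : z.re * z.im = 0 := by linarith
  rcases mul_eq_zero.1 e3 with h0 | h0
  · have hw : Real.sqrt w = 0 := Real.sqrt_eq_zero_of_nonpos (by nlinarith)
    have hw' : Real.sqrt (-w) = -z.im := by
      rw [show -w = (-z.im) ^ 2 by rw [h0] at e1; linarith, Real.sqrt_sq (by linarith)]
    apply Complex.ext <;> simp [hw, hw', h0]
  · have hw : Real.sqrt w = z.re := by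
      rw [show w = z.re ^ 2 by rw [h0] at e1; linarith, Real.sqrt_sq h1]
    have hw' : Real.sqrt (-w) = 0 := Real.sqrt_eq_zero_of_nonpos (by rw [h0] at e1; nlinarith)
    apply Complex.ext <;> simp [hw, hw', h0]

/-- The squared momentum on the real axis. -/
noncomputable def momSq (t : ℝ) (g b : ℂ → ℂ) (x : ℝ) : ℝ :=
  (x - t) / (x + 1) * (g x).re * (b x).re

/-- The limits at infinity are taken along this filter. -/
def atInf (r : ℝ) : Filter ℂ := comap re atTop ⊓ 𝓟 (HS r)

theorem eventually_atInf {p : ℂ → Prop} :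
    (∀ᶠ x in atInf r, p x) ↔ ∃ R : ℝ, ∀ x ∈ HS r, R ≤ x.re → p x := by
  rw [atInf, eventually_inf_principal, eventually_comap, eventually_atTop]
  constructor
  · rintro ⟨R, hR⟩
    exact ⟨R, fun x hx h => hR x.re h x rfl hx⟩
  · rintro ⟨R, hR⟩
    exact ⟨R, fun y hy x hxy hx => hR x hx (hxy ▸ hy)⟩

theorem tendsto_re_atInf : Tendsto re (atInf r) atTop :=
  tendsto_comap.mono_left inf_le_left

theorem tendsto_ofReal_atInf (hr : 0 < r) : Tendsto (fun x : ℝ => (x : ℂ)) atTop (atInf r) := by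
  refine tendsto_inf.2 ⟨tendsto_comap_iff.2 tendsto_id, ?_⟩
  exact tendsto_principal.2 ((eventually_ge_atTop 0).mono fun x hx => ofReal_mem_HS hr hx)

theorem ell_eq_log (hr : r ≤ 1) (ht : 0 < t) {x : ℂ} (hx : x ∈ HS r) (hxt : t < x.re) :
    ell t x = log ((x - t) / (x + 1)) := by
  have h0 : 0 < (x - t).re := by simpa using hxt
  have h1 : x - t ≠ 0 := fun h => by simp [h] at h0
  have a1 : |arg (x - t)| < Real.pi / 2 := abs_arg_lt_pi_div_two_iff.2 (Or.inl h0)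
  have a2 : |arg (x + 1)| < Real.pi / 2 :=
    abs_arg_lt_pi_div_two_iff.2 (Or.inl (by simp; linarith))
  rw [abs_lt] at a1 a2
  have e0 : arg (I * (x - t)) = Real.pi / 2 + arg (x - t) := by
    rw [arg_mul I_ne_zero h1 (by rw [arg_I]; constructor <;> linarith), arg_I]
  have e : (ell t x).im = arg (x - t) - arg (x + 1) := by
    simp [ell, log_im, e0]
  rw [← exp_ell hr hx h1, log_exp (by rw [e]; linarith) (by rw [e]; linarith)]

theorem tendsto_tau (t : ℝ) : Tendsto (fun x : ℂ => (x - t) / (x + 1)) (atInf r) (𝓝 1) := by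
  have h0 : Tendsto (fun x : ℂ => ‖x + 1‖) (atInf r) atTop :=
    tendsto_atTop_mono (fun x => (by simpa using re_le_norm (x + 1) : x.re + 1 ≤ ‖x + 1‖))
      (tendsto_re_atInf.atTop_add tendsto_const_nhds)
  have h1 : Tendsto (fun x : ℂ => (x + 1)⁻¹) (atInf r) (𝓝 0) :=
    tendsto_inv₀_cobounded.comp (tendsto_norm_atTop_iff_cobounded.1 h0)
  have h2 := ((h1.const_mul (1 + t : ℂ)).const_sub 1)
  rw [mul_zero, sub_zero] at h2
  refine h2.congr' ?_
  filter_upwards [h0.eventually_gt_atTop 0] with x hx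
  have := norm_pos_iff.1 hx
  field_simp
  ring

theorem tendsto_of_norm_sub_le (hδ : 0 < δ) {f : ℂ → ℂ} {z : ℂ}
    (h : ∀ x ∈ HS r, ‖f x - z‖ ≤ C * (x.re + 2) ^ (-δ)) : Tendsto f (atInf r) (𝓝 z) := by
  rw [tendsto_iff_norm_sub_tendsto_zero]
  have h1 : Tendsto (fun x : ℂ => C * (x.re + 2) ^ (-δ)) (atInf r) (𝓝 0) := by
    have := ((tendsto_rpow_neg_atTop hδ).comp
      (tendsto_re_atInf (r := r).atTop_add (tendsto_const_nhds (x := (2 : ℝ))))).const_mul C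
    simpa [Function.comp_def] using this
  refine squeeze_zero' (Eventually.of_forall fun _ => norm_nonneg _) ?_ h1
  exact eventually_atInf.2 ⟨0, fun x hx _ => h x hx⟩

namespace TPData

theorem tendsto_ell (D : TPData r δ t c C α β g b) : Tendsto (ell t) (atInf r) (𝓝 0) := by
  have h := (tendsto_tau (r := r) t).clog one_mem_slitPlane
  rw [log_one] at h
  refine h.congr' ?_
  exact eventually_atInf.2 ⟨t + 1, fun x hx hxt =>
    (ell_eq_log D.r_le_one D.t_pos hx (by linarith)).symm⟩

theorem tendsto_log_g (D : TPData r δ t c C α β g b) :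
    Tendsto (fun x => log (g x)) (atInf r) (𝓝 (Real.log α)) := by
  have h1 := tendsto_of_norm_sub_le (by linarith [D.δ_gt]) D.g_lim
  have h2 := h1.div (tendsto_tau (r := r) t) one_ne_zero
  rw [div_one] at h2
  have h3 : Tendsto g (atInf r) (𝓝 (α : ℂ)) := by
    refine h2.congr' ?_
    refine eventually_atInf.2 ⟨t + 1, fun x hx hxt => ?_⟩
    have h4 : x - t ≠ 0 := fun h => by
      have := congrArg re h; simp at this; linarith
    have h5 := slitPlane_ne_zero (add_one_mem_slit D.r_le_one hx)
    simp only [Pi.div_apply]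
    field_simp
  rw [ofReal_log D.α_pos.le]
  exact h3.clog (ofReal_mem_slitPlane.2 D.α_pos)

theorem tendsto_log_b (D : TPData r δ t c C α β g b) :
    Tendsto (fun x => log (b x)) (atInf r) (𝓝 (Real.log β)) := by
  have h1 := tendsto_of_norm_sub_le (by linarith [D.δ_gt]) D.b_lim
  rw [ofReal_log D.β_pos.le]
  exact h1.clog (ofReal_mem_slitPlane.2 D.β_pos)

theorem tendsto_mom (D : TPData r δ t c C α β g b) :
    Tendsto (mom t g b) (atInf r) (𝓝 (Real.sqrt (α * β))) := by
  have h := (((D.tendsto_ell.add D.tendsto_log_g).add D.tendsto_log_b).div_const 2).cexp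
  convert h using 2
  · rfl
  rw [zero_add, ← ofReal_add, ← Real.log_mul D.α_pos.ne' D.β_pos.ne',
    show ((Real.log (α * β) : ℝ) : ℂ) / 2 = ((Real.log (α * β) / 2 : ℝ) : ℂ) by push_cast; rfl,
    ← ofReal_exp, ← Real.log_sqrt (mul_pos D.α_pos D.β_pos).le,
    Real.exp_log (Real.sqrt_pos.2 (mul_pos D.α_pos D.β_pos))]

theorem tendsto_amp (D : TPData r δ t c C α β g b) :
    Tendsto (amp t g b) (atInf r) (𝓝 (((α / β) ^ ((1 : ℝ) / 4) : ℝ) : ℂ)) := by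
  have h := (((D.tendsto_ell.add D.tendsto_log_g).sub D.tendsto_log_b).div_const 4).cexp
  convert h using 2
  · rfl
  rw [zero_add, ← ofReal_sub, ← Real.log_div D.α_pos.ne' D.β_pos.ne',
    show ((Real.log (α / β) : ℝ) : ℂ) / 4 = ((Real.log (α / β) * (1 / 4) : ℝ) : ℂ) by
      push_cast; ring, ← ofReal_exp, Real.rpow_def_of_pos (div_pos D.α_pos D.β_pos)]

theorem g_ofReal (D : TPData r δ t c C α β g b) {x : ℝ} (hx : 0 ≤ x) :
    g x = ((g x).re : ℂ) := Complex.ext rfl (by simpa using D.g_real x hx)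

theorem b_ofReal (D : TPData r δ t c C α β g b) {x : ℝ} (hx : 0 ≤ x) :
    b x = ((b x).re : ℂ) := Complex.ext rfl (by simpa using D.b_real x hx)

theorem mom_real (D : TPData r δ t c C α β g b) {x : ℝ} (hx : 0 ≤ x) (hxt : x ≠ t) :
    mom t g b x = Real.sqrt (momSq t g b x) - I * Real.sqrt (-momSq t g b x) := by
  obtain ⟨ρ, θ, hρ, e, h1, h2⟩ := D.mom_polar hx le_rfl D.r_pos (Or.inl hxt)
  simp only [ofReal_zero, mul_zero, sub_zero] at e h1 h2
  have er : (mom t g b x).re = ρ * Real.cos θ := by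
    rw [e, exp_mul_I]; simp [← ofReal_cos, ← ofReal_sin]
  have ei : (mom t g b x).im = ρ * Real.sin θ := by
    rw [e, exp_mul_I]; simp [← ofReal_cos, ← ofReal_sin]
  refine eq_sqrt_sub_I_sqrt ?_ ?_ ?_
  · rw [er]
    exact mul_nonneg hρ (Real.cos_nonneg_of_neg_pi_div_two_le_of_le h1
      (by linarith [Real.pi_pos]))
  · rw [ei]
    exact mul_nonpos_of_nonneg_of_nonpos hρ
      (Real.sin_nonpos_of_nonpos_of_neg_pi_le h2 (by linarith [Real.pi_pos]))
  · rw [D.mom_sq (ofReal_mem_HS D.r_pos hx) (by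
      rw [← ofReal_sub]; exact ofReal_ne_zero.2 (sub_ne_zero.2 hxt)), momSq, D.g_ofReal hx,
      D.b_ofReal hx]
    push_cast
    simp

theorem amp_zero (D : TPData r δ t c C α β g b) : amp t g b 0 =
    ((t * (g 0).re / (b 0).re) ^ ((1 : ℝ) / 4) : ℝ) * exp (-(Real.pi / 4) * I) := by
  have h0 : (0 : ℂ) ∈ HS r := by simpa using ofReal_mem_HS D.r_pos le_rfl
  have hg := D.c_pos.trans_le (D.g_re 0 h0)
  have hb := D.c_pos.trans_le (D.b_re 0 h0)
  have eg := D.g_ofReal le_rfl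
  have eb := D.b_ofReal le_rfl
  rw [ofReal_zero] at eg eb
  have ht := D.t_pos
  have e1 : I * ((0 : ℂ) - t) = (t : ℂ) * -I := by ring
  have e2 : log (g 0) = (Real.log (g 0).re : ℂ) := by
    rw [ofReal_log hg.le, ← eg]
  have e3 : log (b 0) = (Real.log (b 0).re : ℂ) := by
    rw [ofReal_log hb.le, ← eb]
  rw [amp, ell, e1, log_ofReal_mul ht (neg_ne_zero.2 I_ne_zero), log_neg_I, zero_add, log_one,
    e2, e3, Real.rpow_def_of_pos (by positivity), Real.log_div (by positivity) hb.ne',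
    Real.log_mul ht.ne' hg.ne', ofReal_exp, ← exp_add]
  congr 1
  push_cast
  ring

end TPData

end

section

/-- A holomorphic path through the lower half plane around the turning point. -/
structure DetourPath (r δ t C₁ r₁ d Y : ℝ) (γ γ' : ℂ → ℂ) (y y' : ℝ → ℝ) : Prop where
  r₁_pos : 0 < r₁
  r₁_le : r₁ ≤ 1 / 2
  d_pos : 0 < d
  Y_lt : Y < r
  deriv : ∀ s ∈ HS r₁, HasDerivAt γ (γ' s) s
  diff : DifferentiableOn ℂ γ' (HS r₁)
  norm_sub_one : ∀ s ∈ HS r₁, ‖γ' s - 1‖ ≤ 1 / 2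
  mem : ∀ s ∈ HS r₁, γ s ∈ slitHS r t
  dist : ∀ s ∈ HS r₁, d ≤ ‖γ s - t‖
  re_ge : ∀ s ∈ HS r₁, s.re - 1 / 2 ≤ (γ s).re
  zero : γ 0 = 0
  eq : ∀ s : ℝ, 0 ≤ s → γ s = s - I * y s
  y_nonneg : ∀ s : ℝ, 0 ≤ s → 0 ≤ y s
  y_le : ∀ s : ℝ, 0 ≤ s → y s ≤ Y
  eq' : ∀ s : ℝ, 0 ≤ s → γ' s = 1 - I * y' s
  y'_ge : ∀ s : ℝ, 0 ≤ s → 2 * (C₁ * (s + 2) ^ (-δ) * y s) ≤ y' s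
  y'_le : ∀ s : ℝ, 0 ≤ s → y' s ≤ 1 / 2

/-- The profile of the detour. -/
noncomputable def prof (K δ : ℝ) (s : ℂ) : ℂ := exp (-(K * (s + 2) ^ ((1 - δ : ℝ) : ℂ)))

theorem prof_ofReal (K δ : ℝ) {s : ℝ} (hs : 0 ≤ s) :
    prof K δ s = (Real.exp (-(K * (s + 2) ^ (1 - δ))) : ℝ) := by
  rw [prof, ofReal_exp, ofReal_neg, ofReal_mul, ofReal_cpow (by linarith)]
  push_cast; rfl

theorem one_le_norm_add_two {r : ℝ} (hr : r ≤ 1) {s : ℂ} (hs : s ∈ HS r) : 1 ≤ ‖s + 2‖ := by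
  refine le_trans ?_ (re_le_norm _)
  simp; linarith [hs.1]

theorem add_two_mem_slit {r : ℝ} (hr : r ≤ 1) {s : ℂ} (hs : s ∈ HS r) : s + 2 ∈ slitPlane := by
  left; simp; linarith [hs.1]

theorem norm_cpow_real {z : ℂ} (hz : z ≠ 0) (a : ℝ) : ‖z ^ (a : ℂ)‖ = ‖z‖ ^ a := by
  rw [norm_cpow_of_ne_zero hz]; simp

theorem norm_prof_le {K δ r : ℝ} (hK : 0 ≤ K) (hδ : 1 < δ) (hr : r ≤ 1) {s : ℂ} (hs : s ∈ HS r) :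
    ‖prof K δ s‖ ≤ Real.exp K := by
  rw [prof, norm_exp, Real.exp_le_exp]
  refine (re_le_norm _).trans ?_
  rw [norm_neg, norm_mul, norm_real, Real.norm_of_nonneg hK,
    norm_cpow_real (slitPlane_ne_zero (add_two_mem_slit hr hs))]
  have := Real.rpow_le_one_of_one_le_of_nonpos (one_le_norm_add_two hr hs)
    (by linarith : 1 - δ ≤ 0)
  nlinarith

theorem hasDerivAt_prof {K δ r : ℝ} (hr : r ≤ 1) {s : ℂ} (hs : s ∈ HS r) :
    HasDerivAt (prof K δ) (K * (δ - 1) * (s + 2) ^ ((-δ : ℝ) : ℂ) * prof K δ s) s := by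
  have h1 : HasDerivAt (fun s : ℂ => s + 2) 1 s := by
    simpa using (hasDerivAt_id s).add_const (2 : ℂ)
  have h2 := (h1.cpow_const (c := ((1 - δ : ℝ) : ℂ)) (add_two_mem_slit hr hs)).const_mul (K : ℂ)
  refine h2.neg.cexp.congr_deriv ?_
  have : ((1 - δ : ℝ) : ℂ) - 1 = ((-δ : ℝ) : ℂ) := by push_cast; ring
  simp only [prof, this, Pi.neg_apply]
  push_cast; ring

theorem norm_prof_deriv_le {K δ r : ℝ} (hK : 0 ≤ K) (hδ : 1 < δ) (hr : r ≤ 1) {s : ℂ}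
    (hs : s ∈ HS r) :
    ‖K * (δ - 1) * (s + 2) ^ ((-δ : ℝ) : ℂ) * prof K δ s‖ ≤ K * (δ - 1) * Real.exp K := by
  have h1 := Real.rpow_le_one_of_one_le_of_nonpos (one_le_norm_add_two hr hs)
    (by linarith : -δ ≤ 0)
  have h2 := norm_prof_le hK hδ hr hs
  rw [show ((K : ℂ) * (δ - 1)) = ((K * (δ - 1) : ℝ) : ℂ) by push_cast; rfl, norm_mul, norm_mul,
    norm_cpow_real (slitPlane_ne_zero (add_two_mem_slit hr hs)), norm_real,
    Real.norm_of_nonneg (mul_nonneg hK (by linarith))]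
  have h3 : 0 ≤ K * (δ - 1) := mul_nonneg hK (by linarith)
  calc K * (δ - 1) * ‖s + 2‖ ^ (-δ) * ‖prof K δ s‖ ≤ K * (δ - 1) * 1 * Real.exp K := by gcongr
    _ = _ := by ring

theorem exists_detourPath {r δ t C₁ : ℝ} (hr : 0 < r) (hr' : r ≤ 1 / 2) (hδ : 1 < δ) (ht : 0 < t)
    (hC : 0 < C₁) : ∃ r₁ d Y γ γ' y y', DetourPath r δ t C₁ r₁ d Y γ γ' y y' := by
  set K := 2 * C₁ / (δ - 1) with hK
  have hδ' : 0 < δ - 1 := by linarith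
  have hK0 : 0 < K := by positivity
  have hKδ : K * (δ - 1) = 2 * C₁ := by rw [hK]; field_simp
  set M := K * (δ - 1) * Real.exp K with hM
  have hM0 : 0 < M := by positivity
  have he := Real.exp_pos K
  set ε := min (min (r / 2) (t / 4)) (1 / 2) / (2 * Real.exp K + M) with hε
  have hε0 : 0 < ε := by positivity
  have hε' : ε * (2 * Real.exp K + M) = min (min (r / 2) (t / 4)) (1 / 2) := by
    rw [hε]; field_simp
  have hε1 : ε * (2 * Real.exp K) + ε * M ≤ r / 2 := by
    rw [← mul_add, hε']; exact (min_le_left _ _).trans (min_le_left _ _)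
  have hε2 : ε * (2 * Real.exp K) + ε * M ≤ t / 4 := by
    rw [← mul_add, hε']; exact (min_le_left _ _).trans (min_le_right _ _)
  have hε3 : ε * (2 * Real.exp K) + ε * M ≤ 1 / 2 := by
    rw [← mul_add, hε']; exact min_le_right _ _
  have hεe : 0 < ε * (2 * Real.exp K) := by positivity
  have hεM : 0 < ε * M := by positivity
  set R : ℝ → ℝ := fun s => Real.exp (-(K * (s + 2) ^ (1 - δ))) with hR
  have hRlt : ∀ s₁ s₂ : ℝ, 0 ≤ s₁ → s₁ < s₂ → R s₁ < R s₂ := fun s₁ s₂ h1 h2 => by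
    have := Real.rpow_lt_rpow_of_neg (by linarith : 0 < s₁ + 2) (by linarith : s₁ + 2 < s₂ + 2)
      (by linarith : 1 - δ < 0)
    simp only [hR, Real.exp_lt_exp]
    nlinarith
  have hRle : ∀ s₁ s₂ : ℝ, 0 ≤ s₁ → s₁ ≤ s₂ → R s₁ ≤ R s₂ := fun s₁ s₂ h1 h2 =>
    h2.eq_or_lt.elim (fun h => by rw [h]) fun h => (hRlt _ _ h1 h).le
  have hR1 : ∀ s : ℝ, 0 ≤ s → R s ≤ Real.exp K := fun s hs => by
    simp only [hR, Real.exp_le_exp]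
    have : 0 ≤ (s + 2) ^ (1 - δ) := by positivity
    nlinarith
  have hR0 : ∀ s : ℝ, 0 < R s := fun s => Real.exp_pos _
  set D := ε * (R (t / 2) - R 0) with hD
  have hD0 : 0 < D := mul_pos hε0 (sub_pos.2 (hRlt _ _ le_rfl (by linarith)))
  set γ : ℂ → ℂ := fun s => s - I * (ε * (prof K δ s - R 0)) with hγ
  set γ' : ℂ → ℂ := fun s => 1 - I * (ε * (K * (δ - 1) * (s + 2) ^ ((-δ : ℝ) : ℂ) * prof K δ s))
    with hγ'
  set r₁ := min (r / 2) (D / 4) with hr₁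
  have hr₁0 : 0 < r₁ := by positivity
  have hr₁1 : r₁ ≤ r / 2 := min_le_left _ _
  have hr₁2 : r₁ ≤ D / 4 := min_le_right _ _
  have hr₁3 : r₁ ≤ 1 := by linarith
  have hder : ∀ s ∈ HS r₁, HasDerivAt γ (γ' s) s := fun s hs =>
    (hasDerivAt_id s).sub ((((hasDerivAt_prof hr₁3 hs).sub_const _).const_mul _).const_mul _)
  have hγ'1 : ∀ s ∈ HS r₁, ‖γ' s - 1‖ ≤ ε * M := fun s hs => by
    have e : γ' s - 1 = -(I * (ε * (K * (δ - 1) * (s + 2) ^ ((-δ : ℝ) : ℂ) * prof K δ s))) :=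
      sub_sub_cancel_left _ _
    rw [e, norm_neg, norm_mul, norm_I, one_mul, norm_mul, norm_real, Real.norm_of_nonneg hε0.le]
    exact mul_le_mul_of_nonneg_left (norm_prof_deriv_le hK0.le hδ hr₁3 hs) hε0.le
  have hRr : ∀ s : ℝ, 0 ≤ s → γ s = s - I * (ε * (R s - R 0) : ℝ) := fun s hs => by
    simp only [hγ, prof_ofReal K δ hs]
    rw [ofReal_mul, ofReal_sub]
  have hclose : ∀ s ∈ HS r₁, ‖γ s - s‖ ≤ ε * (2 * Real.exp K) := fun s hs => by
    simp only [hγ, sub_sub_cancel_left, norm_neg, norm_mul, norm_I, one_mul, norm_real,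
      Real.norm_of_nonneg hε0.le]
    have h1 := norm_sub_le (prof K δ s) (R 0 : ℂ)
    have h2 := norm_prof_le hK0.le hδ hr₁3 hs
    rw [norm_real, Real.norm_of_nonneg (hR0 0).le] at h1
    have h3 := hR1 0 le_rfl
    gcongr
    linarith
  have hmem : ∀ s ∈ HS r₁, γ s ∈ HS r := fun s hs => by
    refine HS_mono (by linarith : r₁ + r / 2 ≤ r) (closedBall_subset_HS hs ?_)
    rw [Metric.mem_closedBall, dist_eq_norm]
    linarith [hclose s hs]
  have hreg : ∀ s ∈ HS r₁, (γ s).re ≤ t - t / 4 ∨ (γ s).im ≤ -(D / 2) := fun s hs => by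
    rcases le_total s.re (t / 2) with h | h
    · left
      have := (abs_re_le_norm _).trans (hclose s hs)
      rw [sub_re, abs_le] at this
      linarith [this.2]
    · right
      have hs0 : 0 ≤ s.re := by linarith
      have h1 := (convex_HS r₁).norm_image_sub_le_of_norm_hasDerivWithin_le (C := 2)
        (fun x hx => (hder x hx).hasDerivWithinAt) (fun x hx => by
          have h1 := hγ'1 x hx
          have h2 := norm_add_le (γ' x - 1) 1
          rw [sub_add_cancel, norm_one] at h2
          linarith) (ofReal_mem_HS hr₁0 hs0) hs
      have h2 : ‖s - s.re‖ ≤ r₁ := by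
        have : s - s.re = s.im * I := by apply Complex.ext <;> simp
        rw [this, norm_mul, norm_I, mul_one, norm_real]
        exact hs.2.le
      have h3 := (abs_im_le_norm _).trans h1
      rw [sub_im, abs_le, hRr _ hs0] at h3
      have h4 : ((s.re : ℂ) - I * (ε * (R s.re - R 0) : ℝ)).im = -(ε * (R s.re - R 0)) := by
        simp
      rw [h4] at h3
      have h5 := hRle (t / 2) s.re (by linarith) h
      have h6 : D ≤ ε * (R s.re - R 0) := by rw [hD]; gcongr
      linarith [h3.2]
  refine ⟨r₁, min (t / 4) (D / 2), ε * (2 * Real.exp K), γ, γ', fun s => ε * (R s - R 0),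
    fun s => ε * (K * (δ - 1) * (s + 2) ^ (-δ) * R s), hr₁0, by linarith, by positivity,
    by linarith, hder, ?_, fun s hs => (hγ'1 s hs).trans (by linarith), fun s hs => ?_,
    fun s hs => ?_, fun s hs => ?_, ?_, hRr, fun s hs => ?_, fun s hs => ?_, fun s hs => ?_,
    fun s hs => ?_, fun s hs => ?_⟩
  · intro s hs
    have h1 := (hasDerivAt_prof (K := K) (δ := δ) hr₁3 hs).differentiableAt
    have h2 : DifferentiableAt ℂ (fun s : ℂ => (s + 2) ^ ((-δ : ℝ) : ℂ)) s :=
      DifferentiableAt.cpow_const (by fun_prop) (add_two_mem_slit hr₁3 hs)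
    exact ((((((differentiableAt_const _).mul h2).mul h1).const_mul _).const_mul
      _).const_sub _).differentiableWithinAt
  · refine mem_slitHS_lower (hmem s hs) ?_
    rcases hreg s hs with h | h
    · right; linarith
    · left; linarith
  · rcases hreg s hs with h | h
    · refine (min_le_left _ _).trans (le_trans ?_ (abs_re_le_norm _))
      rw [sub_re, ofReal_re, abs_of_nonpos] <;> linarith
    · refine (min_le_right _ _).trans (le_trans ?_ (abs_im_le_norm _))
      rw [sub_im, ofReal_im, abs_of_nonpos] <;> linarith
  · have := (abs_re_le_norm _).trans (hclose s hs)
    rw [sub_re, abs_le] at this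
    linarith [this.1]
  · have := hRr 0 le_rfl
    simpa using this
  · exact mul_nonneg hε0.le (sub_nonneg.2 (hRle _ _ le_rfl hs))
  · have := hR1 s hs
    have := hR0 0
    gcongr
    linarith
  · have e : ((s : ℂ) + 2) ^ ((-δ : ℝ) : ℂ) = (((s + 2) ^ (-δ) : ℝ) : ℂ) := by
      rw [ofReal_cpow (by linarith)]
      push_cast; rfl
    simp only [hγ', prof_ofReal K δ hs, e]
    rw [ofReal_mul, ofReal_mul, ofReal_mul, ofReal_mul, ofReal_sub, ofReal_one]
  · rw [hKδ]
    have h1 : 0 ≤ (s + 2) ^ (-δ) := by positivity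
    have h2 := hR0 0
    have : ε * (2 * C₁ * (s + 2) ^ (-δ) * R s) - 2 * (C₁ * (s + 2) ^ (-δ) * (ε * (R s - R 0)))
      = 2 * ε * C₁ * (s + 2) ^ (-δ) * R 0 := by ring
    have : 0 ≤ 2 * ε * C₁ * (s + 2) ^ (-δ) * R 0 := by positivity
    linarith
  · have h1 := Real.rpow_le_one_of_one_le_of_nonpos (by linarith : 1 ≤ s + 2)
      (by linarith : -δ ≤ 0)
    have h2 := hR1 s hs
    have h3 : K * (δ - 1) * (s + 2) ^ (-δ) * R s ≤ M := by
      rw [hM]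
      calc K * (δ - 1) * (s + 2) ^ (-δ) * R s ≤ K * (δ - 1) * 1 * Real.exp K := by
            have := (hR0 s).le
            gcongr
        _ = _ := by ring
    have : ε * (K * (δ - 1) * (s + 2) ^ (-δ) * R s) ≤ ε * M := by gcongr
    linarith

namespace TPData

variable {r δ t c C α β : ℝ} {g b : ℂ → ℂ}

theorem coreData (D : TPData r δ t c C α β g b) {r₁ d Y : ℝ} {γ γ' : ℂ → ℂ} {y y' : ℝ → ℝ}
    (p : DetourPath r δ t (C / c) r₁ d Y γ γ' y y') : ∃ c₀ C₀ G,
    CoreData r₁ δ c₀ C₀ G (fun s => mom t g b (γ s) * γ' s) (fun s => coup t g b (γ s) * γ' s) := by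
  have hd := p.d_pos
  have ht := D.t_pos
  have hc := D.c_pos
  have hC := D.C_pos
  have hne : ∀ s ∈ HS r₁, γ s - t ≠ 0 := fun s hs => norm_pos_iff.1 (hd.trans_le (p.dist s hs))
  have hγ'l : ∀ s ∈ HS r₁, 1 / 2 ≤ ‖γ' s‖ := fun s hs => by
    have h1 := p.norm_sub_one s hs
    have h2 := norm_sub_le (γ' s) (γ' s - 1)
    rw [sub_sub_cancel, norm_one] at h2
    linarith
  have hγ'u : ∀ s ∈ HS r₁, ‖γ' s‖ ≤ 2 := fun s hs => by
    have h1 := p.norm_sub_one s hs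
    have h2 := norm_add_le (γ' s - 1) 1
    rw [sub_add_cancel, norm_one] at h2
    linarith
  set G := ((1 + t) * (9 * ((d + 1 + t) / d)) + C / c + C / c) / 4 with hG
  have hG0 : 0 ≤ G := by positivity
  refine ⟨Real.sqrt (d / (d + 1 + t) * c * c) * (1 / 2), Real.sqrt ((3 + 2 * t) * C * C) * 2,
    G * 2 ^ δ * 2, p.r₁_pos, p.r₁_le, D.δ_gt, by positivity, by positivity, ?_, ?_, ?_, ?_, ?_, ?_⟩
  · exact DifferentiableOn.mul (fun s hs => ((D.differentiableAt_mom (p.mem s hs)).comp s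
      (p.deriv s hs).differentiableAt).differentiableWithinAt) p.diff
  · exact DifferentiableOn.mul (fun s hs => ((D.differentiableAt_coup (p.mem s hs)).comp s
      (p.deriv s hs).differentiableAt).differentiableWithinAt) p.diff
  · intro s hs
    rw [norm_mul]
    exact mul_le_mul (D.le_mom hd (p.mem s hs).1 (p.dist s hs)) (hγ'l s hs) (by norm_num)
      (norm_nonneg _)
  · intro s hs
    rw [norm_mul]
    exact mul_le_mul (D.mom_le (p.mem s hs).1 (hne s hs)) (hγ'u s hs) (norm_nonneg _)
      (Real.sqrt_nonneg _)
  · intro s hs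
    rw [norm_mul]
    have h1 := D.norm_coup_le hd (p.mem s hs).1 (p.dist s hs)
    have h2 := rpow_shift_le (by linarith [D.δ_gt] : 0 ≤ δ)
      (by linarith [hs.1, p.r₁_le] : -1 ≤ s.re) (p.re_ge s hs)
    calc _ ≤ G * (2 ^ δ * (s.re + 2) ^ (-δ)) * 2 :=
          mul_le_mul (h1.trans (by gcongr)) (hγ'u s hs) (norm_nonneg _)
            (mul_nonneg hG0 ((Real.rpow_nonneg (by linarith [(p.mem s hs).1.1, D.r_le]) _).trans h2))
      _ = _ := by ring
  · intro s hs
    have hy := p.y_nonneg s hs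
    have hyr := (p.y_le s hs).trans_lt p.Y_lt
    obtain ⟨ρ, θ, hρ, e, h1, h2⟩ := D.mom_polar hs hy hyr (by
      by_contra! h
      have := hne s (ofReal_mem_HS p.r₁_pos hs)
      rw [p.eq s hs, show y s = 0 from le_antisymm h.2 hy, h.1] at this
      simp at this)
    have h3 := p.y'_ge s hs
    have h4 := p.y'_le s hs
    set ϑ := C / c * (s + 2) ^ (-δ) * y s
    have hϑ : 0 ≤ ϑ := by positivity
    have him : (mom t g b (γ s) * γ' s).im = ρ * (Real.sin θ - y' s * Real.cos θ) := by
      rw [p.eq s hs, p.eq' s hs, e, exp_mul_I]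
      simp [← ofReal_cos, ← ofReal_sin]
      ring
    simp only [him]
    refine mul_nonpos_of_nonneg_of_nonpos hρ ?_
    rcases le_total θ 0 with h5 | h5
    · rcases le_total (-(Real.pi / 2)) θ with h6 | h6
      · have := Real.sin_nonpos_of_nonpos_of_neg_pi_le h5 (by linarith [Real.pi_pos])
        have := Real.cos_nonneg_of_neg_pi_div_two_le_of_le h6 (by linarith [Real.pi_pos])
        have : 0 ≤ y' s * Real.cos θ := mul_nonneg (by linarith) this
        linarith
      · set ψ := -(Real.pi / 2) - θ with hψ
        have e1 : Real.sin θ = -Real.cos ψ := by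
          rw [show θ = -(ψ + Real.pi / 2) by rw [hψ]; ring, Real.sin_neg, Real.sin_add_pi_div_two]
        have e2 : Real.cos θ = -Real.sin ψ := by
          rw [show θ = -(ψ + Real.pi / 2) by rw [hψ]; ring, Real.cos_neg, Real.cos_add_pi_div_two]
        have h7 : 0 ≤ ψ := by linarith
        have h8 : ψ ≤ 1 / 4 := by linarith
        have := Real.one_sub_sq_div_two_le_cos (x := ψ)
        have := Real.sin_le h7
        have : y' s * Real.sin ψ ≤ 1 / 2 * (1 / 4) := by
          refine (mul_le_mul_of_nonneg_left (by linarith : Real.sin ψ ≤ 1 / 4) (by linarith)).trans ?_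
          gcongr
        rw [e1, e2]
        nlinarith
    · have := Real.one_sub_sq_div_two_le_cos (x := θ)
      have := Real.sin_le h5
      have h8 : θ ≤ 1 / 4 := by linarith
      have : 1 / 2 ≤ Real.cos θ := by nlinarith
      have : y' s * (1 / 2) ≤ y' s * Real.cos θ := by gcongr; linarith
      linarith

end TPData

end

section

theorem gronwallBound_self (K ε y : ℝ) : gronwallBound ε K ε y = ε * gronwallBound 1 K 1 y := by
  by_cases hK : K = 0
  · subst hK; rw [gronwallBound_K0, gronwallBound_K0]; ring
  · rw [gronwallBound_of_K_ne_0 hK, gronwallBound_of_K_ne_0 hK]; ring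

theorem solution_unique {u v u' v' a b : ℝ → ℂ} {M : ℝ}
    (ha : ∀ s : ℝ, 0 ≤ s → ‖a s‖ ≤ M) (hb : ∀ s : ℝ, 0 ≤ s → ‖b s‖ ≤ M)
    (hu : ∀ s : ℝ, 0 ≤ s → HasDerivAt u (a s * v s) s)
    (hv : ∀ s : ℝ, 0 ≤ s → HasDerivAt v (b s * u s) s)
    (hu' : ∀ s : ℝ, 0 ≤ s → HasDerivAt u' (a s * v' s) s)
    (hv' : ∀ s : ℝ, 0 ≤ s → HasDerivAt v' (b s * u' s) s)
    (e1 : u 0 = u' 0) (e2 : v 0 = v' 0) {s : ℝ} (hs : 0 ≤ s) : u s = u' s ∧ v s = v' s := by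
  have hM : 0 ≤ M := (norm_nonneg _).trans (ha 0 le_rfl)
  have h := pair_gronwall (z := fun s => u s - u' s) (w := fun s => v s - v' s) (K := M)
    (ε := 0) (d := 0) (Y := s) (fun y hy => (hu y hy.1).sub (hu' y hy.1))
    (fun y hy => (hv y hy.1).sub (hv' y hy.1))
    (fun y hy => by
      rw [← mul_sub, norm_mul, add_zero]
      exact mul_le_mul (ha y hy.1) (le_max_right _ _) (norm_nonneg _) hM)
    (fun y hy => by
      rw [← mul_sub, norm_mul, add_zero]
      exact mul_le_mul (hb y hy.1) (le_max_left _ _) (norm_nonneg _) hM)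
    (by simp [e1]) (by simp [e2]) (right_mem_Icc.2 hs)
  rw [gronwallBound_self] at h
  simp only [zero_mul, norm_le_zero_iff, sub_eq_zero] at h
  exact h

theorem tendsto_vertical {r M Y : ℝ} (hr : 0 < r) {U V a b : ℂ → ℂ} {κ A B : ℂ} {y : ℝ → ℝ}
    (hU : ∀ x ∈ HS r, HasDerivAt U (a x * V x) x) (hV : ∀ x ∈ HS r, HasDerivAt V (b x * U x) x)
    (ha : ∀ x ∈ HS r, ‖a x‖ ≤ M) (hb : ∀ x ∈ HS r, ‖b x‖ ≤ M)
    (h1 : Tendsto (fun x => κ * A + a x * B) (atInf r) (𝓝 0))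
    (h2 : Tendsto (fun x => κ * B + b x * A) (atInf r) (𝓝 0))
    (hUl : Tendsto (fun s : ℝ => exp (κ * s) * U s) atTop (𝓝 A))
    (hVl : Tendsto (fun s : ℝ => exp (κ * s) * V s) atTop (𝓝 B))
    (hy0 : ∀ s : ℝ, 0 ≤ s → 0 ≤ y s) (hyY : ∀ s : ℝ, 0 ≤ s → y s ≤ Y) (hYr : Y < r) :
    Tendsto (fun s : ℝ => exp (κ * (s - I * y s)) * U (s - I * y s)) atTop (𝓝 A) ∧
    Tendsto (fun s : ℝ => exp (κ * (s - I * y s)) * V (s - I * y s)) atTop (𝓝 B) := by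
  have hM : 0 ≤ M := (norm_nonneg _).trans (ha _ (ofReal_mem_HS hr le_rfl))
  have hY : 0 ≤ Y := (hy0 0 le_rfl).trans (hyY 0 le_rfl)
  set K := ‖κ‖ + M with hK
  have hK0 : 0 ≤ K := by positivity
  set N := gronwallBound 1 K 1 Y with hN
  have hmono : ∀ v ∈ Icc 0 Y, gronwallBound 1 K 1 v ≤ N := fun v hv =>
    gronwallBound_mono zero_le_one zero_le_one hK0 hv.2
  have hN0 : 0 < N := by
    refine lt_of_lt_of_le ?_ (hmono 0 ⟨le_rfl, hY⟩)
    rw [gronwallBound_x0]; norm_num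
  have key : ∀ ε > 0, ∃ S : ℝ, ∀ s ≥ S,
      ‖exp (κ * (s - I * y s)) * U (s - I * y s) - A‖ ≤ ε * N ∧
      ‖exp (κ * (s - I * y s)) * V (s - I * y s) - B‖ ≤ ε * N := by
    intro ε hε
    obtain ⟨R₁, hR₁⟩ := eventually_atInf.1 (h1.eventually
      (p := fun z => z ∈ Metric.closedBall 0 ε) (Metric.closedBall_mem_nhds _ hε))
    obtain ⟨R₂, hR₂⟩ := eventually_atInf.1 (h2.eventually
      (p := fun z => z ∈ Metric.closedBall 0 ε) (Metric.closedBall_mem_nhds _ hε))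
    obtain ⟨R₃, hR₃⟩ := eventually_atTop.1 (hUl.eventually
      (p := fun z => z ∈ Metric.closedBall A ε) (Metric.closedBall_mem_nhds _ hε))
    obtain ⟨R₄, hR₄⟩ := eventually_atTop.1 (hVl.eventually
      (p := fun z => z ∈ Metric.closedBall B ε) (Metric.closedBall_mem_nhds _ hε))
    simp only [mem_closedBall_iff_norm, sub_zero] at hR₁ hR₂ hR₃ hR₄
    refine ⟨max 0 (max (max R₁ R₂) (max R₃ R₄)), fun s hs => ?_⟩
    simp only [ge_iff_le, max_le_iff] at hs
    obtain ⟨hs0, ⟨hs1, hs2⟩, hs3, hs4⟩ := hs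
    have hx : ∀ v ∈ Icc 0 Y, (s - I * v : ℂ) ∈ HS r := fun v hv => by
      refine ⟨by simp; linarith, ?_⟩
      simp [abs_of_nonneg hv.1]; linarith [hv.2]
    have hline : ∀ v : ℝ, HasDerivAt (fun v : ℝ => (s - I * v : ℂ)) (-I) v := fun v => by
      simpa using ((hasDerivAt_id v).ofReal_comp.const_mul I).const_sub (s : ℂ)
    have hexp : ∀ v : ℝ, HasDerivAt (fun v : ℝ => exp (κ * (s - I * v : ℂ)))
        (exp (κ * (s - I * v)) * (κ * -I)) v := fun v => ((hline v).const_mul κ).cexp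
    have hz : ∀ v ∈ Icc 0 Y, HasDerivAt (fun v : ℝ => exp (κ * (s - I * v)) * U (s - I * v) - A)
        (exp (κ * (s - I * v)) * (κ * -I) * U (s - I * v) + exp (κ * (s - I * v)) *
          (a (s - I * v) * V (s - I * v) * -I)) v := fun v hv =>
      ((hexp v).mul ((hU _ (hx v hv)).comp v (hline v))).sub_const _
    have hw : ∀ v ∈ Icc 0 Y, HasDerivAt (fun v : ℝ => exp (κ * (s - I * v)) * V (s - I * v) - B)
        (exp (κ * (s - I * v)) * (κ * -I) * V (s - I * v) + exp (κ * (s - I * v)) *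
          (b (s - I * v) * U (s - I * v) * -I)) v := fun v hv =>
      ((hexp v).mul ((hV _ (hx v hv)).comp v (hline v))).sub_const _
    have hb1 : ∀ {k l z w A B : ℂ} {ε : ℝ}, ‖k‖ = ‖κ‖ → ‖l‖ ≤ M → ‖k * A + l * B‖ ≤ ε →
        ‖-I * (k * z + l * w)‖ ≤ K * max ‖z - A‖ ‖w - B‖ + ε := by
      intro k l z w A B ε hk hl he
      rw [norm_mul, norm_neg, norm_I, one_mul]
      calc ‖k * z + l * w‖ = ‖k * (z - A) + l * (w - B) + (k * A + l * B)‖ := by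
            congr 1; ring
        _ ≤ ‖k‖ * ‖z - A‖ + ‖l‖ * ‖w - B‖ + ε := by
            refine (norm_add_le _ _).trans (add_le_add ((norm_add_le _ _).trans ?_) he)
            rw [norm_mul, norm_mul]
        _ ≤ ‖κ‖ * max ‖z - A‖ ‖w - B‖ + M * max ‖z - A‖ ‖w - B‖ + ε := by
            rw [hk]
            gcongr
            · exact le_max_left _ _
            · exact le_max_right _ _
        _ = _ := by rw [hK]; ring
    have hys : y s ∈ Icc 0 Y := ⟨hy0 s hs0, hyY s hs0⟩
    have := pair_gronwall (K := K) (ε := ε) (d := ε) hz hw (fun v hv => ?_) (fun v hv => ?_)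
      (by simpa using hR₃ s hs3) (by simpa using hR₄ s hs4) hys
    · rw [gronwallBound_self] at this
      have h3 := mul_le_mul_of_nonneg_left (hmono _ hys) hε.le
      exact ⟨this.1.trans h3, this.2.trans h3⟩
    · refine le_trans (le_of_eq ?_) (hb1 rfl (ha _ (hx v hv))
        (hR₁ _ (hx v hv) (by simpa using hs1)))
      congr 1; ring
    · rw [max_comm]
      refine le_trans (le_of_eq ?_) (hb1 rfl (hb _ (hx v hv))
        (hR₂ _ (hx v hv) (by simpa using hs2)))
      congr 1; ring
  constructor <;> refine Metric.tendsto_atTop.2 fun ε hε => ?_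
  all_goals
    obtain ⟨S, hS⟩ := key (ε / (2 * N)) (by positivity)
    refine ⟨S, fun s hs => ?_⟩
    have e : ε / (2 * N) * N = ε / 2 := by field_simp
    rw [dist_eq_norm]
  · linarith [(hS s hs).1]
  · linarith [(hS s hs).2]

end

section

/-- The complex phase accumulated between the origin and infinity. -/
noncomputable def phaseC (t p : ℝ) (g b : ℂ → ℂ) : ℂ :=
  ((-(p * t) + ∫ x in Ioi t, (Real.sqrt (momSq t g b x) - p) : ℝ) : ℂ)
    - I * (∫ x in (0 : ℝ)..t, Real.sqrt (-momSq t g b x) : ℝ)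

namespace TPData

variable {r δ t c C α β : ℝ} {g b : ℂ → ℂ}

theorem momSq_continuousOn (D : TPData r δ t c C α β g b) :
    ContinuousOn (momSq t g b) (Ici 0) := by
  have h : ∀ f : ℂ → ℂ, DifferentiableOn ℂ f (HS r) →
      ContinuousOn (fun x : ℝ => (f x).re) (Ici 0) := fun f hf =>
    continuous_re.comp_continuousOn (hf.continuousOn.comp continuous_ofReal.continuousOn
      fun x hx => ofReal_mem_HS D.r_pos hx)
  refine ContinuousOn.mul (ContinuousOn.mul (ContinuousOn.div (by fun_prop) (by fun_prop) ?_)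
    (h g D.g_diff)) (h b D.b_diff)
  intro x hx
  have : (0 : ℝ) ≤ x := hx
  positivity

theorem g_pos (D : TPData r δ t c C α β g b) {x : ℝ} (hx : 0 ≤ x) : 0 < (g x).re :=
  D.c_pos.trans_le (D.g_re _ (ofReal_mem_HS D.r_pos hx))

theorem b_pos (D : TPData r δ t c C α β g b) {x : ℝ} (hx : 0 ≤ x) : 0 < (b x).re :=
  D.c_pos.trans_le (D.b_re _ (ofReal_mem_HS D.r_pos hx))

theorem momSq_nonneg (D : TPData r δ t c C α β g b) {x : ℝ} (hx : t ≤ x) :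
    0 ≤ momSq t g b x := by
  have h0 : 0 ≤ x := D.t_pos.le.trans hx
  have := D.g_pos h0
  have := D.b_pos h0
  have : 0 ≤ (x - t) / (x + 1) := div_nonneg (by linarith) (by linarith)
  rw [momSq]; positivity

theorem momSq_nonpos (D : TPData r δ t c C α β g b) {x : ℝ} (hx : 0 ≤ x) (hxt : x ≤ t) :
    momSq t g b x ≤ 0 := by
  have h1 := D.g_pos hx
  have h2 := D.b_pos hx
  have h3 : (x - t) / (x + 1) ≤ 0 := div_nonpos_of_nonpos_of_nonneg (by linarith) (by linarith)
  rw [momSq]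
  exact mul_nonpos_of_nonpos_of_nonneg (mul_nonpos_of_nonpos_of_nonneg h3 h1.le) h2.le

theorem abs_sqrt_momSq_sub_le (D : TPData r δ t c C α β g b) {x : ℝ} (hx : t ≤ x) :
    |Real.sqrt (momSq t g b x) - Real.sqrt (α * β)| ≤
      (C * C + α * C) / Real.sqrt (α * β) * (x + 2) ^ (-δ) := by
  have h0 : 0 ≤ x := D.t_pos.le.trans hx
  have hα := D.α_pos
  have hβ := D.β_pos
  have hp : 0 < Real.sqrt (α * β) := Real.sqrt_pos.2 (by positivity)
  have hm := D.momSq_nonneg hx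
  have hxm := ofReal_mem_HS D.r_pos h0
  have e0 : ((x : ℂ) - t) / (x + 1) * g x = (((x - t) / (x + 1) * (g x).re : ℝ) : ℂ) := by
    rw [D.g_ofReal h0]; push_cast; simp
  have h1 := D.g_lim x hxm
  have h2 := D.b_lim x hxm
  rw [e0, ← ofReal_sub, norm_real, Real.norm_eq_abs, ofReal_re] at h1
  rw [D.b_ofReal h0, ← ofReal_sub, norm_real, Real.norm_eq_abs, ofReal_re] at h2
  have h3 : |(b x).re| ≤ C := (abs_re_le_norm _).trans (D.b_le _ hxm)
  have h4 : |momSq t g b x - α * β| ≤ (C * C + α * C) * (x + 2) ^ (-δ) := by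
    have : momSq t g b x - α * β = ((x - t) / (x + 1) * (g x).re - α) * (b x).re
        + α * ((b x).re - β) := by rw [momSq]; ring
    rw [this]
    refine (abs_add_le _ _).trans ?_
    rw [abs_mul, abs_mul, abs_of_pos hα]
    have h5 : 0 ≤ (x + 2) ^ (-δ) := by positivity
    have hC := D.C_pos
    calc _ ≤ C * (x + 2) ^ (-δ) * C + α * (C * (x + 2) ^ (-δ)) := by gcongr
      _ = _ := by ring
  have h6 : Real.sqrt (momSq t g b x) - Real.sqrt (α * β)
      = (momSq t g b x - α * β) / (Real.sqrt (momSq t g b x) + Real.sqrt (α * β)) := by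
    rw [eq_div_iff (by positivity)]
    have e1 := Real.sq_sqrt hm
    have e2 := Real.sq_sqrt (by positivity : 0 ≤ α * β)
    linear_combination e1 - e2
  rw [h6, abs_div, abs_of_pos (by positivity : 0 < Real.sqrt (momSq t g b x) + Real.sqrt (α * β)),
    div_mul_eq_mul_div]
  have := Real.sqrt_nonneg (momSq t g b x)
  exact div_le_div₀ ((abs_nonneg _).trans h4) h4 hp (by linarith)

theorem integrableOn_sqrt_momSq_sub (D : TPData r δ t c C α β g b) :
    IntegrableOn (fun x => Real.sqrt (momSq t g b x) - Real.sqrt (α * β)) (Ioi t) := by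
  refine Integrable.mono' ((integrableOn_add_rpow_Ioi_of_lt (m := 2) (a := -δ) (c := t)
    (by linarith [D.δ_gt]) (by linarith [D.t_pos])).const_mul
      ((C * C + α * C) / Real.sqrt (α * β))) ?_ ?_
  · refine ContinuousOn.aestronglyMeasurable ?_ measurableSet_Ioi
    refine ContinuousOn.sub (Real.continuous_sqrt.comp_continuousOn ?_) continuousOn_const
    exact D.momSq_continuousOn.mono fun x hx => (D.t_pos.trans hx).le
  · refine (ae_restrict_iff' measurableSet_Ioi).2 (ae_of_all _ fun x hx => ?_)
    exact D.abs_sqrt_momSq_sub_le (le_of_lt hx)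

theorem integral_mom (D : TPData r δ t c C α β g b) {P : ℂ → ℂ}
    (hP : ∀ x ∈ slitHS r t, HasDerivAt P (mom t g b x) x) {X : ℝ} (hX : t < X) :
    P X - P 0 = (∫ x in t..X, Real.sqrt (momSq t g b x) : ℝ)
      - I * (∫ x in (0 : ℝ)..t, Real.sqrt (-momSq t g b x) : ℝ) := by
  have ht := D.t_pos
  have hr := D.r_pos
  set M := Real.sqrt ((3 + 2 * t) * C * C) with hM
  have hM0 : 0 ≤ M := Real.sqrt_nonneg _
  set F : ℝ → ℂ := fun x => Real.sqrt (momSq t g b x) - I * Real.sqrt (-momSq t g b x) with hF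
  have hFc : ContinuousOn F (Ici 0) := by
    have h1 := continuous_ofReal.comp_continuousOn
      (Real.continuous_sqrt.comp_continuousOn D.momSq_continuousOn)
    have h2 := continuous_ofReal.comp_continuousOn
      (Real.continuous_sqrt.comp_continuousOn D.momSq_continuousOn.neg)
    exact h1.sub (continuousOn_const.mul h2)
  have hFi : ∀ a b : ℝ, 0 ≤ a → 0 ≤ b → IntervalIntegrable F volume a b := fun a b ha hb =>
    (hFc.mono fun x hx => (le_min ha hb).trans hx.1).intervalIntegrable
  have hreal : ∀ x : ℝ, 0 ≤ x → x ≠ t → (x : ℂ) ∈ slitHS r t := fun x hx hxt =>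
    mem_slitHS_lower (ofReal_mem_HS hr hx) (Or.inr (by simpa using hxt))
  have hFM : ∀ x : ℝ, 0 ≤ x → ‖F x‖ ≤ M := fun x hx => by
    by_cases hxt : x = t
    · simp only [hF, hxt, momSq]; simpa using hM0
    · have e : F x = mom t g b x := (D.mom_real hx hxt).symm
      rw [e]
      exact D.mom_le (ofReal_mem_HS hr hx) (sub_ne_of_mem_slitHS (hreal x hx hxt))
  have hftc : ∀ a b : ℝ, 0 ≤ a → a ≤ b → (b < t ∨ t < a) → ∫ x in a..b, F x = P b - P a := by
    intro a b ha hab h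
    refine intervalIntegral.integral_eq_sub_of_hasDerivAt (f := fun x : ℝ => P x) (fun x hx => ?_)
      (hFi a b ha (ha.trans hab))
    rw [uIcc_of_le hab] at hx
    have hxt : x ≠ t := by rcases h with h | h; exacts [(hx.2.trans_lt h).ne, (h.trans_le hx.1).ne']
    have := (hP x (hreal x (ha.trans hx.1) hxt)).comp_ofReal
    rwa [D.mom_real (ha.trans hx.1) hxt] at this
  have hseg : ∀ ε : ℝ, 0 < ε → ε < r → ∀ x : ℝ, 0 ≤ x → x ≠ t → |x - t| ≤ ε →
      ‖P x - P (t - I * ε)‖ ≤ M * (2 * ε) := by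
    intro ε hε hεr x hx hxt hxe
    have hz : (t - I * ε : ℂ) ∈ HS r := ⟨by simp; linarith, by simpa [abs_of_pos hε] using hεr⟩
    have hsub : segment ℝ (t - I * ε : ℂ) x ⊆ slitHS r t := by
      intro w hw
      have hwr := (convex_HS r).segment_subset hz (ofReal_mem_HS hr hx) hw
      obtain ⟨a, b, ha, hb, hab, rfl⟩ := hw
      refine mem_slitHS_lower hwr ?_
      rcases ha.eq_or_lt with h | h
      · right
        have : b = 1 := by linarith
        subst this; subst h
        simpa using hxt
      · left
        simp; positivity
    have := (convex_segment (t - I * ε : ℂ) x).norm_image_sub_le_of_norm_hasDerivWithin_le (C := M)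
      (fun w hw => (hP w (hsub hw)).hasDerivWithinAt)
      (fun w hw => D.mom_le (hsub hw).1 (sub_ne_of_mem_slitHS (hsub hw)))
      (left_mem_segment ℝ _ _) (right_mem_segment ℝ _ _)
    refine this.trans (mul_le_mul_of_nonneg_left ?_ hM0)
    have e : (x : ℂ) - (t - I * ε) = ((x - t : ℝ) : ℂ) + I * ε := by push_cast; ring
    rw [e]
    refine (norm_add_le _ _).trans ?_
    rw [norm_mul, norm_I, norm_real, norm_real, Real.norm_eq_abs, Real.norm_of_nonneg hε.le]
    linarith
  have hmain : ∫ x in (0 : ℝ)..X, F x = P X - P 0 := by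
    have hb : ∀ᶠ ε : ℝ in 𝓝[>] 0, ‖(∫ x in (0 : ℝ)..X, F x) - (P X - P 0)‖ ≤ 6 * M * ε := by
      have hm : 0 < min (min r t) (X - t) := lt_min (lt_min hr ht) (by linarith)
      filter_upwards [Ioo_mem_nhdsGT hm] with ε hε
      obtain ⟨h0, h1⟩ := hε
      rw [lt_min_iff, lt_min_iff] at h1
      obtain ⟨⟨h1, h2⟩, h3⟩ := h1
      have e1 := hftc 0 (t - ε) le_rfl (by linarith) (Or.inl (by linarith))
      have e2 := hftc (t + ε) X (by linarith) (by linarith) (Or.inr (by linarith))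
      have e3 := intervalIntegral.integral_add_adjacent_intervals
        (hFi 0 (t - ε) le_rfl (by linarith)) (hFi (t - ε) (t + ε) (by linarith) (by linarith))
      have e4 := intervalIntegral.integral_add_adjacent_intervals
        (hFi 0 (t + ε) le_rfl (by linarith)) (hFi (t + ε) X (by linarith) (by linarith))
      have i1 : ‖∫ x in (t - ε)..(t + ε), F x‖ ≤ M * |t + ε - (t - ε)| :=
        intervalIntegral.norm_integral_le_of_norm_le_const fun x hx => by
          rw [uIoc_of_le (by linarith)] at hx
          exact hFM x (by linarith [hx.1])
      have i2 := hseg ε h0 h1 (t - ε) (by linarith) (by linarith) (by simp [abs_of_pos h0])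
      have i3 := hseg ε h0 h1 (t + ε) (by linarith) (by linarith) (by simp [abs_of_pos h0])
      have e5 : (∫ x in (0 : ℝ)..X, F x) - (P X - P 0) = (∫ x in (t - ε)..(t + ε), F x)
          + (P (t - ε : ℝ) - P (t - I * ε)) - (P (t + ε : ℝ) - P (t - I * ε)) := by
        rw [← e4, ← e3, e1, e2]; simp; ring
      rw [e5]
      refine (norm_sub_le _ _).trans ((add_le_add (norm_add_le _ _) le_rfl).trans ?_)
      rw [show t + ε - (t - ε) = 2 * ε by ring, abs_of_pos (by linarith)] at i1
      linarith
    have hl : Tendsto (fun ε : ℝ => 6 * M * ε) (𝓝[>] 0) (𝓝 (6 * M * 0)) :=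
      (tendsto_id.mono_left nhdsWithin_le_nhds).const_mul _
    have := ge_of_tendsto hl hb
    rw [mul_zero, norm_le_zero_iff, sub_eq_zero] at this
    exact this
  rw [← hmain, ← intervalIntegral.integral_add_adjacent_intervals (hFi 0 t le_rfl ht.le)
    (hFi t X ht.le (by linarith))]
  have e1 : ∫ x in (0 : ℝ)..t, F x = ∫ x in (0 : ℝ)..t, -I * ((Real.sqrt (-momSq t g b x) : ℝ) : ℂ) := by
    refine intervalIntegral.integral_congr fun x hx => ?_
    rw [uIcc_of_le ht.le] at hx
    simp [hF, Real.sqrt_eq_zero_of_nonpos (D.momSq_nonpos hx.1 hx.2)]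
  have e2 : ∫ x in t..X, F x = ∫ x in t..X, ((Real.sqrt (momSq t g b x) : ℝ) : ℂ) := by
    refine intervalIntegral.integral_congr fun x hx => ?_
    rw [uIcc_of_le hX.le] at hx
    simp [hF, Real.sqrt_eq_zero_of_nonpos (neg_nonpos.2 (D.momSq_nonneg hx.1))]
  rw [e1, e2, intervalIntegral.integral_const_mul, intervalIntegral.integral_ofReal,
    intervalIntegral.integral_ofReal]
  ring

theorem exists_phase (D : TPData r δ t c C α β g b) : ∃ J : ℂ → ℂ,
    (∀ x ∈ slitHS r t, HasDerivAt J (-mom t g b x) x) ∧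
    J 0 = phaseC t (Real.sqrt (α * β)) g b ∧
    ∀ (y : ℝ → ℝ) (Y : ℝ), (∀ s : ℝ, 0 ≤ s → 0 ≤ y s) → (∀ s : ℝ, 0 ≤ s → y s ≤ Y) → Y < r →
      Tendsto (fun s : ℝ => J (s - I * y s) + Real.sqrt (α * β) * (s - I * y s)) atTop (𝓝 0) := by
  have ht := D.t_pos
  have hr := D.r_pos
  set p := Real.sqrt (α * β) with hp
  obtain ⟨P, hP⟩ : ∃ P : ℂ → ℂ, ∀ x ∈ slitHS r t, HasDerivAt P (mom t g b x) x :=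
    ⟨sprim (t - I * (r / 2)) (mom t g b), fun x hx => hasDerivAt_sprim (isOpen_slitHS r t)
      (starConvex_slitHS hr ht)
      (fun z hz => (D.differentiableAt_mom hz).differentiableWithinAt) hx⟩
  have hJ : ∀ x ∈ slitHS r t, HasDerivAt (fun x => phaseC t p g b - (P x - P 0))
      (-mom t g b x) x := fun x hx => ((hP x hx).sub_const _).const_sub _
  refine ⟨_, hJ, by simp, fun y Y hy0 hyY hYr => ?_⟩
  have hreal : Tendsto (fun s : ℝ => phaseC t p g b - (P s - P 0) + p * s) atTop (𝓝 0) := by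
    have hi := intervalIntegral_tendsto_integral_Ioi t D.integrableOn_sqrt_momSq_sub
      tendsto_id
    have h1 : Tendsto (fun s : ℝ => (((∫ x in Ioi t, (Real.sqrt (momSq t g b x) - p))
        - ∫ x in t..s, (Real.sqrt (momSq t g b x) - p) : ℝ) : ℂ)) atTop (𝓝 0) := by
      have := (hi.const_sub (∫ x in Ioi t, (Real.sqrt (momSq t g b x) - p)))
      rw [sub_self] at this
      exact_mod_cast (continuous_ofReal.tendsto 0).comp this
    refine h1.congr' ((eventually_gt_atTop t).mono fun s hs => ?_)
    beta_reduce
    rw [D.integral_mom hP hs, phaseC, intervalIntegral.integral_sub, intervalIntegral.integral_const]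
    · push_cast
      simp only [smul_eq_mul, ofReal_mul, ofReal_sub]
      ring
    · refine ContinuousOn.intervalIntegrable (Real.continuous_sqrt.comp_continuousOn
        (D.momSq_continuousOn.mono fun x hx => ?_))
      rw [uIcc_of_le hs.le] at hx
      exact ht.le.trans hx.1
    · exact intervalIntegrable_const
  rcases lt_or_ge Y 0 with hY | hY
  · linarith [hy0 0 le_rfl, hyY 0 le_rfl]
  have hdiff : Tendsto (fun s : ℝ => (phaseC t p g b - (P (s - I * y s) - P 0) + p * (s - I * y s))
      - (phaseC t p g b - (P s - P 0) + p * s)) atTop (𝓝 0) := by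
    refine Metric.tendsto_atTop.2 fun ε hε => ?_
    obtain ⟨R, hR⟩ := eventually_atInf.1 (D.tendsto_mom.eventually
      (p := fun z => z ∈ Metric.closedBall ((Real.sqrt (α * β) : ℝ) : ℂ) (ε / (Y + 1)))
      (Metric.closedBall_mem_nhds _ (by positivity)))
    refine ⟨max R (t + 1), fun s hs => ?_⟩
    rw [ge_iff_le, max_le_iff] at hs
    have hc : Convex ℝ (HS r ∩ {x : ℂ | s ≤ x.re}) :=
      (convex_HS r).inter (convex_halfSpace_re_ge s)
    have hs0 : 0 ≤ s := by linarith
    have hy := hy0 s hs0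
    have hyY' := hyY s hs0
    have m1 : (s : ℂ) ∈ HS r ∩ {x : ℂ | s ≤ x.re} := ⟨ofReal_mem_HS hr hs0, by simp⟩
    have m2 : (s - I * y s : ℂ) ∈ HS r ∩ {x : ℂ | s ≤ x.re} :=
      ⟨⟨by simp; linarith, by simp [abs_of_nonneg hy]; linarith⟩, by simp⟩
    have := hc.norm_image_sub_le_of_norm_hasDerivWithin_le (C := ε / (Y + 1))
      (f := fun x : ℂ => phaseC t p g b - (P x - P 0) + p * x) (f' := fun x => -mom t g b x + p)
      (fun x hx => (((hJ x (mem_slitHS_lower hx.1 (Or.inr (by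
        have : s ≤ x.re := hx.2
        linarith)))).add (((hasDerivAt_id x).const_mul (p : ℂ)))).congr_deriv
          (by simp)).hasDerivWithinAt)
      (fun x hx => by
        have h := hR x hx.1 (hs.1.trans hx.2)
        rw [Metric.mem_closedBall, dist_comm, dist_eq_norm] at h
        rwa [neg_add_eq_sub]) m1 m2
    rw [dist_eq_norm, sub_zero]
    refine this.trans_lt ?_
    rw [sub_sub_cancel_left, norm_neg, norm_mul, norm_I, one_mul, norm_real,
      Real.norm_of_nonneg hy, div_mul_eq_mul_div, div_lt_iff₀ (by positivity)]
    nlinarith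
  have := hdiff.add hreal
  rw [add_zero] at this
  exact this.congr fun s => by ring

end TPData
end

section

/-- Recessive families at the right of a turning point. -/
structure JostFamily (t α β : ℝ) (g b : ℂ → ℂ) (u v : ℝ → ℝ → ℂ) : Prop where
  deriv_u : ∀ h : ℝ, 0 < h → ∀ s : ℝ, 0 ≤ s →
    HasDerivAt (u h) (-(I / h * ((s - t) / (s + 1) * g s)) * v h s) s
  deriv_v : ∀ h : ℝ, 0 < h → ∀ s : ℝ, 0 ≤ s → HasDerivAt (v h) (-(I / h * b s) * u h s) s
  lim_u : ∀ h : ℝ, 0 < h → Tendsto (fun s : ℝ => exp (I / h * Real.sqrt (α * β) * s) * u h s) atTop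
    (𝓝 (((α / β) ^ ((1 : ℝ) / 4) : ℝ) : ℂ))
  lim_v : ∀ h : ℝ, 0 < h → Tendsto (fun s : ℝ => exp (I / h * Real.sqrt (α * β) * s) * v h s) atTop
    (𝓝 (((α / β) ^ ((1 : ℝ) / 4) : ℝ) : ℂ)⁻¹)

namespace TPData

variable {r δ t c C α β : ℝ} {g b : ℂ → ℂ}

theorem gevrey_connection (D : TPData r δ t c C α β g b) :
    ∃ (C' : ℝ) (a₀ b₀ : ℕ → ℂ), 1 ≤ C' ∧ a₀ 0 = 1 ∧ b₀ 0 = 0 ∧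
    ∀ u v : ℝ → ℝ → ℂ, JostFamily t α β g b u v →
      ∃ Fe Fo : ℝ → ℂ, Gevrey 1 C' Fe a₀ ∧ Gevrey 1 C' Fo b₀ ∧ ∀ h : ℝ, 0 < h →
        u h 0 = exp (I / h * phaseC t (Real.sqrt (α * β)) g b) * (Fe h + Fo h) * amp t g b 0 ∧
        v h 0 = exp (I / h * phaseC t (Real.sqrt (α * β)) g b) * (Fe h - Fo h)
          * (amp t g b 0)⁻¹ := by
  have hr := D.r_pos
  have ht := D.t_pos
  have hα := D.α_pos
  have hβ := D.β_pos
  obtain ⟨r₁, d, Y, γ, γ', y, y', p⟩ := exists_detourPath hr D.r_le D.δ_gt ht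
    (div_pos D.C_pos D.c_pos)
  obtain ⟨c₀, C₀, G, H⟩ := D.coreData p
  obtain ⟨C', a₀, b₀, hC', ha₀, hb₀, hg⟩ := H.gevrey
  obtain ⟨J, hJ, hJ0, hJl⟩ := D.exists_phase
  set P := Real.sqrt (α * β) with hP
  set A := (α / β) ^ ((1 : ℝ) / 4) with hA
  have hA0 : 0 < A := Real.rpow_pos_of_pos (by positivity) _
  have hAc : (A : ℂ) ≠ 0 := by exact_mod_cast hA0.ne'
  have hA2 : A ^ 2 = Real.sqrt (α / β) := by
    rw [hA, ← Real.rpow_natCast, ← Real.rpow_mul (by positivity), Real.sqrt_eq_rpow]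
    norm_num
  have hPA : P * A ^ 2 = α := by
    rw [hA2, hP, ← Real.sqrt_mul (by positivity), show α * β * (α / β) = α * α by field_simp,
      Real.sqrt_mul_self hα.le]
  have hPA' : P = β * A ^ 2 := by
    have h1 : P * P = α * β := Real.mul_self_sqrt (by positivity)
    have hP0 : 0 < P := Real.sqrt_pos.2 (by positivity)
    refine mul_left_cancel₀ hP0.ne' ?_
    rw [h1, ← hPA]; ring
  refine ⟨C', a₀, b₀, hC', ha₀, hb₀, fun u v F => ?_⟩
  have hex : ∀ h : ℝ, 0 < h → ∃ U V : ℂ → ℂ, U 0 = u h 0 ∧ V 0 = v h 0 ∧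
      (∀ x ∈ HS r, HasDerivAt U (-(I / h * ((x - t) / (x + 1) * g x)) * V x) x) ∧
      (∀ x ∈ HS r, HasDerivAt V (-(I / h * b x) * U x) x) ∧
      Tendsto (fun s : ℝ => exp (I / h * P * γ s) * U (γ s)) atTop (𝓝 A) ∧
      Tendsto (fun s : ℝ => exp (I / h * P * γ s) * V (γ s)) atTop (𝓝 (A : ℂ)⁻¹) := by
    intro h hh
    have hτd : DifferentiableOn ℂ (fun x : ℂ => (x - t) / (x + 1)) (HS r) :=
      DifferentiableOn.div (by fun_prop) (by fun_prop) fun x hx =>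
        slitPlane_ne_zero (add_one_mem_slit D.r_le_one hx)
    set M := 1 / h * ((3 + 2 * t) * C + C) with hM
    have hC := D.C_pos
    have hI : ‖I / (h : ℂ)‖ = 1 / h := by simp [abs_of_pos hh]
    have haM : ∀ x ∈ HS r, ‖-(I / h * ((x - t) / (x + 1) * g x))‖ ≤ M := fun x hx => by
      rw [norm_neg, norm_mul, norm_mul, hI, hM]
      have := norm_tau_le ht D.r_le hx
      have := D.g_le x hx
      calc _ ≤ 1 / h * ((3 + 2 * t) * C) := by gcongr
        _ ≤ _ := by gcongr; linarith
    have hbM : ∀ x ∈ HS r, ‖-(I / h * b x)‖ ≤ M := fun x hx => by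
      rw [norm_neg, norm_mul, hI, hM]
      have := D.b_le x hx
      have h0 : 0 ≤ (3 + 2 * t) * C := by positivity
      gcongr; linarith
    obtain ⟨U, V, hU0, hV0, hU, hV⟩ := exists_holomorphic_solution (isOpen_HS r) (convex_HS r)
      (by simpa using ofReal_mem_HS hr le_rfl)
      ((hτd.mul D.g_diff).const_mul (I / h)).neg (D.b_diff.const_mul (I / h)).neg haM hbM
      (u h 0) (v h 0)
    have heq : ∀ s : ℝ, 0 ≤ s → U s = u h s ∧ V s = v h s := fun s hs =>
      solution_unique (u := fun s : ℝ => U s) (v := fun s : ℝ => V s)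
        (fun s hs => haM s (ofReal_mem_HS hr hs)) (fun s hs => hbM s (ofReal_mem_HS hr hs))
        (fun s hs => (hU s (ofReal_mem_HS hr hs)).comp_ofReal)
        (fun s hs => (hV s (ofReal_mem_HS hr hs)).comp_ofReal)
        (F.deriv_u h hh) (F.deriv_v h hh) (by simpa using hU0) (by simpa using hV0) hs
    have l1 : Tendsto (fun x : ℂ => I / h * P * A + -(I / h * ((x - t) / (x + 1) * g x)) * (A : ℂ)⁻¹)
        (atInf r) (𝓝 0) := by
      have := ((((tendsto_of_norm_sub_le (by linarith [D.δ_gt]) D.g_lim).const_mul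
        (I / (h : ℂ))).neg).mul_const (A : ℂ)⁻¹).const_add (I / h * P * A)
      convert this using 2
      rw [← hPA]; push_cast; field_simp; ring
    have l2 : Tendsto (fun x : ℂ => I / h * P * (A : ℂ)⁻¹ + -(I / h * b x) * A)
        (atInf r) (𝓝 0) := by
      have := ((((tendsto_of_norm_sub_le (by linarith [D.δ_gt]) D.b_lim).const_mul
        (I / (h : ℂ))).neg).mul_const (A : ℂ)).const_add (I / h * P * (A : ℂ)⁻¹)
      convert this using 2
      rw [hPA']; push_cast; field_simp; ring
    have := tendsto_vertical hr hU hV haM hbM l1 l2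
      ((F.lim_u h hh).congr' ((eventually_ge_atTop 0).mono fun s hs => by
        beta_reduce; rw [(heq s hs).1]))
      ((F.lim_v h hh).congr' ((eventually_ge_atTop 0).mono fun s hs => by
        beta_reduce; rw [(heq s hs).2])) p.y_nonneg p.y_le p.Y_lt
    refine ⟨U, V, hU0, hV0, hU, hV, this.1.congr' ?_, this.2.congr' ?_⟩ <;>
    exact (eventually_ge_atTop 0).mono fun s hs => by beta_reduce; rw [p.eq s hs]
  choose! U V hU0 hV0 hU hV hUl hVl using hex
  set we : ℝ → ℝ → ℂ := fun h s => ((amp t g b (γ s))⁻¹ * U h (γ s) + amp t g b (γ s) * V h (γ s))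
    / 2 * exp (-(I / h * J (γ s))) with hwe
  set wo : ℝ → ℝ → ℂ := fun h s => ((amp t g b (γ s))⁻¹ * U h (γ s) - amp t g b (γ s) * V h (γ s))
    / 2 * exp (-(I / h * J (γ s))) with hwo
  have hAmp : ∀ s : ℝ, 0 ≤ s → HasDerivAt (fun s : ℝ => amp t g b (γ s))
      (coup t g b (γ s) * amp t g b (γ s) * γ' s) s := fun s hs =>
    have hs' := ofReal_mem_HS p.r₁_pos hs
    ((D.hasDerivAt_amp (p.mem s hs')).comp _ (p.deriv s hs')).comp_ofReal
  have hE : ∀ h : ℝ, ∀ s : ℝ, 0 ≤ s → HasDerivAt (fun s : ℝ => exp (-(I / h * J (γ s))))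
      (exp (-(I / h * J (γ s))) * (I / h * mom t g b (γ s) * γ' s)) s := fun h s hs =>
    have hs' := ofReal_mem_HS p.r₁_pos hs
    ((((hJ _ (p.mem s hs')).comp _ (p.deriv s hs')).comp_ofReal.const_mul (I / (h : ℂ))).neg.cexp
      ).congr_deriv (by simp only [Pi.neg_apply, Function.comp_apply]; ring)
  have hUd : ∀ h : ℝ, 0 < h → ∀ s : ℝ, 0 ≤ s → HasDerivAt (fun s : ℝ => U h (γ s))
      (-(I / h * (mom t g b (γ s) * amp t g b (γ s) ^ 2)) * V h (γ s) * γ' s) s :=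
    fun h hh s hs => by
    have hs' := ofReal_mem_HS p.r₁_pos hs
    have hm := p.mem s hs'
    rw [D.mom_mul_amp_sq hm.1 (sub_ne_of_mem_slitHS hm)]
    exact ((hU h hh _ hm.1).comp _ (p.deriv s hs')).comp_ofReal
  have hVd : ∀ h : ℝ, 0 < h → ∀ s : ℝ, 0 ≤ s → HasDerivAt (fun s : ℝ => V h (γ s))
      (-(I / h * (mom t g b (γ s) / amp t g b (γ s) ^ 2)) * U h (γ s) * γ' s) s :=
    fun h hh s hs => by
    have hs' := ofReal_mem_HS p.r₁_pos hs
    have hm := p.mem s hs'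
    rw [← D.b_mul_amp_sq hm.1, mul_div_cancel_right₀ _ (pow_ne_zero 2 (amp_ne t g b _))]
    exact ((hV h hh _ hm.1).comp _ (p.deriv s hs')).comp_ofReal
  have hlim : ∀ h : ℝ, 0 < h →
      Tendsto (fun s : ℝ => (amp t g b (γ s))⁻¹ * U h (γ s) * exp (-(I / h * J (γ s)))) atTop
        (𝓝 1) ∧
      Tendsto (fun s : ℝ => amp t g b (γ s) * V h (γ s) * exp (-(I / h * J (γ s)))) atTop
        (𝓝 1) := by
    intro h hh
    have hγl : Tendsto (fun s : ℝ => γ s) atTop (atInf r) := by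
      refine tendsto_inf.2 ⟨tendsto_comap_iff.2 ?_, tendsto_principal.2 ?_⟩
      · refine tendsto_atTop_mono' _ ((eventually_ge_atTop 0).mono fun s hs => ?_)
          (tendsto_atTop_add_const_right _ (-(1 / 2 : ℝ)) tendsto_id)
        have := p.re_ge s (ofReal_mem_HS p.r₁_pos hs)
        simpa [sub_eq_add_neg] using this
      · exact (eventually_ge_atTop 0).mono fun s hs => (p.mem s (ofReal_mem_HS p.r₁_pos hs)).1
    have hal := D.tendsto_amp.comp hγl
    have hjl : Tendsto (fun s : ℝ => exp (-(I / h * (J (γ s) + P * γ s)))) atTop (𝓝 1) := by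
      have h0 := ((hJl y Y p.y_nonneg p.y_le p.Y_lt).const_mul (I / (h : ℂ))).neg.cexp
      rw [mul_zero, neg_zero, exp_zero] at h0
      exact h0.congr' ((eventually_ge_atTop 0).mono fun s hs => by beta_reduce; rw [p.eq s hs])
    have e : ∀ s : ℝ, exp (-(I / h * J (γ s)))
        = exp (I / h * P * γ s) * exp (-(I / h * (J (γ s) + P * γ s))) := fun s => by
      rw [← exp_add]; congr 1; ring
    constructor
    · have := ((hal.inv₀ hAc).mul (hUl h hh)).mul hjl
      rw [inv_mul_cancel₀ hAc, one_mul] at this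
      refine this.congr fun s => ?_
      rw [e]; simp only [Function.comp_apply]; ring
    · have := (hal.mul (hVl h hh)).mul hjl
      rw [mul_inv_cancel₀ hAc, one_mul] at this
      refine this.congr fun s => ?_
      rw [e]; simp only [Function.comp_apply]; ring
  have hres := hg we wo ?_ ?_ ?_ ?_
  · refine ⟨fun h => we h 0, fun h => wo h 0, hres.1, hres.2, fun h hh => ?_⟩
    have hA := amp_ne t g b 0
    have e1 : exp (I / h * phaseC t P g b) * exp (-(I / h * phaseC t P g b)) = 1 := by
      rw [← exp_add, add_neg_cancel, exp_zero]
    simp only [hwe, hwo, ofReal_zero, p.zero, hJ0, hU0 h hh, hV0 h hh]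
    generalize exp (I / h * phaseC t P g b) = E₁ at e1 ⊢
    generalize exp (-(I / h * phaseC t P g b)) = E₂ at e1 ⊢
    constructor
    · field_simp
      linear_combination (-2 * u h 0) * e1
    · field_simp
      linear_combination (-2 * v h 0 * amp t g b 0 ^ 2) * e1
  · intro h hh s hs
    have hA := amp_ne t g b (γ s)
    refine ((((((hAmp s hs).inv hA).mul (hUd h hh s hs)).add
      ((hAmp s hs).mul (hVd h hh s hs))).div_const 2).mul (hE h s hs)).congr_deriv ?_
    simp only [hwo, Pi.add_apply, Pi.mul_apply, Pi.inv_apply]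
    field_simp; ring
  · intro h hh s hs
    have hA := amp_ne t g b (γ s)
    refine ((((((hAmp s hs).inv hA).mul (hUd h hh s hs)).sub
      ((hAmp s hs).mul (hVd h hh s hs))).div_const 2).mul (hE h s hs)).congr_deriv ?_
    simp only [hwe, hwo, Pi.sub_apply, Pi.mul_apply, Pi.inv_apply]
    field_simp; ring
  · intro h hh
    have := ((hlim h hh).1.add (hlim h hh).2).div_const 2
    rw [show ((1 : ℂ) + 1) / 2 = 1 by norm_num] at this
    exact this.congr fun s => by simp only [hwe]; ring
  · intro h hh
    have := ((hlim h hh).1.sub (hlim h hh).2).div_const 2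
    rw [sub_self, zero_div] at this
    exact this.congr fun s => by simp only [hwo]; ring

end TPData
end

section

/-- A bound near infinity on a half strip extends to all of a smaller one. -/
theorem exists_decay_bound {R σ δ K X : ℝ} {f : ℂ → ℂ} (hR : R ≤ 1 / 2)
    (hσ : σ < R) (hf : ContinuousOn f (HS R))
    (hX : ∀ x ∈ HS σ, X ≤ x.re → ‖f x‖ ≤ K * (x.re + 2) ^ (-δ)) :
    ∃ K', 0 ≤ K' ∧ ∀ x ∈ HS σ, ‖f x‖ ≤ K' * (x.re + 2) ^ (-δ) := by
  by_cases h0 : 0 < R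
  swap
  · exact ⟨0, le_rfl, fun x hx => absurd (pos_of_mem_HS hx) (by linarith)⟩
  have hsub : Icc (-σ) X ×ℂ Icc (-σ) σ ⊆ HS R := fun x hx => by
    rw [mem_reProdIm] at hx
    exact ⟨by linarith [hx.1.1], abs_lt.2 ⟨by linarith [hx.2.1], by linarith [hx.2.2]⟩⟩
  have hcont : ContinuousOn (fun x : ℂ => ‖f x‖ * (x.re + 2) ^ δ) (Icc (-σ) X ×ℂ Icc (-σ) σ) := by
    refine (hf.mono hsub).norm.mul (ContinuousOn.rpow_const (by fun_prop) fun x hx => Or.inl ?_)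
    have := (hsub hx).1
    linarith
  obtain ⟨M, hM⟩ := (isCompact_Icc.reProdIm isCompact_Icc).exists_bound_of_continuousOn hcont
  refine ⟨max |K| M, (abs_nonneg K).trans (le_max_left _ _), fun x hx => ?_⟩
  have hpos : 0 < x.re + 2 := by linarith [hx.1, pos_of_mem_HS hx]
  have hp := Real.rpow_pos_of_pos hpos (-δ)
  rcases le_total X x.re with h | h
  · refine (hX x hx h).trans ?_
    gcongr
    exact (le_abs_self K).trans (le_max_left _ _)
  · have h1 := (le_abs_self _).trans
      (hM x (mem_reProdIm.2 ⟨⟨hx.1.le, h⟩, (abs_lt.1 hx.2).1.le, (abs_lt.1 hx.2).2.le⟩))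
    have h2 : ‖f x‖ = ‖f x‖ * (x.re + 2) ^ δ * (x.re + 2) ^ (-δ) := by
      rw [mul_assoc, ← Real.rpow_add hpos, add_neg_cancel, Real.rpow_zero, mul_one]
    rw [h2]
    gcongr
    exact h1.trans (le_max_right _ _)

/-- Positivity on the half line extends to a half strip. -/
theorem exists_re_lower_bound {R X c₀ : ℝ} {f : ℂ → ℂ} (h0 : 0 < R)
    (hf : ContinuousOn f (HS R)) (hc₀ : 0 < c₀) (hX : ∀ x ∈ HS R, X ≤ x.re → c₀ ≤ (f x).re)
    (hpos : ∀ x : ℝ, 0 ≤ x → 0 < (f x).re) :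
    ∃ r c, 0 < r ∧ r ≤ R ∧ 0 < c ∧ ∀ x ∈ HS r, c ≤ (f x).re := by
  set K : Set ℂ := (fun x : ℝ => (x : ℂ)) '' Icc 0 |X| with hK
  have hKc : IsCompact K := isCompact_Icc.image continuous_ofReal
  have hU : IsOpen (HS R ∩ (fun x => (f x).re) ⁻¹' Ioi 0) :=
    (continuous_re.comp_continuousOn hf).isOpen_inter_preimage (isOpen_HS R) isOpen_Ioi
  have hKU : K ⊆ HS R ∩ (fun x => (f x).re) ⁻¹' Ioi 0 := by
    rintro _ ⟨x, hx, rfl⟩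
    exact ⟨ofReal_mem_HS h0 hx.1, hpos x hx.1⟩
  obtain ⟨d, hd, hdU⟩ := hKc.exists_cthickening_subset_open hU hKU
  have hcomp : IsCompact (Metric.cthickening d K) := hKc.cthickening
  have hne : (Metric.cthickening d K).Nonempty :=
    ⟨((0 : ℝ) : ℂ), Metric.self_subset_cthickening K ⟨0, ⟨le_rfl, abs_nonneg X⟩, rfl⟩⟩
  obtain ⟨z, hz, hzmin⟩ := hcomp.exists_isMinOn hne
    (continuous_re.comp_continuousOn (hf.mono (hdU.trans inter_subset_left)))
  refine ⟨min R (d / 2), min c₀ (f z).re, by positivity, min_le_left _ _,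
    lt_min hc₀ (hdU hz).2, fun x hx => ?_⟩
  have hxR := HS_mono (min_le_left _ _) hx
  rcases le_total X x.re with h | h
  · exact (min_le_left _ _).trans (hX x hxR h)
  · refine (min_le_right _ _).trans (hzmin (Metric.mem_cthickening_of_dist_le x
      ((max 0 x.re : ℝ) : ℂ) d K ⟨max 0 x.re, ⟨le_max_left _ _,
        max_le (abs_nonneg X) (h.trans (le_abs_self X))⟩, rfl⟩ ?_))
    have hx' := HS_mono (min_le_right _ _) hx
    rw [dist_eq_norm]
    refine (norm_le_abs_re_add_abs_im _).trans ?_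
    simp only [sub_re, ofReal_re, sub_im, ofReal_im, sub_zero]
    have h1 : |x.re - max 0 x.re| ≤ d / 2 := by
      have := hx'.1
      rcases max_cases 0 x.re with ⟨h2, h3⟩ | ⟨h2, h3⟩ <;> rw [h2]
      · rw [sub_zero, abs_of_nonpos h3]; linarith
      · simp; linarith
    linarith [hx'.2]

/-- The coefficients of a Dirac system on one side of an interior point. -/
structure SideData (R δ t K α β : ℝ) (a b : ℂ → ℂ) : Prop where
  R_pos : 0 < R
  R_le : R ≤ 1 / 2
  δ_gt : 1 < δ
  δ_le : δ ≤ 2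
  t_pos : 0 < t
  α_pos : 0 < α
  β_pos : 0 < β
  K_nonneg : 0 ≤ K
  a_diff : DifferentiableOn ℂ a (HS R)
  b_diff : DifferentiableOn ℂ b (HS R)
  a_real : ∀ x : ℝ, 0 ≤ x → (a x).im = 0
  b_real : ∀ x : ℝ, 0 ≤ x → (b x).im = 0
  a_lim : ∀ x ∈ HS R, ‖a x + α‖ ≤ K * (x.re + 2) ^ (-δ)
  b_lim : ∀ x ∈ HS R, ‖b x + β‖ ≤ K * (x.re + 2) ^ (-δ)
  a_zero : a t = 0
  a_simple : deriv a t ≠ 0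
  a_pos : ∀ x : ℝ, 0 ≤ x → x < t → 0 < (a x).re
  a_neg : ∀ x : ℝ, t < x → (a x).re < 0
  b_neg : ∀ x : ℝ, 0 ≤ x → (b x).re < 0

/-- The regular factor of the coefficient with the turning point. -/
noncomputable def regFactor (t : ℝ) (a : ℂ → ℂ) (x : ℂ) : ℂ := -((x + 1) * dslope a t x)

variable {R δ t K α β : ℝ} {a b : ℂ → ℂ}

namespace SideData

theorem add_one_ne (D : SideData R δ t K α β a b) {x : ℂ} (hx : x ∈ HS R) : x + 1 ≠ 0 := by
  intro h
  have h1 := hx.1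
  have h2 : x.re + 1 = 0 := by simpa using congrArg re h
  linarith [D.R_le]

theorem regFactor_of_ne (D : SideData R δ t K α β a b) {x : ℂ} (hx : x ≠ t) :
    regFactor t a x = -a x * (x + 1) / (x - t) := by
  rw [regFactor, dslope_of_ne _ hx, slope_def_field, D.a_zero, sub_zero]
  ring

theorem tau_mul_regFactor (D : SideData R δ t K α β a b) {x : ℂ} (hx : x ∈ HS R) :
    (x - t) / (x + 1) * regFactor t a x = -a x := by
  have h1 := D.add_one_ne hx
  by_cases h : x = t
  · simp [h, D.a_zero]
  · rw [D.regFactor_of_ne h]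
    have := sub_ne_zero.2 h
    field_simp

theorem regFactor_diff (D : SideData R δ t K α β a b) :
    DifferentiableOn ℂ (regFactor t a) (HS R) := by
  have : DifferentiableOn ℂ (dslope a t) (HS R) :=
    (differentiableOn_dslope ((isOpen_HS R).mem_nhds (ofReal_mem_HS D.R_pos D.t_pos.le))).2 D.a_diff
  unfold regFactor
  fun_prop

theorem tendsto_regFactor (D : SideData R δ t K α β a b) :
    Tendsto (regFactor t a) (atInf R) (𝓝 α) := by
  have h1 : Tendsto (fun x => -a x) (atInf R) (𝓝 α) :=
    tendsto_of_norm_sub_le (δ := δ) (C := K) (by linarith [D.δ_gt]) fun x hx => by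
      rw [← norm_neg, neg_sub, sub_neg_eq_add, add_comm]; exact D.a_lim x hx
  have h2 := h1.div (tendsto_tau (r := R) t) one_ne_zero
  rw [div_one] at h2
  refine h2.congr' (eventually_atInf.2 ⟨t + 1, fun x hx hxt => ?_⟩)
  have h3 : x - t ≠ 0 := fun h => by
    have : x.re - t = 0 := by simpa using congrArg re h
    linarith
  have h4 := D.add_one_ne hx
  simp only [Pi.div_apply]
  rw [← D.tau_mul_regFactor hx]
  field_simp

theorem regFactor_ofReal (D : SideData R δ t K α β a b) {x : ℝ} (hx : 0 ≤ x) :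
    (regFactor t a x).im = 0 ∧ 0 < (regFactor t a x).re := by
  have hne : ∀ x : ℝ, 0 ≤ x → x ≠ t → (regFactor t a x).im = 0 ∧ 0 < (regFactor t a x).re := by
    intro x hx hxt
    have h1 : a x = ((a x).re : ℝ) := by
      apply Complex.ext <;> simp [D.a_real x hx]
    have h2 : regFactor t a x = ((-(a x).re * (x + 1) / (x - t) : ℝ) : ℂ) := by
      rw [D.regFactor_of_ne (by exact_mod_cast hxt), h1]
      push_cast
      simp
    rw [h2, ofReal_im, ofReal_re]
    refine ⟨rfl, ?_⟩
    rcases lt_or_gt_of_ne hxt with h | h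
    · have := D.a_pos x hx h
      exact div_pos_of_neg_of_neg (by nlinarith) (by linarith)
    · have := D.a_neg x h
      exact div_pos (by nlinarith) (by linarith)
  by_cases hxt : x = t
  swap
  · exact hne x hx hxt
  subst hxt
  have hc : ContinuousAt (fun y : ℝ => regFactor x a y) x :=
    ContinuousAt.comp (f := fun y : ℝ => (y : ℂ)) (D.regFactor_diff.continuousOn.continuousAt
      ((isOpen_HS R).mem_nhds (ofReal_mem_HS D.R_pos D.t_pos.le))) continuous_ofReal.continuousAt
  have hev : ∀ᶠ y : ℝ in 𝓝[≠] x, 0 ≤ y ∧ y ≠ x :=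
    ((eventually_ge_nhds D.t_pos).filter_mono nhdsWithin_le_nhds).and self_mem_nhdsWithin
  have him : (regFactor x a x).im = 0 :=
    tendsto_nhds_unique ((continuous_im.continuousAt.comp hc).tendsto.mono_left nhdsWithin_le_nhds)
      (tendsto_const_nhds.congr' (hev.mono fun y hy => (hne y hy.1 hy.2).1.symm))
  have hre : 0 ≤ (regFactor x a x).re :=
    ge_of_tendsto ((continuous_re.continuousAt.comp hc).tendsto.mono_left
      (nhdsWithin_le_nhds (s := {x}ᶜ))) (hev.mono fun y hy => (hne y hy.1 hy.2).2.le)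
  refine ⟨him, hre.lt_of_ne fun h => ?_⟩
  have h0 : regFactor x a x = 0 := Complex.ext h.symm him
  rw [regFactor, dslope_same, neg_eq_zero, mul_eq_zero] at h0
  exact h0.elim (D.add_one_ne (ofReal_mem_HS D.R_pos hx)) D.a_simple

theorem norm_deriv_regFactor_le (D : SideData R δ t K α β a b) {σ : ℝ} (hσ : σ < R) {x : ℂ}
    (hx : x ∈ HS σ) (hxt : 2 * t + 2 ≤ x.re) :
    ‖deriv (regFactor t a) x‖ ≤
      (2 * (2 ^ δ * K / (R - σ)) + (K + α) * (1 + t) * 4) * (x.re + 2) ^ (-δ) := by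
  have ht := D.t_pos
  have hxR := HS_mono hσ.le hx
  have hp : 0 < (x.re + 2) := by linarith
  have hre : (x.re + 2) / 2 ≤ ‖x - t‖ :=
    le_trans (by simp; linarith) (re_le_norm (x - t))
  have hxne : x - t ≠ 0 := norm_pos_iff.1 (by linarith)
  have hev : regFactor t a =ᶠ[𝓝 x] fun y => -a y * (y + 1) / (y - t) := by
    filter_upwards [isOpen_ne.mem_nhds (sub_ne_zero.1 hxne)] with y hy
    exact D.regFactor_of_ne hy
  have hda : HasDerivAt a (deriv a x) x :=
    (D.a_diff.differentiableAt ((isOpen_HS R).mem_nhds hxR)).hasDerivAt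
  have hd : HasDerivAt (fun y => -a y * (y + 1) / (y - t))
      (-(deriv a x * ((x + 1) / (x - t))) + a x * (1 + t) * (1 / (x - t)) ^ 2) x := by
    refine (((hda.neg.mul ((hasDerivAt_id' x).add_const 1)).div
      ((hasDerivAt_id' x).sub_const (t : ℂ))) hxne).congr_deriv ?_
    simp only [Pi.neg_apply, Pi.mul_apply]
    field_simp
    ring
  rw [hev.deriv_eq, hd.deriv]
  have hquot : ‖(x + 1) / (x - t)‖ ≤ 2 := by
    rw [norm_div, div_le_iff₀ (norm_pos_iff.2 hxne)]
    calc ‖x + 1‖ = ‖(x - t) + ((1 + t : ℝ) : ℂ)‖ := by congr 1; push_cast; ring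
      _ ≤ ‖x - t‖ + (1 + t) := by
        refine (norm_add_le _ _).trans ?_
        rw [norm_real, Real.norm_of_nonneg (by linarith)]
      _ ≤ _ := by linarith
  have hda' : ‖deriv a x‖ ≤ 2 ^ δ * K / (R - σ) * (x.re + 2) ^ (-δ) := by
    have h1 := norm_deriv_le_HS (f := fun y => a y + α) (by linarith [D.δ_gt]) D.K_nonneg hσ D.R_le
      (D.a_diff.add_const _) D.a_lim hx
    rw [deriv_add_const] at h1
    exact h1.trans_eq (by ring)
  have ha : ‖a x‖ ≤ K + α := by
    have h1 := D.a_lim x hxR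
    have h2 : (x.re + 2) ^ (-δ) ≤ 1 :=
      Real.rpow_le_one_of_one_le_of_nonpos (by linarith) (by linarith [D.δ_gt])
    calc ‖a x‖ = ‖(a x + α) - α‖ := by rw [add_sub_cancel_right]
      _ ≤ K * 1 + α := by
        refine (norm_sub_le _ _).trans (add_le_add (h1.trans ?_) ?_)
        · exact mul_le_mul_of_nonneg_left h2 D.K_nonneg
        · rw [norm_real, Real.norm_of_nonneg D.α_pos.le]
      _ = _ := by ring
  have hinv : ‖(1 / (x - t)) ^ 2‖ ≤ 4 * (x.re + 2) ^ (-δ) := by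
    calc ‖(1 / (x - t)) ^ 2‖ = 1 / ‖x - t‖ ^ 2 := by simp
      _ ≤ 1 / ((x.re + 2) / 2) ^ 2 := by gcongr
      _ = 4 * (x.re + 2) ^ (-2 : ℝ) := by
        rw [Real.rpow_neg hp.le, Real.rpow_two]; field_simp; norm_num
      _ ≤ _ := by
        gcongr
        · linarith
        · exact D.δ_le
  refine (norm_add_le _ _).trans ?_
  rw [norm_neg, norm_mul, norm_mul, norm_mul, add_mul]
  have h1t : ‖(1 + t : ℂ)‖ = 1 + t := by
    rw [show (1 + t : ℂ) = ((1 + t : ℝ) : ℂ) by push_cast; ring, norm_real,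
      Real.norm_of_nonneg (by linarith)]
  rw [h1t]
  refine add_le_add ?_ ?_
  · calc _ ≤ 2 ^ δ * K / (R - σ) * (x.re + 2) ^ (-δ) * 2 :=
        mul_le_mul hda' hquot (norm_nonneg _) ((norm_nonneg _).trans hda')
      _ = _ := by ring
  · calc _ ≤ (K + α) * (1 + t) * (4 * (x.re + 2) ^ (-δ)) :=
        mul_le_mul (mul_le_mul_of_nonneg_right ha (by linarith)) hinv (norm_nonneg _)
          (mul_nonneg ((norm_nonneg _).trans ha) (by linarith))
      _ = _ := by ring

theorem exists_tpData (D : SideData R δ t K α β a b) :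
    ∃ r c C, TPData r δ t c C α β (regFactor t a) (fun x => -b x) := by
  have hδ : 0 < δ := by linarith [D.δ_gt]
  have hR := D.R_pos
  obtain ⟨X₁, hX₁⟩ := eventually_atInf.1 ((continuous_re.tendsto _).comp
    D.tendsto_regFactor |>.eventually (lt_mem_nhds (show α / 2 < (α : ℂ).re by
      have := D.α_pos; simp; linarith)))
  obtain ⟨r₁, c₁, hr₁, hr₁R, hc₁, H₁⟩ := exists_re_lower_bound D.R_pos D.regFactor_diff.continuousOn
    (half_pos D.α_pos) (fun x hx h => (hX₁ x hx h).le) fun x hx => (D.regFactor_ofReal hx).2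
  have hb : Tendsto (fun x => -b x) (atInf R) (𝓝 β) :=
    tendsto_of_norm_sub_le (δ := δ) (C := K) (by linarith [D.δ_gt]) fun x hx => by
      rw [← norm_neg, neg_sub, sub_neg_eq_add, add_comm]; exact D.b_lim x hx
  obtain ⟨X₂, hX₂⟩ := eventually_atInf.1 ((continuous_re.tendsto _).comp
    hb |>.eventually (lt_mem_nhds (show β / 2 < (β : ℂ).re by
      have := D.β_pos; simp; linarith)))
  obtain ⟨r₂, c₂, hr₂, hr₂R, hc₂, H₂⟩ := exists_re_lower_bound D.R_pos D.b_diff.neg.continuousOn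
    (half_pos D.β_pos) (fun x hx h => (hX₂ x hx h).le) fun x hx => by
      simpa using D.b_neg x hx
  obtain ⟨X₃, hX₃⟩ := eventually_atInf.1 (D.tendsto_regFactor.norm.eventually
    (gt_mem_nhds (lt_add_one ‖(α : ℂ)‖)))
  have hhalf : R / 2 < R := by linarith
  obtain ⟨K₃, hK₃, H₃⟩ := exists_decay_bound (δ := 0) (K := ‖(α : ℂ)‖ + 1) (X := X₃) D.R_le hhalf
    D.regFactor_diff.continuousOn fun x hx h => by
      rw [neg_zero, Real.rpow_zero, mul_one]
      exact (hX₃ x (HS_mono hhalf.le hx) h).le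
  obtain ⟨K₄, hK₄, H₄⟩ := exists_decay_bound D.R_le hhalf
    (D.regFactor_diff.deriv (isOpen_HS R)).continuousOn
    fun x hx h => D.norm_deriv_regFactor_le hhalf hx h
  set r := min (R / 2) (min r₁ r₂)
  set K₅ := 2 ^ δ * K / (R - R / 2)
  have hK₅ : 0 ≤ K₅ := by have := D.K_nonneg; have : 0 < R - R / 2 := by linarith
                          positivity
  have hK := D.K_nonneg
  have hβ := D.β_pos
  set C := K + β + K₃ + K₄ + K₅
  have hrR : HS r ⊆ HS (R / 2) := HS_mono (min_le_left _ _)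
  have hrR' : HS r ⊆ HS R := hrR.trans (HS_mono hhalf.le)
  have hr1 : HS r ⊆ HS r₁ := HS_mono ((min_le_right _ _).trans (min_le_left _ _))
  have hr2 : HS r ⊆ HS r₂ := HS_mono ((min_le_right _ _).trans (min_le_right _ _))
  have hp : ∀ x ∈ HS r, 0 < x.re + 2 := fun x hx => by
    linarith [(hrR' hx).1, D.R_le]
  refine ⟨r, min c₁ c₂, C, ⟨by positivity, (min_le_left _ _).trans (by linarith [D.R_le]), D.δ_gt,
    D.δ_le, D.t_pos, by positivity, D.α_pos, D.β_pos, D.regFactor_diff.mono hrR',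
    (D.b_diff.mono hrR').neg, fun x hx => (min_le_left _ _).trans (H₁ x (hr1 hx)),
    fun x hx => (min_le_right _ _).trans (H₂ x (hr2 hx)), ?_, ?_, ?_, ?_,
    fun x hx => (D.regFactor_ofReal hx).1, fun x hx => by simp [D.b_real x hx], ?_, ?_⟩⟩
  · intro x hx
    have := H₃ x (hrR hx)
    rw [neg_zero, Real.rpow_zero, mul_one] at this
    linarith
  · intro x hx
    have h1 := D.b_lim x (hrR' hx)
    have h2 : (x.re + 2) ^ (-δ) ≤ 1 :=
      Real.rpow_le_one_of_one_le_of_nonpos (by linarith [(hrR' hx).1, D.R_le]) (by linarith)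
    rw [norm_neg]
    calc ‖b x‖ = ‖(b x + β) - β‖ := by rw [add_sub_cancel_right]
      _ ≤ K * 1 + β := by
        refine (norm_sub_le _ _).trans (add_le_add (h1.trans ?_) ?_)
        · exact mul_le_mul_of_nonneg_left h2 D.K_nonneg
        · rw [norm_real, Real.norm_of_nonneg D.β_pos.le]
      _ ≤ C := by linarith
  · intro x hx
    refine (H₄ x (hrR hx)).trans ?_
    have := hp x hx
    gcongr
    linarith
  · intro x hx
    have h1 := norm_deriv_le_HS (f := fun y => b y + β) (by linarith [D.δ_gt]) D.K_nonneg hhalf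
      D.R_le (D.b_diff.add_const _) D.b_lim (hrR hx)
    rw [deriv_add_const] at h1
    rw [deriv.fun_neg, norm_neg]
    refine h1.trans ?_
    have := hp x hx
    rw [mul_div_right_comm]
    gcongr
    change K₅ ≤ C
    linarith
  · intro x hx
    rw [D.tau_mul_regFactor (hrR' hx), ← norm_neg, show -(-a x - α) = a x + α by ring]
    refine (D.a_lim x (hrR' hx)).trans ?_
    have := hp x hx
    gcongr
    linarith
  · intro x hx
    rw [← norm_neg, show -(-b x - β) = b x + β by ring]
    refine (D.b_lim x (hrR' hx)).trans ?_
    have := hp x hx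
    gcongr
    linarith

end SideData

end

section

/-- A family of solutions of `u' = (i/h) a v`, `v' = (i/h) b u` on the half line, normalised at
infinity. -/
structure SideFamily (α β : ℝ) (a b : ℂ → ℂ) (u v : ℝ → ℝ → ℂ) : Prop where
  deriv_u : ∀ h : ℝ, 0 < h → ∀ s : ℝ, HasDerivAt (u h) (I / h * a s * v h s) s
  deriv_v : ∀ h : ℝ, 0 < h → ∀ s : ℝ, HasDerivAt (v h) (I / h * b s * u h s) s
  lim_u : ∀ h : ℝ, 0 < h → Tendsto (fun s : ℝ => exp (I / h * Real.sqrt (α * β) * s) * u h s) atTop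
    (𝓝 (((α / β) ^ ((1 : ℝ) / 4) : ℝ) : ℂ))
  lim_v : ∀ h : ℝ, 0 < h → Tendsto (fun s : ℝ => exp (I / h * Real.sqrt (α * β) * s) * v h s) atTop
    (𝓝 (((α / β) ^ ((1 : ℝ) / 4) : ℝ) : ℂ)⁻¹)

/-- The regularised action from the origin to infinity through the turning point. -/
noncomputable def sidePhase (t p : ℝ) (a b : ℂ → ℂ) : ℂ :=
  ((-(p * t) + ∫ x in Ioi t, (√((a x).re * (b x).re) - p) : ℝ) : ℂ)
    - I * (∫ x in (0 : ℝ)..t, √(-((a x).re * (b x).re)) : ℝ)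

variable {R δ t K α β : ℝ} {a b : ℂ → ℂ}

namespace SideData

theorem momSq_eq (D : SideData R δ t K α β a b) {x : ℝ} (hx : 0 ≤ x) :
    momSq t (regFactor t a) (fun x => -b x) x = (a x).re * (b x).re := by
  have h := D.tau_mul_regFactor (ofReal_mem_HS D.R_pos hx)
  have h1 : regFactor t a x = ((regFactor t a x).re : ℝ) := by
    apply Complex.ext <;> simp [(D.regFactor_ofReal hx).1]
  have h2 : (((x - t) / (x + 1) * (regFactor t a x).re : ℝ) : ℂ) = -a x := by
    rw [← h]; push_cast; rw [← h1]
  have h3 := congrArg re h2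
  rw [ofReal_re, neg_re] at h3
  rw [momSq, h3, neg_re]
  ring

theorem phaseC_eq (D : SideData R δ t K α β a b) (p : ℝ) :
    phaseC t p (regFactor t a) (fun x => -b x) = sidePhase t p a b := by
  have ht := D.t_pos
  have h1 : ∫ x in Ioi t, (√(momSq t (regFactor t a) (fun x => -b x) x) - p) =
      ∫ x in Ioi t, (√((a x).re * (b x).re) - p) :=
    setIntegral_congr_fun measurableSet_Ioi fun x (hx : t < x) => by
      simp only [D.momSq_eq (ht.le.trans hx.le)]
  have h2 : ∫ x in (0 : ℝ)..t, √(-momSq t (regFactor t a) (fun x => -b x) x) =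
      ∫ x in (0 : ℝ)..t, √(-((a x).re * (b x).re)) := by
    refine intervalIntegral.integral_congr fun x hx => ?_
    rw [uIcc_of_le ht.le] at hx
    simp only [D.momSq_eq hx.1]
  rw [phaseC, sidePhase, h1, h2]

theorem connection (D : SideData R δ t K α β a b) :
    ∃ (C' : ℝ) (a₀ b₀ : ℕ → ℂ), 1 ≤ C' ∧ a₀ 0 = 1 ∧ b₀ 0 = 0 ∧
      ∀ u v, SideFamily α β a b u v → ∃ Fe Fo : ℝ → ℂ, Gevrey 1 C' Fe a₀ ∧ Gevrey 1 C' Fo b₀ ∧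
        ∀ h : ℝ, 0 < h →
          u h 0 = exp (I / h * sidePhase t (√(α * β)) a b) * (Fe h + Fo h) *
            ((((a 0).re / -(b 0).re) ^ ((1 : ℝ) / 4) : ℝ) * exp (-(Real.pi / 4) * I)) ∧
          v h 0 = exp (I / h * sidePhase t (√(α * β)) a b) * (Fe h - Fo h) *
            ((((a 0).re / -(b 0).re) ^ ((1 : ℝ) / 4) : ℝ) * exp (-(Real.pi / 4) * I))⁻¹ := by
  obtain ⟨r, c, C, T⟩ := D.exists_tpData
  obtain ⟨C', a₀, b₀, hC', ha₀, hb₀, H⟩ := T.gevrey_connection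
  refine ⟨C', a₀, b₀, hC', ha₀, hb₀, fun u v F => ?_⟩
  have hg0 : t * (regFactor t a 0).re = (a 0).re := by
    have h1 : regFactor t a 0 = a 0 / t := by
      rw [D.regFactor_of_ne (by exact_mod_cast D.t_pos.ne)]
      simp [div_neg, neg_div]
    rw [h1, div_ofReal_re]
    field_simp [D.t_pos.ne']
  have hamp : amp t (regFactor t a) (fun x => -b x) 0 =
      (((a 0).re / -(b 0).re) ^ ((1 : ℝ) / 4) : ℝ) * exp (-(Real.pi / 4) * I) := by
    rw [T.amp_zero, hg0, neg_re]
  rw [← hamp, ← D.phaseC_eq]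
  refine H u v ⟨fun h hh s hs => ?_, fun h hh s hs => ?_, F.lim_u, F.lim_v⟩
  · refine (F.deriv_u h hh s).congr_deriv ?_
    rw [D.tau_mul_regFactor (ofReal_mem_HS D.R_pos hs)]
    ring
  · exact (F.deriv_v h hh s).congr_deriv (by ring)

end SideData

end

section

/-- A function with a sectorial decay bound, restricted to a half strip along the real axis. -/
theorem exists_decay_affine {ε η δ C X e x₀ : ℝ} {f : ℂ → ℂ} {w : ℂ} (hε : 0 < ε) (hη : 0 < η)
    (hδ : 1 < δ) (he : e = 1 ∨ e = -1) (hf : AnalyticOnNhd ℂ f (Sector ε η))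
    (h : ∀ x ∈ Sector ε η, X ≤ e * x.re → ‖f x - w‖ ≤ C * (1 + ‖x‖ ^ 2) ^ (-(δ / 2))) :
    ∃ R K, 0 < R ∧ R ≤ 1 / 2 ∧ 0 ≤ K ∧ DifferentiableOn ℂ (fun y => f (x₀ + e * y)) (HS R) ∧
      ∀ y ∈ HS R, ‖f (x₀ + e * y) - w‖ ≤ K * (y.re + 2) ^ (-(min δ 2)) := by
  have he1 : |e| = 1 := by rcases he with rfl | rfl <;> simp
  have hee : e * e = 1 := by rcases he with rfl | rfl <;> simp
  set R := min η (1 / 2) with hR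
  have hRpos : 0 < R := by positivity
  have hmaps : MapsTo (fun y : ℂ => (x₀ + e * y : ℂ)) (HS R) (Sector ε η) := fun y hy => by
    have h1 : |y.im| < η := hy.2.trans_le (min_le_left _ _)
    have h2 : 0 ≤ ε * |x₀ + e * y.re| := by positivity
    simp only [Sector, mem_ofPred_eq, add_im, ofReal_im, mul_im, ofReal_re, add_re, mul_re, zero_mul,
      add_zero, zero_add, sub_zero, abs_mul, he1, one_mul]
    linarith
  have hd : DifferentiableOn ℂ (fun y => f (x₀ + e * y)) (HS R) :=
    hf.differentiableOn.comp (by fun_prop) hmaps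
  have hfar : ∀ y ∈ HS (R / 2), max (2 * |x₀| + 2) (X + |x₀|) ≤ y.re →
      ‖f (x₀ + e * y) - w‖ ≤ |C| * 2 ^ δ * (y.re + 2) ^ (-(min δ 2)) := by
    intro y hy hX
    have hx0 : |e * x₀| = |x₀| := by rw [abs_mul, he1, one_mul]
    have hx1 := neg_abs_le (e * x₀)
    have hy1 := (le_max_left _ _).trans hX
    have hy2 := (le_max_right _ _).trans hX
    have habs := abs_nonneg x₀
    have hre : e * (x₀ + e * y : ℂ).re = e * x₀ + y.re := by
      simp
      linear_combination y.re * hee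
    have h1 := h _ (hmaps (HS_mono (by linarith) hy)) (by rw [hre]; linarith)
    have hp : 0 < (y.re + 2) / 2 := by linarith
    have hn : (y.re + 2) / 2 ≤ ‖(x₀ + e * y : ℂ)‖ := by
      calc (y.re + 2) / 2 ≤ e * (x₀ + e * y : ℂ).re := by rw [hre]; linarith
        _ ≤ |e * (x₀ + e * y : ℂ).re| := le_abs_self _
        _ = |(x₀ + e * y : ℂ).re| := by rw [abs_mul, he1, one_mul]
        _ ≤ _ := abs_re_le_norm _
    calc ‖f (x₀ + e * y) - w‖ ≤ C * (1 + ‖(x₀ + e * y : ℂ)‖ ^ 2) ^ (-(δ / 2)) := h1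
      _ ≤ |C| * (1 + ‖(x₀ + e * y : ℂ)‖ ^ 2) ^ (-(δ / 2)) := by gcongr; exact le_abs_self C
      _ ≤ |C| * (((y.re + 2) / 2) ^ 2) ^ (-(δ / 2)) := by
        refine mul_le_mul_of_nonneg_left
          (Real.rpow_le_rpow_of_nonpos (by positivity) ?_ (by linarith)) (abs_nonneg _)
        have : ((y.re + 2) / 2) ^ 2 ≤ ‖(x₀ + e * y : ℂ)‖ ^ 2 := by gcongr
        linarith
      _ = |C| * 2 ^ δ * (y.re + 2) ^ (-δ) := by
        rw [← Real.rpow_natCast, ← Real.rpow_mul hp.le,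
          show ((2 : ℕ) : ℝ) * (-(δ / 2)) = -δ by push_cast; ring,
          Real.div_rpow (by linarith) (by norm_num), Real.rpow_neg (by norm_num : (0 : ℝ) ≤ 2),
          div_inv_eq_mul]
        ring
      _ ≤ _ := by
        gcongr
        · linarith
        · exact min_le_left _ _
  obtain ⟨K, hK, H⟩ := exists_decay_bound (min_le_right _ _) (half_lt_self hRpos)
    (hd.continuousOn.sub continuousOn_const) hfar
  exact ⟨R / 2, K, by positivity, by linarith [min_le_right η (1 / 2)], hK,
    hd.mono (HS_mono (by linarith)), H⟩

/-- The coefficient `(μ - s) / c` of the Dirac system. -/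
noncomputable def sideA (μ c : ℝ) (s : ℂ → ℂ) (y : ℂ) : ℂ := (μ - s y) / c

/-- The coefficient `-(μ + s) / c` of the Dirac system. -/
noncomputable def sideB (μ c : ℝ) (s : ℂ → ℂ) (y : ℂ) : ℂ := -(μ + s y) / c

theorem sideData_of {R δ t K μ c L : ℝ} {s : ℂ → ℂ} (hR : 0 < R) (hR2 : R ≤ 1 / 2) (hδ : 1 < δ)
    (hδ2 : δ ≤ 2) (ht : 0 < t) (hK : 0 ≤ K) (hc : 0 < c) (hμ : 0 < μ) (hL : μ < L)
    (hd : DifferentiableOn ℂ s (HS R)) (hreal : ∀ x : ℝ, 0 ≤ x → (s x).im = 0)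
    (hlim : ∀ x ∈ HS R, ‖s x - L‖ ≤ K * (x.re + 2) ^ (-δ)) (hst : s t = μ) (hst' : deriv s t ≠ 0)
    (h1 : ∀ x : ℝ, 0 ≤ x → x < t → (s x).re < μ) (h2 : ∀ x : ℝ, t < x → μ < (s x).re)
    (h3 : ∀ x : ℝ, 0 ≤ x → -μ < (s x).re) :
    SideData R δ t (K / c) ((L - μ) / c) ((L + μ) / c) (sideA μ c s) (sideB μ c s) where
  R_pos := hR
  R_le := hR2
  δ_gt := hδ
  δ_le := hδ2
  t_pos := ht
  α_pos := div_pos (by linarith) hc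
  β_pos := div_pos (by linarith) hc
  K_nonneg := by positivity
  a_diff := by unfold sideA; fun_prop
  b_diff := by unfold sideB; fun_prop
  a_real x hx := by simp [sideA, div_ofReal_im, hreal x hx]
  b_real x hx := by simp [sideB, div_ofReal_im, hreal x hx]
  a_lim x hx := by
    have h0 : sideA μ c s x + ((L - μ) / c : ℝ) = -(s x - L) / c := by
      rw [sideA]; push_cast; ring
    rw [h0, norm_div, norm_neg, norm_real, Real.norm_of_nonneg hc.le, div_mul_eq_mul_div]
    gcongr
    exact hlim x hx
  b_lim x hx := by
    have h0 : sideB μ c s x + ((L + μ) / c : ℝ) = -(s x - L) / c := by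
      rw [sideB]; push_cast; ring
    rw [h0, norm_div, norm_neg, norm_real, Real.norm_of_nonneg hc.le, div_mul_eq_mul_div]
    gcongr
    exact hlim x hx
  a_zero := by simp [sideA, hst]
  a_simple := by
    have h0 : HasDerivAt s (deriv s t) t :=
      (hd.differentiableAt ((isOpen_HS R).mem_nhds (ofReal_mem_HS hR ht.le))).hasDerivAt
    have h0' : HasDerivAt (sideA μ c s) (-deriv s t / c) t := (h0.const_sub _).div_const _
    rw [h0'.deriv]
    exact div_ne_zero (neg_ne_zero.2 hst') (by exact_mod_cast hc.ne')
  a_pos x hx hxt := by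
    rw [sideA, div_ofReal_re]
    have := h1 x hx hxt
    exact div_pos (by simp; linarith) hc
  a_neg x hxt := by
    rw [sideA, div_ofReal_re]
    have := h2 x hxt
    exact div_neg_of_neg_of_pos (by simp; linarith) hc
  b_neg x hx := by
    rw [sideB, div_ofReal_re]
    have := h3 x hx
    exact div_neg_of_neg_of_pos (by simp; linarith) hc

/-- The position of the energy relative to the potential, read off from the turning points. -/
structure TurningPattern (μ t₁ t₂ : ℝ) (l : ℝ → ℝ) : Prop where
  lt_left : ∀ x, x < t₁ → μ < l x
  left : l t₁ = μ
  lt_of_left : ∀ x, t₁ < x → l x < μ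
  gt_of_right : ∀ x, x < t₂ → -μ < l x
  right : l t₂ = -μ
  right_lt : ∀ x, t₂ < x → l x < -μ

theorem turningPattern_of {μ t₁ t₂ lm lp : ℝ} {l : ℝ → ℝ} (hμ : 0 < μ) (ht : t₁ < t₂)
    (hl : Continuous l) (hlm : Tendsto l atBot (𝓝 lm)) (hlp : Tendsto l atTop (𝓝 lp))
    (hm : μ < lm) (hp : lp < -μ) (hz : ∀ x, l x ^ 2 = μ ^ 2 ↔ x = t₁ ∨ x = t₂) :
    TurningPattern μ t₁ t₂ l := by
  have hz' : ∀ x, l x = μ ∨ l x = -μ → x = t₁ ∨ x = t₂ := fun x hx => (hz x).1 (by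
    rcases hx with h | h <;> rw [h]; ring)
  have hz1 : l t₁ = μ ∨ l t₁ = -μ := sq_eq_sq_iff_eq_or_eq_neg.1 ((hz t₁).2 (Or.inl rfl))
  have hz2 : l t₂ = μ ∨ l t₂ = -μ := sq_eq_sq_iff_eq_or_eq_neg.1 ((hz t₂).2 (Or.inr rfl))
  have hlt : ∀ x, x < t₁ → μ < l x := by
    intro x hx
    by_contra! h
    obtain ⟨y, hy1, hy2⟩ := ((hlm.eventually (lt_mem_nhds hm)).and (eventually_le_atBot x)).exists
    obtain ⟨z, hz3, hz4⟩ := intermediate_value_Icc' hy2 hl.continuousOn ⟨h, hy1.le⟩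
    rcases hz' z (Or.inl hz4) with h | h <;> linarith [hz3.2]
  have hgt : ∀ x, t₂ < x → l x < -μ := by
    intro x hx
    by_contra! h
    obtain ⟨y, hy1, hy2⟩ := ((hlp.eventually (gt_mem_nhds hp)).and (eventually_ge_atTop x)).exists
    obtain ⟨z, hz3, hz4⟩ := intermediate_value_Icc' hy2 hl.continuousOn ⟨hy1.le, h⟩
    rcases hz' z (Or.inr hz4) with h | h <;> linarith [hz3.1]
  have hl1 : l t₁ = μ := by
    have : μ ≤ l t₁ := ge_of_tendsto (hl.tendsto t₁ |>.mono_left (nhdsWithin_le_nhds (s := Iio t₁)))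
      (eventually_nhdsWithin_of_forall fun x hx => (hlt x hx).le)
    rcases hz1 with h | h
    · exact h
    · linarith
  have hl2 : l t₂ = -μ := by
    have : l t₂ ≤ -μ := le_of_tendsto (hl.tendsto t₂ |>.mono_left
      (nhdsWithin_le_nhds (s := Ioi t₂))) (eventually_nhdsWithin_of_forall fun x hx => (hgt x hx).le)
    rcases hz2 with h | h
    · linarith
    · exact h
  refine ⟨hlt, hl1, fun x hx => ?_, fun x hx => ?_, hl2, hgt⟩
  · rcases lt_trichotomy x t₂ with h | h | h
    · by_contra! h'
      obtain ⟨z, hz3, hz4⟩ := intermediate_value_Icc' h.le hl.continuousOn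
        ⟨by rw [hl2]; linarith, h'⟩
      rcases hz' z (Or.inl hz4) with h | h
      · linarith [hz3.1]
      · rw [h, hl2] at hz4; linarith
    · rw [h, hl2]; linarith
    · linarith [hgt x h]
  · rcases lt_trichotomy x t₁ with h | h | h
    · linarith [hlt x h]
    · rw [h, hl1]; linarith
    · by_contra! h'
      obtain ⟨z, hz3, hz4⟩ := intermediate_value_Icc' h.le hl.continuousOn
        ⟨h', by rw [hl1]; linarith⟩
      rcases hz' z (Or.inr hz4) with h | h
      · rw [h, hl1] at hz4; linarith
      · linarith [hz3.2]

end

section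

/-- The hypotheses of the Klein paradox on the potential. -/
structure KleinPotential (m c Vm Vp E : ℝ) (V : ℂ → ℂ) (t₁ t₂ : ℝ) : Prop where
  hA : AssumptionA V Vm Vp
  hm : 0 < m
  hc : 0 < c
  hE1 : Vm + m * c ^ 2 < E
  hE2 : E < Vp - m * c ^ 2
  ht : t₁ < t₂
  zeros : ∀ x : ℝ, m ^ 2 * c ^ 4 - ((V x).re - E) ^ 2 = 0 ↔ x = t₁ ∨ x = t₂
  simple1 : deriv (fun x : ℝ => m ^ 2 * c ^ 4 - ((V x).re - E) ^ 2) t₁ ≠ 0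
  simple2 : deriv (fun x : ℝ => m ^ 2 * c ^ 4 - ((V x).re - E) ^ 2) t₂ ≠ 0

namespace KleinPotential

variable {m c Vm Vp E t₁ t₂ : ℝ} {V : ℂ → ℂ}

theorem analyticAt_ofReal (D : KleinPotential m c Vm Vp E V t₁ t₂) (x : ℝ) : AnalyticAt ℂ V x := by
  obtain ⟨ε, hε, η, hη, δ, -, h, -⟩ := D.hA.sector
  refine h x ?_
  have : 0 ≤ ε * |x| := by positivity
  simp only [Sector, mem_ofPred_eq, ofReal_im, ofReal_re, abs_zero]
  linarith

theorem deriv_ne (D : KleinPotential m c Vm Vp E V t₁ t₂) {t : ℝ}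
    (h : deriv (fun x : ℝ => m ^ 2 * c ^ 4 - ((V x).re - E) ^ 2) t ≠ 0) : deriv V t ≠ 0 := by
  intro h0
  refine h ?_
  have h1 : HasDerivAt V 0 t := h0 ▸ (D.analyticAt_ofReal t).differentiableAt.hasDerivAt
  have h2 : HasDerivAt (fun x : ℝ => (V x).re) 0 t := h1.real_of_complex
  have h3 := ((h2.sub_const E).pow 2).const_sub (m ^ 2 * c ^ 4)
  simpa using h3.deriv

theorem norm_sub_le_affine (D : KleinPotential m c Vm Vp E V t₁ t₂) (x₀ : ℝ) :
    (∃ R δ K : ℝ, 0 < R ∧ R ≤ 1 / 2 ∧ 1 < δ ∧ δ ≤ 2 ∧ 0 ≤ K ∧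
      DifferentiableOn ℂ (fun y => V (x₀ + y)) (HS R) ∧
      ∀ y ∈ HS R, ‖V (x₀ + y) - Vp‖ ≤ K * (y.re + 2) ^ (-δ)) ∧
    (∃ R δ K : ℝ, 0 < R ∧ R ≤ 1 / 2 ∧ 1 < δ ∧ δ ≤ 2 ∧ 0 ≤ K ∧
      DifferentiableOn ℂ (fun y => V (x₀ - y)) (HS R) ∧
      ∀ y ∈ HS R, ‖V (x₀ - y) - Vm‖ ≤ K * (y.re + 2) ^ (-δ)) := by
  obtain ⟨ε, hε, η, hη, δ, hδ, h, ⟨Cp, Rp, hp⟩, ⟨Cm, Rm, hm⟩⟩ := D.hA.sector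
  have hδ2 : 1 < min δ 2 := lt_min hδ one_lt_two
  constructor
  · obtain ⟨R, K, h1, h2, h3, h4, h5⟩ := exists_decay_affine (x₀ := x₀) (X := Rp) hε hη hδ
      (Or.inl rfl) h (by simpa using hp)
    simp only [ofReal_one, one_mul] at h4 h5
    exact ⟨R, min δ 2, K, h1, h2, hδ2, min_le_right _ _, h3, h4, h5⟩
  · obtain ⟨R, K, h1, h2, h3, h4, h5⟩ := exists_decay_affine (x₀ := x₀) (X := Rm) hε hη hδ
      (Or.inr rfl) h (fun x hx hX => hm x hx (by linarith))
    simp only [ofReal_neg, ofReal_one, neg_mul, one_mul, ← sub_eq_add_neg] at h4 h5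
    exact ⟨R, min δ 2, K, h1, h2, hδ2, min_le_right _ _, h3, h4, h5⟩

theorem tendsto_of_decay {R δ K x₀ : ℝ} {w : ℝ} {f : ℂ → ℂ} (hR : 0 < R) (hδ : 1 < δ)
    (h : ∀ y ∈ HS R, ‖f y - w‖ ≤ K * (y.re + 2) ^ (-δ)) :
    Tendsto (fun x : ℝ => (f (x - x₀ : ℝ)).re) atTop (𝓝 w) := by
  have h1 := (tendsto_of_norm_sub_le (by linarith) h).comp (tendsto_ofReal_atInf hR)
  have h2 : Tendsto (fun x : ℝ => x - x₀) atTop atTop := tendsto_atTop_add_const_right _ _ tendsto_id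
  exact (continuous_re.tendsto (w : ℂ)).comp (h1.comp h2)

theorem pattern (D : KleinPotential m c Vm Vp E V t₁ t₂) :
    TurningPattern (m * c ^ 2) t₁ t₂ fun x => E - (V x).re := by
  obtain ⟨⟨R, δ, K, hR, -, hδ, -, -, -, h1⟩, ⟨R', δ', K', hR', -, hδ', -, -, -, h2⟩⟩ :=
    D.norm_sub_le_affine 0
  have hcont : Continuous fun x : ℝ => (V x).re := continuous_re.comp
    (continuous_iff_continuousAt.2 fun x =>
      (D.analyticAt_ofReal x).continuousAt.comp continuous_ofReal.continuousAt)
  have e1 : Tendsto (fun x : ℝ => (V x).re) atTop (𝓝 Vp) := by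
    have := tendsto_of_decay (x₀ := 0) hR hδ h1
    simpa using this
  have e2 : Tendsto (fun x : ℝ => (V x).re) atBot (𝓝 Vm) := by
    have := (tendsto_of_decay (x₀ := 0) hR' hδ' h2).comp tendsto_neg_atBot_atTop
    simpa [Function.comp_def] using this
  have hμ : 0 < m * c ^ 2 := mul_pos D.hm (pow_pos D.hc 2)
  refine turningPattern_of hμ D.ht (continuous_const.sub hcont) (e2.const_sub E) (e1.const_sub E)
    (by linarith [D.hE1]) (by linarith [D.hE2]) fun x => ?_
  rw [← D.zeros x]
  constructor <;> intro h <;> linear_combination -h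

theorem sideData_right (D : KleinPotential m c Vm Vp E V t₁ t₂) {x₀ : ℝ} (h1 : t₁ < x₀)
    (h2 : x₀ < t₂) : ∃ R δ K, SideData R δ (t₂ - x₀) K ((Vp - E - m * c ^ 2) / c)
      ((Vp - E + m * c ^ 2) / c) (sideA (m * c ^ 2) c fun y => V (x₀ + y) - E)
      (sideB (m * c ^ 2) c fun y => V (x₀ + y) - E) := by
  obtain ⟨⟨R, δ, K, hR, hR2, hδ, hδ2, hK, hd, hb⟩, -⟩ := D.norm_sub_le_affine x₀
  have P := D.pattern
  have hre : ∀ x : ℝ, (V (x₀ + x) - E).re = -(E - (V ((x₀ + x : ℝ) : ℂ)).re) := fun x => by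
    rw [sub_re, ofReal_re, ofReal_add]; ring
  have hreal : ∀ x : ℝ, (V (x₀ + x) - E).im = 0 := fun x => by
    rw [sub_im, ofReal_im, sub_zero]; exact_mod_cast D.hA.real_on_real (x₀ + x)
  have hx : (x₀ + (t₂ - x₀ : ℝ) : ℂ) = t₂ := by push_cast; ring
  refine ⟨R, δ, K / c, sideData_of (t := t₂ - x₀) (L := Vp - E) hR hR2 hδ hδ2 (by linarith) hK D.hc
    (mul_pos D.hm (pow_pos D.hc 2)) (by linarith [D.hE2]) (hd.sub_const _) (fun x _ => hreal x) (fun x hx => ?_) ?_ ?_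
    (fun x hx hxt => ?_) (fun x hxt => ?_) fun x hx => ?_⟩
  · convert hb x hx using 2
    push_cast; ring
  · apply Complex.ext
    · rw [hre, ofReal_re, add_sub_cancel, P.right]; ring
    · rw [hreal, ofReal_im]
  · rw [deriv_sub_const, deriv_comp_const_add, hx]
    exact D.deriv_ne D.simple2
  · rw [hre]; linarith [P.gt_of_right (x₀ + x) (by linarith)]
  · rw [hre]; linarith [P.right_lt (x₀ + x) (by linarith)]
  · rw [hre]; linarith [P.lt_of_left (x₀ + x) (by linarith)]

theorem sideData_left (D : KleinPotential m c Vm Vp E V t₁ t₂) {x₀ : ℝ} (h1 : t₁ < x₀)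
    (h2 : x₀ < t₂) : ∃ R δ K, SideData R δ (x₀ - t₁) K ((E - Vm - m * c ^ 2) / c)
      ((E - Vm + m * c ^ 2) / c) (sideA (m * c ^ 2) c fun y => E - V (x₀ - y))
      (sideB (m * c ^ 2) c fun y => E - V (x₀ - y)) := by
  obtain ⟨-, ⟨R, δ, K, hR, hR2, hδ, hδ2, hK, hd, hb⟩⟩ := D.norm_sub_le_affine x₀
  have P := D.pattern
  have hre : ∀ x : ℝ, (E - V (x₀ - x)).re = E - (V ((x₀ - x : ℝ) : ℂ)).re := fun x => by
    rw [sub_re, ofReal_re, ofReal_sub]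
  have hreal : ∀ x : ℝ, (E - V (x₀ - x)).im = 0 := fun x => by
    rw [sub_im, ofReal_im, zero_sub, neg_eq_zero]; exact_mod_cast D.hA.real_on_real (x₀ - x)
  have hx : (x₀ - (x₀ - t₁ : ℝ) : ℂ) = t₁ := by push_cast; ring
  refine ⟨R, δ, K / c, sideData_of (t := x₀ - t₁) (L := E - Vm) hR hR2 hδ hδ2 (by linarith) hK D.hc
    (mul_pos D.hm (pow_pos D.hc 2)) (by linarith [D.hE1]) (hd.const_sub _) (fun x _ => hreal x) (fun x hx => ?_) ?_ ?_
    (fun x hx hxt => ?_) (fun x hxt => ?_) fun x hx => ?_⟩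
  · rw [show (E - V (x₀ - x) - ((E - Vm : ℝ) : ℂ)) = -(V (x₀ - x) - Vm) by push_cast; ring, norm_neg]
    exact hb x hx
  · apply Complex.ext
    · rw [hre, ofReal_re, sub_sub_cancel, P.left]
    · rw [hreal, ofReal_im]
  · rw [deriv_const_sub, deriv_comp_const_sub, hx, neg_neg]
    exact D.deriv_ne D.simple1
  · rw [hre]; linarith [P.lt_of_left (x₀ - x) (by linarith)]
  · rw [hre]; linarith [P.lt_left (x₀ - x) (by linarith)]
  · rw [hre]; linarith [P.gt_of_right (x₀ - x) (by linarith)]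

end KleinPotential

end

section

open scoped ComplexConjugate

variable {m c E Vm Vp W hp : ℝ} {V : ℂ → ℂ}

/-- The Dirac equation in normal form. -/
theorem hasDerivAt_of_isDiracSolution (hc : 0 < c) (hh : 0 < hp) {u : ℝ → ℂ × ℂ}
    (hu : IsDiracSolution hp m c V E u) (x : ℝ) :
    HasDerivAt (fun y => (u y).1) (I / hp * ((E - V x + m * c ^ 2) / c) * (u x).2) x ∧
    HasDerivAt (fun y => (u y).2) (I / hp * ((E - V x - m * c ^ 2) / c) * (u x).1) x := by
  have h1 : (hp : ℂ) ≠ 0 := by exact_mod_cast hh.ne'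
  have h2 : (c : ℂ) ≠ 0 := by exact_mod_cast hc.ne'
  refine ⟨(hu.diff1 x).hasDerivAt.congr_deriv ?_, (hu.diff2 x).hasDerivAt.congr_deriv ?_⟩
  · have h := hu.eq2 x
    field_simp
    linear_combination I * h + hp * c * deriv (fun y : ℝ => (u y).1) x * I_sq
  · have h := hu.eq1 x
    field_simp
    linear_combination I * h + hp * c * deriv (fun y : ℝ => (u y).2) x * I_sq

theorem hasDerivAt_wron (hc : 0 < c) (hh : 0 < hp) {u v : ℝ → ℂ × ℂ}
    (hu : IsDiracSolution hp m c V E u) (hv : IsDiracSolution hp m c V E v) (x : ℝ) :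
    HasDerivAt (fun x => Wron (u x) (v x)) 0 x := by
  obtain ⟨u1, u2⟩ := hasDerivAt_of_isDiracSolution hc hh hu x
  obtain ⟨v1, v2⟩ := hasDerivAt_of_isDiracSolution hc hh hv x
  exact ((u1.mul v2).sub (u2.mul v1)).congr_deriv (by ring)

theorem wron_eq (hc : 0 < c) (hh : 0 < hp) {u v : ℝ → ℂ × ℂ}
    (hu : IsDiracSolution hp m c V E u) (hv : IsDiracSolution hp m c V E v) (x y : ℝ) :
    Wron (u x) (v x) = Wron (u y) (v y) :=
  is_const_of_deriv_eq_zero (fun x => (hasDerivAt_wron hc hh hu hv x).differentiableAt)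
    (fun x => (hasDerivAt_wron hc hh hu hv x).deriv) x y

/-- Incoming and outgoing Jost solutions at the same end have Wronskian `-2`. -/
theorem wron_jost (hc : 0 < c) (hh : 0 < hp) {u v : ℝ → ℂ × ℂ} {l : Filter ℝ} [l.NeBot]
    (hu : IsDiracSolution hp m c V E u) (hv : IsDiracSolution hp m c V E v)
    (ju : JostCond hp m c E W 1 1 l u) (jv : JostCond hp m c E W (-1) (-1) l v)
    (hA : AmpF m c (E - W) ≠ 0) (x : ℝ) : Wron (u x) (v x) = -2 := by
  have hA' : ((AmpF m c (E - W) : ℝ) : ℂ) ≠ 0 := by exact_mod_cast hA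
  have h := (ju.1.mul jv.2).sub (ju.2.mul jv.1)
  have hl : ((AmpF m c (E - W) : ℝ) : ℂ) * ((((-1 : ℝ) : ℂ)) * ((AmpF m c (E - W) : ℝ) : ℂ)⁻¹) -
      ((1 : ℝ) : ℂ) * ((AmpF m c (E - W) : ℝ) : ℂ)⁻¹ * ((AmpF m c (E - W) : ℝ) : ℂ) = -2 := by
    push_cast
    field_simp
    norm_num
  refine tendsto_nhds_unique (tendsto_const_nhds (f := l)) ((hl ▸ h).congr fun y => ?_)
  rw [wron_eq hc hh hu hv x y, Wron]
  have he : ∀ z w p q : ℂ, z * exp p * (w * exp q) = z * w * exp (p + q) := fun z w p q => by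
    rw [exp_add]; ring
  rw [he, he, ← neg_add]
  have e0 : ∀ k : ℂ, ((1 : ℝ) : ℂ) * I / (hp * c) * k * y + ((-1 : ℝ) : ℂ) * I / (hp * c) * k * y = 0 :=
    fun k => by push_cast; ring
  rw [e0]
  simp

/-- The symmetry of the Dirac equation with real potential under conjugation. -/
def conjSymm (u : ℝ → ℂ × ℂ) (x : ℝ) : ℂ × ℂ := (conj (u x).1, -conj (u x).2)

theorem isDiracSolution_conjSymm (hc : 0 < c) (hh : 0 < hp) (hV : ∀ x : ℝ, (V x).im = 0)
    {u : ℝ → ℂ × ℂ} (hu : IsDiracSolution hp m c V E u) :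
    IsDiracSolution hp m c V E (conjSymm u) := by
  have hV' : ∀ x : ℝ, conj (V x) = V x := fun x => conj_eq_iff_im.2 (hV x)
  have h1 : ∀ x : ℝ, HasDerivAt (fun y => (conjSymm u y).1)
      (conj (I / hp * ((E - V x + m * c ^ 2) / c) * (u x).2)) x := fun x =>
    (hasDerivAt_of_isDiracSolution hc hh hu x).1.star
  have h2 : ∀ x : ℝ, HasDerivAt (fun y => (conjSymm u y).2)
      (-conj (I / hp * ((E - V x - m * c ^ 2) / c) * (u x).1)) x := fun x =>
    (hasDerivAt_of_isDiracSolution hc hh hu x).2.star.neg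
  have h3 : (hp : ℂ) ≠ 0 := by exact_mod_cast hh.ne'
  have h4 : (c : ℂ) ≠ 0 := by exact_mod_cast hc.ne'
  refine ⟨fun x => (h1 x).differentiableAt, fun x => (h2 x).differentiableAt, fun x => ?_,
    fun x => ?_⟩
  · rw [(h2 x).deriv]
    simp only [conjSymm, map_mul, map_div₀, map_sub, conj_I, conj_ofReal, hV', map_pow]
    field_simp
    linear_combination (-(E - V x - m * c ^ 2)) * conj (u x).1 * I_sq
  · rw [(h1 x).deriv]
    simp only [conjSymm, map_mul, map_div₀, map_add, map_sub, conj_I, conj_ofReal, hV', map_pow]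
    field_simp
    linear_combination (E - V x + m * c ^ 2) * conj (u x).2 * I_sq

theorem jostCond_conjSymm {u : ℝ → ℂ × ℂ} {l : Filter ℝ}
    (hu : JostCond hp m c E W (-1) (-1) l u) : JostCond hp m c E W 1 1 l (conjSymm u) := by
  have hθ : ∀ k x : ℝ, conj (exp (-(((-1 : ℝ) : ℂ) * I / (hp * c) * k * x))) =
      exp (-(((1 : ℝ) : ℂ) * I / (hp * c) * k * x)) := fun k x => by
    rw [← exp_conj]
    simp
  constructor
  · have h := (continuous_conj.tendsto _).comp hu.1
    refine (h.congr fun x => ?_).trans (by simp)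
    simp only [Function.comp_apply, map_mul, hθ, conjSymm]
  · have h := ((continuous_conj.tendsto _).comp hu.2).neg
    refine (h.congr fun x => ?_).trans (by simp)
    simp only [Function.comp_apply, map_mul, hθ, conjSymm, neg_mul]

/-- Outgoing Jost solutions at `+∞` restricted to a right half line. -/
theorem sideFamily_right (hm : 0 < m) (hc : 0 < c) (hE : E < Vp - m * c ^ 2) (x₀ : ℝ)
    {ω : ℝ → ℝ → ℂ × ℂ} (hω : ∀ h : ℝ, 0 < h → IsDiracSolution h m c V E (ω h))
    (hj : ∀ h : ℝ, 0 < h → JostCond h m c E Vp 1 1 atTop (ω h)) :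
    SideFamily ((Vp - E - m * c ^ 2) / c) ((Vp - E + m * c ^ 2) / c)
      (sideA (m * c ^ 2) c fun y => V (x₀ + y) - E) (sideB (m * c ^ 2) c fun y => V (x₀ + y) - E)
      (fun h s => exp (I / h * √(Esym m c E Vp) * x₀) * (ω h (x₀ + s)).1)
      (fun h s => exp (I / h * √(Esym m c E Vp) * x₀) * (ω h (x₀ + s)).2) := by
  have hμ : 0 < m * c ^ 2 := mul_pos hm (pow_pos hc 2)
  have hP : (Vp - E - m * c ^ 2) / c * ((Vp - E + m * c ^ 2) / c) = Esym m c E Vp := by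
    rw [Esym]; field_simp; ring
  have hΦ : PhiF m c (E - Vp) = -(c * √(Esym m c E Vp)) := by
    have h1 : Esym m c E Vp = ((E - Vp) ^ 2 - m ^ 2 * c ^ 4) / c ^ 2 := by rw [Esym]; ring
    rw [PhiF, Real.sign_of_neg (by linarith), h1, Real.sqrt_div' _ (by positivity),
      Real.sqrt_sq hc.le]
    field_simp
  have hA : AmpF m c (E - Vp) =
      ((Vp - E - m * c ^ 2) / c / ((Vp - E + m * c ^ 2) / c)) ^ ((1 : ℝ) / 4) := by
    rw [AmpF, div_div_div_cancel_right₀ hc.ne', ← neg_div_neg_eq]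
    congr 2 <;> ring
  have hexp : ∀ h s : ℝ, 0 < h → ∀ z : ℂ,
      z * exp (-(((1 : ℝ) : ℂ) * I / (h * c) * ((PhiF m c (E - Vp) : ℝ) : ℂ) * ((x₀ + s : ℝ) : ℂ))) =
      exp (I / h * √(Esym m c E Vp) * s) * (exp (I / h * √(Esym m c E Vp) * x₀) * z) := by
    intro h s hh z
    have hh' : (h : ℂ) ≠ 0 := by exact_mod_cast hh.ne'
    have hc' : (c : ℂ) ≠ 0 := by exact_mod_cast hc.ne'
    rw [← mul_assoc, ← exp_add, mul_comm z, hΦ]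
    congr 2
    push_cast
    field_simp
    ring
  have hshift : Tendsto (fun s : ℝ => x₀ + s) atTop atTop := tendsto_atTop_add_const_left _ _ tendsto_id
  refine ⟨fun h hh s => ?_, fun h hh s => ?_, fun h hh => ?_, fun h hh => ?_⟩
  · have h1 := (hasDerivAt_of_isDiracSolution hc hh (hω h hh) (x₀ + s)).1.comp_const_add x₀ s
    refine (h1.const_mul _).congr_deriv ?_
    simp only [sideA]
    push_cast
    ring
  · have h1 := (hasDerivAt_of_isDiracSolution hc hh (hω h hh) (x₀ + s)).2.comp_const_add x₀ s
    refine (h1.const_mul _).congr_deriv ?_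
    simp only [sideB]
    push_cast
    ring
  · rw [hP, ← hA]
    exact ((hj h hh).1.comp hshift).congr fun s => hexp h s hh _
  · rw [hP, ← hA]
    have h2 := ((hj h hh).2.comp hshift).congr fun s => hexp h s hh _
    simpa using h2

/-- Incoming Jost solutions at `-∞` restricted to a left half line. -/
theorem sideFamily_left (hm : 0 < m) (hc : 0 < c) (hE : Vm + m * c ^ 2 < E) (x₀ : ℝ)
    {ω : ℝ → ℝ → ℂ × ℂ} (hω : ∀ h : ℝ, 0 < h → IsDiracSolution h m c V E (ω h))
    (hj : ∀ h : ℝ, 0 < h → JostCond h m c E Vm 1 1 atBot (ω h)) :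
    SideFamily ((E - Vm - m * c ^ 2) / c) ((E - Vm + m * c ^ 2) / c)
      (sideA (m * c ^ 2) c fun y => E - V (x₀ - y)) (sideB (m * c ^ 2) c fun y => E - V (x₀ - y))
      (fun h s => exp (-(I / h * √(Esym m c E Vm) * x₀)) * (ω h (x₀ - s)).2)
      (fun h s => exp (-(I / h * √(Esym m c E Vm) * x₀)) * (ω h (x₀ - s)).1) := by
  have hμ : 0 < m * c ^ 2 := mul_pos hm (pow_pos hc 2)
  have hP : (E - Vm - m * c ^ 2) / c * ((E - Vm + m * c ^ 2) / c) = Esym m c E Vm := by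
    rw [Esym]; field_simp; ring
  have hΦ : PhiF m c (E - Vm) = c * √(Esym m c E Vm) := by
    have h1 : Esym m c E Vm = ((E - Vm) ^ 2 - m ^ 2 * c ^ 4) / c ^ 2 := by rw [Esym]; ring
    rw [PhiF, Real.sign_of_pos (by linarith), h1, Real.sqrt_div' _ (by positivity),
      Real.sqrt_sq hc.le]
    field_simp
  have hA : (AmpF m c (E - Vm))⁻¹ =
      ((E - Vm - m * c ^ 2) / c / ((E - Vm + m * c ^ 2) / c)) ^ ((1 : ℝ) / 4) := by
    rw [AmpF, div_div_div_cancel_right₀ hc.ne', ← Real.inv_rpow, inv_div]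
    exact div_nonneg (by linarith) (by linarith)
  have hexp : ∀ h s : ℝ, 0 < h → ∀ z : ℂ,
      z * exp (-(((1 : ℝ) : ℂ) * I / (h * c) * ((PhiF m c (E - Vm) : ℝ) : ℂ) * ((x₀ - s : ℝ) : ℂ))) =
      exp (I / h * √(Esym m c E Vm) * s) * (exp (-(I / h * √(Esym m c E Vm) * x₀)) * z) := by
    intro h s hh z
    have hh' : (h : ℂ) ≠ 0 := by exact_mod_cast hh.ne'
    have hc' : (c : ℂ) ≠ 0 := by exact_mod_cast hc.ne'
    rw [← mul_assoc, ← exp_add, mul_comm z, hΦ]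
    congr 2
    push_cast
    field_simp
    ring
  have hshift : Tendsto (fun s : ℝ => x₀ - s) atTop atBot :=
    (tendsto_atBot_add_const_left _ _ tendsto_neg_atTop_atBot).congr fun s => (sub_eq_add_neg _ _).symm
  refine ⟨fun h hh s => ?_, fun h hh s => ?_, fun h hh => ?_, fun h hh => ?_⟩
  · have h1 := (hasDerivAt_of_isDiracSolution hc hh (hω h hh) (x₀ - s)).2.comp_const_sub x₀ s
    refine (h1.const_mul _).congr_deriv ?_
    simp only [sideA]
    push_cast
    ring
  · have h1 := (hasDerivAt_of_isDiracSolution hc hh (hω h hh) (x₀ - s)).1.comp_const_sub x₀ s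
    refine (h1.const_mul _).congr_deriv ?_
    simp only [sideB]
    push_cast
    ring
  · rw [hP, ← hA]
    have h2 := ((hj h hh).2.comp hshift).congr fun s => hexp h s hh _
    simpa using h2
  · rw [hP, ← hA, ofReal_inv, inv_inv]
    exact ((hj h hh).1.comp hshift).congr fun s => hexp h s hh _

end

section

open scoped ComplexConjugate

variable {m c E Vm Vp W hp t₁ t₂ x₀ : ℝ} {V : ℂ → ℂ}

theorem sideA_re_mul_sideB_re (s : ℂ → ℂ) (y : ℂ) :
    (sideA (m * c ^ 2) c s y).re * (sideB (m * c ^ 2) c s y).re =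
      (-(m ^ 2 * c ^ 4) + (s y).re ^ 2) / c ^ 2 := by
  rw [sideA, sideB, div_ofReal_re, div_ofReal_re, div_mul_div_comm, sub_re, neg_re, add_re, ofReal_re]
  ring

theorem sidePhase_right : sidePhase (t₂ - x₀) √(Esym m c E Vp)
      (sideA (m * c ^ 2) c fun y => V (x₀ + y) - E) (sideB (m * c ^ 2) c fun y => V (x₀ + y) - E) =
    √(Esym m c E Vp) * x₀ - (t₂ * √(Esym m c E Vp) - ∫ t in Ici t₂, Qsym m c E Vp V t : ℝ) -
      I * (∫ t in x₀..t₂, √((m ^ 2 * c ^ 4 - ((V t).re - E) ^ 2) / c ^ 2) : ℝ) := by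
  have h1 : ∫ t in Ici t₂, Qsym m c E Vp V t =
      ∫ x in Ioi (t₂ - x₀), Qsym m c E Vp V (x₀ + x) := by
    rw [integral_Ici_eq_integral_Ioi, ← integral_indicator measurableSet_Ioi,
      ← integral_add_left_eq_self _ x₀, ← integral_indicator measurableSet_Ioi]
    refine integral_congr_ae (Eventually.of_forall fun x => ?_)
    simp only [indicator, mem_Ioi, sub_lt_iff_lt_add']
  have h2 := intervalIntegral.integral_comp_add_left (a := 0) (b := t₂ - x₀)
    (fun t : ℝ => √((m ^ 2 * c ^ 4 - ((V t).re - E) ^ 2) / c ^ 2)) x₀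
  rw [add_zero, add_sub_cancel] at h2
  have h3 : ∀ x : ℝ, -((-(m ^ 2 * c ^ 4) + (V (x₀ + x) - E).re ^ 2) / c ^ 2) =
      (m ^ 2 * c ^ 4 - ((V ((x₀ + x : ℝ) : ℂ)).re - E) ^ 2) / c ^ 2 := fun x => by
    rw [sub_re, ofReal_re, ofReal_add]; ring
  have h4 : ∀ x : ℝ, √((-(m ^ 2 * c ^ 4) + (V (x₀ + x) - E).re ^ 2) / c ^ 2) - √(Esym m c E Vp) =
      Qsym m c E Vp V (x₀ + x) := fun x => by
    rw [Qsym, sub_re, ofReal_re, ofReal_add]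
  simp only [sidePhase, sideA_re_mul_sideB_re, h3, h4, ← h1, h2]
  push_cast
  ring

theorem sidePhase_left : sidePhase (x₀ - t₁) √(Esym m c E Vm)
      (sideA (m * c ^ 2) c fun y => E - V (x₀ - y)) (sideB (m * c ^ 2) c fun y => E - V (x₀ - y)) =
    -(√(Esym m c E Vm) * x₀) + (t₁ * √(Esym m c E Vm) + ∫ t in Iic t₁, Qsym m c E Vm V t : ℝ) -
      I * (∫ t in t₁..x₀, √((m ^ 2 * c ^ 4 - ((V t).re - E) ^ 2) / c ^ 2) : ℝ) := by
  have h1 : ∫ t in Iic t₁, Qsym m c E Vm V t =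
      ∫ x in Ioi (x₀ - t₁), Qsym m c E Vm V (x₀ - x) := by
    rw [integral_Iic_eq_integral_Iio, ← integral_indicator measurableSet_Iio,
      ← integral_sub_left_eq_self _ _ x₀, ← integral_indicator measurableSet_Ioi]
    refine integral_congr_ae (Eventually.of_forall fun x => ?_)
    simp only [indicator, mem_Ioi, mem_Iio, sub_lt_comm]
  have h2 := intervalIntegral.integral_comp_sub_left (a := 0) (b := x₀ - t₁)
    (fun t : ℝ => √((m ^ 2 * c ^ 4 - ((V t).re - E) ^ 2) / c ^ 2)) x₀
  rw [sub_zero, sub_sub_cancel] at h2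
  have h3 : ∀ x : ℝ, -((-(m ^ 2 * c ^ 4) + (E - V (x₀ - x)).re ^ 2) / c ^ 2) =
      (m ^ 2 * c ^ 4 - ((V ((x₀ - x : ℝ) : ℂ)).re - E) ^ 2) / c ^ 2 := fun x => by
    rw [sub_re, ofReal_re, ofReal_sub]; ring
  have h4 : ∀ x : ℝ, √((-(m ^ 2 * c ^ 4) + (E - V (x₀ - x)).re ^ 2) / c ^ 2) - √(Esym m c E Vm) =
      Qsym m c E Vm V (x₀ - x) := fun x => by
    rw [Qsym, sub_re, ofReal_re, ofReal_sub, sub_sq_comm]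
  simp only [sidePhase, sideA_re_mul_sideB_re, h3, h4, ← h1, h2]
  push_cast
  ring

theorem eq_of_exp_mul_eq {θ ψ χ z A B : ℂ} (h : exp θ * z = exp ψ * A * B) (e : ψ = θ + χ) :
    z = exp χ * A * B := by
  rw [e, exp_add, mul_assoc, mul_assoc] at h
  rw [mul_assoc]
  exact mul_left_cancel₀ (exp_ne_zero _) h

theorem KleinPotential.expansion_right (D : KleinPotential m c Vm Vp E V t₁ t₂) (h1 : t₁ < x₀)
    (h2 : x₀ < t₂) : ∃ (C : ℝ) (a b : ℕ → ℂ), 1 ≤ C ∧ a 0 = 1 ∧ b 0 = 0 ∧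
      ∀ ω : ℝ → ℝ → ℂ × ℂ, (∀ h : ℝ, 0 < h → IsDiracSolution h m c V E (ω h)) →
        (∀ h : ℝ, 0 < h → JostCond h m c E Vp 1 1 atTop (ω h)) →
        ∃ f g : ℝ → ℂ, Gevrey 1 C f a ∧ Gevrey 1 C g b ∧ ∀ h : ℝ, 0 < h →
          ω h x₀ =
            (exp (I / h * (-(t₂ * √(Esym m c E Vp) - ∫ t in Ici t₂, Qsym m c E Vp V t : ℝ) - I *
                (∫ t in x₀..t₂, √((m ^ 2 * c ^ 4 - ((V t).re - E) ^ 2) / c ^ 2) : ℝ))) *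
              (f h + g h) * ((Bsym m c E (V x₀).re : ℝ) * exp (-(Real.pi / 4) * I)),
            exp (I / h * (-(t₂ * √(Esym m c E Vp) - ∫ t in Ici t₂, Qsym m c E Vp V t : ℝ) - I *
                (∫ t in x₀..t₂, √((m ^ 2 * c ^ 4 - ((V t).re - E) ^ 2) / c ^ 2) : ℝ))) *
              (f h - g h) * ((Bsym m c E (V x₀).re : ℝ) * exp (-(Real.pi / 4) * I))⁻¹) := by
  obtain ⟨R, δ, K, S⟩ := D.sideData_right h1 h2
  obtain ⟨C, a, b, hC, ha, hb, H⟩ := S.connection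
  refine ⟨C, a, b, hC, ha, hb, fun ω hω hj => ?_⟩
  obtain ⟨f, g, hf, hg, F⟩ := H _ _ (sideFamily_right D.hm D.hc D.hE2 x₀ hω hj)
  refine ⟨f, g, hf, hg, fun h hh => ?_⟩
  have hP : (Vp - E - m * c ^ 2) / c * ((Vp - E + m * c ^ 2) / c) = Esym m c E Vp := by
    have := D.hc.ne'
    rw [Esym]; field_simp; ring
  have hB : ((sideA (m * c ^ 2) c (fun y => V (x₀ + y) - E) 0).re /
      -(sideB (m * c ^ 2) c (fun y => V (x₀ + y) - E) 0).re) ^ ((1 : ℝ) / 4) =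
      Bsym m c E (V x₀).re := by
    rw [sideA, sideB, div_ofReal_re, div_ofReal_re, ← neg_div,
      div_div_div_cancel_right₀ D.hc.ne', Bsym]
    simp only [add_zero, sub_re, neg_re, add_re, ofReal_re]
    ring_nf
  obtain ⟨e1, e2⟩ := F h hh
  rw [hP, sidePhase_right, hB, add_zero] at e1 e2
  ext1
  · exact eq_of_exp_mul_eq e1 (by ring)
  · exact eq_of_exp_mul_eq e2 (by ring)

theorem KleinPotential.expansion_left (D : KleinPotential m c Vm Vp E V t₁ t₂) (h1 : t₁ < x₀)
    (h2 : x₀ < t₂) : ∃ (C : ℝ) (a b : ℕ → ℂ), 1 ≤ C ∧ a 0 = 1 ∧ b 0 = 0 ∧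
      ∀ ω : ℝ → ℝ → ℂ × ℂ, (∀ h : ℝ, 0 < h → IsDiracSolution h m c V E (ω h)) →
        (∀ h : ℝ, 0 < h → JostCond h m c E Vm 1 1 atBot (ω h)) →
        ∃ f g : ℝ → ℂ, Gevrey 1 C f a ∧ Gevrey 1 C g b ∧ ∀ h : ℝ, 0 < h →
          ω h x₀ =
            (exp (I / h * ((t₁ * √(Esym m c E Vm) + ∫ t in Iic t₁, Qsym m c E Vm V t : ℝ) - I *
                (∫ t in t₁..x₀, √((m ^ 2 * c ^ 4 - ((V t).re - E) ^ 2) / c ^ 2) : ℝ))) *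
              (f h - g h) * (((Bsym m c E (V x₀).re : ℝ) : ℂ)⁻¹ * exp (-(Real.pi / 4) * I))⁻¹,
            exp (I / h * ((t₁ * √(Esym m c E Vm) + ∫ t in Iic t₁, Qsym m c E Vm V t : ℝ) - I *
                (∫ t in t₁..x₀, √((m ^ 2 * c ^ 4 - ((V t).re - E) ^ 2) / c ^ 2) : ℝ))) *
              (f h + g h) * (((Bsym m c E (V x₀).re : ℝ) : ℂ)⁻¹ * exp (-(Real.pi / 4) * I))) := by
  obtain ⟨R, δ, K, S⟩ := D.sideData_left h1 h2
  obtain ⟨C, a, b, hC, ha, hb, H⟩ := S.connection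
  refine ⟨C, a, b, hC, ha, hb, fun ω hω hj => ?_⟩
  obtain ⟨f, g, hf, hg, F⟩ := H _ _ (sideFamily_left D.hm D.hc D.hE1 x₀ hω hj)
  refine ⟨f, g, hf, hg, fun h hh => ?_⟩
  have hP : (E - Vm - m * c ^ 2) / c * ((E - Vm + m * c ^ 2) / c) = Esym m c E Vm := by
    have := D.hc.ne'
    rw [Esym]; field_simp; ring
  have hp1 := D.pattern.lt_of_left x₀ h1
  have hp2 := D.pattern.gt_of_right x₀ h2
  have hB : ((sideA (m * c ^ 2) c (fun y => E - V (x₀ - y)) 0).re /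
      -(sideB (m * c ^ 2) c (fun y => E - V (x₀ - y)) 0).re) ^ ((1 : ℝ) / 4) =
      (Bsym m c E (V x₀).re)⁻¹ := by
    rw [sideA, sideB, div_ofReal_re, div_ofReal_re, ← neg_div,
      div_div_div_cancel_right₀ D.hc.ne', Bsym, ← Real.inv_rpow]
    · simp only [sub_zero, sub_re, neg_re, add_re, ofReal_re]
      rw [inv_div]
      ring_nf
    · exact div_nonneg (by simp; linarith) (by simp at hp2 ⊢; linarith)
  obtain ⟨e1, e2⟩ := F h hh
  rw [hP, sidePhase_left, hB, sub_zero, ofReal_inv] at e1 e2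
  ext1
  · exact eq_of_exp_mul_eq e2 (by ring)
  · exact eq_of_exp_mul_eq e1 (by ring)

end

section

open scoped ComplexConjugate

/-- A combination `f * g + f' * g'` of Gevrey functions in which `f'` is of order `h`. -/
theorem Gevrey.exists_dot {h₀ C : ℝ} {f f' g g' : ℝ → ℂ} {a a' b b' : ℕ → ℂ} (hC : 1 ≤ C)
    (hf : Gevrey h₀ C f a) (hf' : Gevrey h₀ C f' a') (hg : Gevrey h₀ C g b)
    (hg' : Gevrey h₀ C g' b') (ha : a 0 = 1) (hb : b 0 = 1) (ha' : a' 0 = 0) :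
    ∃ C' d, 1 ≤ C' ∧ d 0 = 1 ∧ Gevrey h₀ C' (fun h => f h * g h + f' h * g' h) d := by
  refine ⟨_, _, ?_, ?_, (hf.mul hg hC).add (hf'.mul hg' hC) (by positivity)⟩
  · nlinarith
  · simp [ha, hb, ha']

theorem gevrey_one : Gevrey 1 1 (fun _ => 1) fun j => if j = 0 then 1 else 0 where
  coeff j := by
    split_ifs
    · simpa using Nat.one_le_iff_ne_zero.2 (Nat.factorial_ne_zero j)
    · simp
  rem N h h0 h1 := by
    rcases N with _ | N
    · simp
    · simp only [ite_mul, one_mul, zero_mul, Finset.sum_ite_eq', Finset.mem_range, Nat.succ_pos,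
        if_true, pow_zero, sub_self, norm_zero]
      positivity

/-- The quotient of two Gevrey functions with limit `1` is given by a classical analytic symbol. -/
theorem Gevrey.exists_isCAS_div {C D : ℝ} {f g : ℝ → ℂ} {a b : ℕ → ℂ} (hf : Gevrey 1 C f a)
    (hg : Gevrey 1 D g b) (hC : 1 ≤ C) (hD : 1 ≤ D) (ha : a 0 = 1) (hb : b 0 = 1) {z : ℂ}
    (hz : ‖z‖ = 1) :
    ∃ φ, IsCAS φ ∧ ∃ r > 0, ∀ h : ℝ, 0 < h → h < r → g h ≠ 0 ∧ z + h * φ h = z * (f h / g h) := by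
  obtain ⟨b', D', hb', hD', hinv, hne⟩ := hg.inv hD hb
  have hr0 : 0 < min 1 (1 / (2 * D ^ 2)) := by positivity
  have hr1 : min 1 (1 / (2 * D ^ 2)) ≤ 1 := min_le_left _ _
  generalize min 1 (1 / (2 * D ^ 2)) = r at hinv hne hr0 hr1
  have hM : 1 ≤ max C D' := hC.trans (le_max_left _ _)
  have h1 := (((hf.mono (by linarith) (le_max_left C D') hr1).mul
    (hinv.mono (by linarith) (le_max_right C D') le_rfl) hM).const_mul z hz).tail (by nlinarith)
  refine ⟨_, h1.isCAS (by positivity) hr0, r, hr0, fun h h0 hhr => ⟨hne h h0 hhr, ?_⟩⟩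
  have hh : (h : ℂ) ≠ 0 := by exact_mod_cast h0.ne'
  simp only [hhr, if_true, zero_add, Finset.range_one, Finset.sum_singleton, ha, hb', mul_one]
  field_simp
  ring

/-- Scattering coefficients from the values of the Jost solutions at one point. -/
theorem scattering_of_values {e B P P' Q Q' : ℂ} {f g f' g' k l k' l' : ℂ} (he : e ^ 2 = -I)
    (hB : B ≠ 0) {inm inp outp outm : ℂ × ℂ} {S : Matrix (Fin 2) (Fin 2) ℂ}
    (houtp : outp = (P * (f + g) * (B * e), P * (f - g) * (B * e)⁻¹))
    (hinm : inm = (Q * (k - l) * (B⁻¹ * e)⁻¹, Q * (k + l) * (B⁻¹ * e)))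
    (hinp : inp = (P' * (f' + g') * (B * e⁻¹), -(P' * (f' - g') * (B * e⁻¹)⁻¹)))
    (houtm : outm = (Q' * (k' - l') * (B⁻¹ * e⁻¹)⁻¹, -(Q' * (k' + l') * (B⁻¹ * e⁻¹))))
    (h1 : inm = S 0 0 • outp + S 1 0 • outm) (h2 : inp = S 0 1 • outp + S 1 1 • outm)
    (w1 : Wron inm outm = -2) (w2 : Wron outp inp = -2) :
    S 0 0 * (P * Q' * (f * k' + g * l')) = 1 ∧ S 1 1 * (P * Q' * (f * k' + g * l')) = 1 ∧
    S 1 0 * (P * Q' * (f * k' + g * l')) = I * (P * Q * (f * k + g * l)) ∧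
    S 0 1 * (P * Q' * (f * k' + g * l')) = I * (P' * Q' * (f' * k' + g' * l')) := by
  have he0 : e ≠ 0 := by rintro rfl; simp at he
  have hw : Wron outp outm = -2 * (P * Q' * (f * k' + g * l')) := by
    rw [Wron, houtp, houtm]; field_simp; ring
  have hw1 : Wron inm outp = 2 * I * (P * Q * (f * k + g * l)) := by
    have : e⁻¹ ^ 2 = I := by rw [inv_pow, he, inv_neg, inv_I, neg_neg]
    have e1 : Wron inm outp = P * Q * ((k - l) * (f - g) * e⁻¹ ^ 2 - (k + l) * (f + g) * e ^ 2) := by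
      rw [Wron, houtp, hinm]; field_simp
    rw [e1, this, he]; ring
  have hw2 : Wron inp outm = -2 * I * (P' * Q' * (f' * k' + g' * l')) := by
    have : e⁻¹ ^ 2 = I := by rw [inv_pow, he, inv_neg, inv_I, neg_neg]
    have e1 : Wron inp outm =
        P' * Q' * ((f' - g') * (k' - l') * e ^ 2 - (f' + g') * (k' + l') * e⁻¹ ^ 2) := by
      rw [Wron, houtm, hinp]; field_simp; ring
    rw [e1, this, he]; ring
  have i1 : Wron inm outm = S 0 0 * Wron outp outm := by
    rw [h1]; simp only [Wron, Prod.fst_add, Prod.snd_add, Prod.smul_fst, Prod.smul_snd, smul_eq_mul]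
    ring
  have i2 : Wron inm outp = -(S 1 0 * Wron outp outm) := by
    rw [h1]; simp only [Wron, Prod.fst_add, Prod.snd_add, Prod.smul_fst, Prod.smul_snd, smul_eq_mul]
    ring
  have i3 : Wron outp inp = S 1 1 * Wron outp outm := by
    rw [h2]; simp only [Wron, Prod.fst_add, Prod.snd_add, Prod.smul_fst, Prod.smul_snd, smul_eq_mul]
    ring
  have i4 : Wron inp outm = S 0 1 * Wron outp outm := by
    rw [h2]; simp only [Wron, Prod.fst_add, Prod.snd_add, Prod.smul_fst, Prod.smul_snd, smul_eq_mul]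
    ring
  rw [hw] at i1 i2 i3 i4
  refine ⟨?_, ?_, ?_, ?_⟩
  · linear_combination (1 / 2) * i1 - (1 / 2) * w1
  · linear_combination (1 / 2) * i3 - (1 / 2) * w2
  · linear_combination (1 / 2) * hw1 - (1 / 2) * i2
  · linear_combination (1 / 2) * i4 - (1 / 2) * hw2

theorem AmpF_ne_zero {m c lam : ℝ} (hm : 0 < m) (hc : 0 < c)
    (h : m * c ^ 2 < lam ∨ lam < -(m * c ^ 2)) : AmpF m c lam ≠ 0 := by
  have hμ : 0 < m * c ^ 2 := mul_pos hm (pow_pos hc 2)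
  have : 0 < (lam + m * c ^ 2) / (lam - m * c ^ 2) := by
    rcases h with h | h
    · exact div_pos (by linarith) (by linarith)
    · exact div_pos_of_neg_of_neg (by linarith) (by linarith)
  exact (Real.rpow_pos_of_pos this _).ne'

end

section

open scoped ComplexConjugate

theorem exp_neg_pi_div_four_sq : exp (-(Real.pi / 4) * I) ^ 2 = -I := by
  rw [← exp_nat_mul, ← exp_neg_pi_div_two_mul_I]
  congr 1
  push_cast
  ring

theorem conj_exp_neg_pi_div_four :
    conj (exp (-(Real.pi / 4) * I)) = (exp (-(Real.pi / 4) * I))⁻¹ := by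
  rw [← exp_conj, ← exp_neg]
  simp [map_ofNat]

theorem eq_of_conjSymm_eq {w : ℝ → ℂ × ℂ} {x : ℝ} {p q : ℂ} (h : conjSymm w x = (p, q)) :
    w x = (conj p, -conj q) := by
  obtain ⟨h1, h2⟩ := Prod.ext_iff.1 h
  simp only [conjSymm] at h1 h2
  rw [← h1, ← h2]
  simp

/-- The solutions of the Dirac equation are governed at the midpoint by two phases. -/
theorem phase_relations (h X Y A A' : ℝ) :
    exp (I / h * (-X - I * A)) * conj (exp (I / h * (Y - I * A'))) *
      (exp (-((A' + A : ℝ) : ℂ) / h) * exp (I * ((Y + X : ℝ) : ℂ) / h)) = 1 ∧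
    exp (I / h * (Y - I * A')) = conj (exp (I / h * (Y - I * A'))) * exp (2 * I / h * Y) ∧
    conj (exp (I / h * (-X - I * A))) = exp (I / h * (-X - I * A)) * exp (2 * I / h * X) := by
  have h1 : conj (exp (I / h * (Y - I * A'))) = exp (-(I / h) * (Y + I * A')) := by
    rw [← exp_conj]; simp [neg_div]
  have h2 : conj (exp (I / h * (-X - I * A))) = exp (-(I / h) * (-X + I * A)) := by
    rw [← exp_conj]; simp [neg_div]
  rw [h1, h2, ← exp_add, ← exp_add, ← exp_add, ← exp_add, ← exp_add]
  refine ⟨?_, ?_, ?_⟩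
  · rw [← exp_zero]
    congr 1
    push_cast
    linear_combination (-(A + A') / h) * I_sq
  · congr 1; ring
  · congr 1; ring

theorem KleinPotential.sAct_eq {m c Vm Vp E t₁ t₂ : ℝ} {V : ℂ → ℂ}
    (D : KleinPotential m c Vm Vp E V t₁ t₂) (x₀ : ℝ) : SAct m c E V t₁ t₂ =
      (∫ t in t₁..x₀, √((m ^ 2 * c ^ 4 - ((V t).re - E) ^ 2) / c ^ 2)) +
        ∫ t in x₀..t₂, √((m ^ 2 * c ^ 4 - ((V t).re - E) ^ 2) / c ^ 2) := by
  have hV : Continuous fun x : ℝ => (V x).re := continuous_re.comp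
    (continuous_iff_continuousAt.2 fun x =>
      (D.analyticAt_ofReal x).continuousAt.comp continuous_ofReal.continuousAt)
  have hc : Continuous fun t : ℝ => √((m ^ 2 * c ^ 4 - ((V t).re - E) ^ 2) / c ^ 2) := by
    fun_prop
  exact (intervalIntegral.integral_add_adjacent_intervals (hc.intervalIntegrable _ _)
    (hc.intervalIntegrable _ _)).symm

end

end KleinWKB

/-- **Klein paradox** (Theorem 2.2).  Under assumption (A), for `m > 0` and an
energy `E` in region III (`V⁻ + mc² < E < V⁺ − mc²`), if `m²c⁴ − (V(x) − E)²`
has exactly two real zeros `t₁ < t₂`, both simple, then there are classical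
analytic symbols `φ₁, φ₂, φ₃` of non-negative order such that
`s₁₁ = s₂₂ = (1 + hφ₁(h)) e^{−S(E)/h} e^{iT(E)/h}`,
`s₂₁ = (i + hφ₂(h)) exp{(2i/h)(t₁ √E⁻ + ∫_{−∞}^{t₁} Q⁻)}`, and
`s₁₂ = (i + hφ₃(h)) exp{(2i/h)(t₂ √E⁺ − ∫_{t₂}^{∞} Q⁺)}`. -/
theorem klein_paradox
    (m c Vm Vp E : ℝ) (V : ℂ → ℂ)
    (hA : AssumptionA V Vm Vp) (hm : 0 < m) (hc : 0 < c)
    (hE1 : Vm + m * c ^ 2 < E) (hE2 : E < Vp - m * c ^ 2)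
    (t₁ t₂ : ℝ) (ht12 : t₁ < t₂)
    (hzeros : ∀ x : ℝ, m ^ 2 * c ^ 4 - ((V x).re - E) ^ 2 = 0 ↔ x = t₁ ∨ x = t₂)
    (hsimp1 : deriv (fun x : ℝ => m ^ 2 * c ^ 4 - ((V x).re - E) ^ 2) t₁ ≠ 0)
    (hsimp2 : deriv (fun x : ℝ => m ^ 2 * c ^ 4 - ((V x).re - E) ^ 2) t₂ ≠ 0)
    (ωinm ωinp ωoutp ωoutm : ℝ → ℝ → ℂ × ℂ)
    (S : ℝ → Matrix (Fin 2) (Fin 2) ℂ)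
    (hsol : ∀ h : ℝ, 0 < h →
      IsDiracSolution h m c V E (ωinm h) ∧ IsDiracSolution h m c V E (ωinp h) ∧
      IsDiracSolution h m c V E (ωoutp h) ∧ IsDiracSolution h m c V E (ωoutm h))
    (hjost : ∀ h : ℝ, 0 < h →
      JostCond h m c E Vm 1 1 atBot (ωinm h) ∧
      JostCond h m c E Vp (-1) (-1) atTop (ωinp h) ∧
      JostCond h m c E Vp 1 1 atTop (ωoutp h) ∧
      JostCond h m c E Vm (-1) (-1) atBot (ωoutm h))
    (hScat : ∀ h : ℝ, 0 < h → ScatRel (ωinm h) (ωinp h) (ωoutp h) (ωoutm h) (S h)) :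
    ∃ φ₁ φ₂ φ₃ : ℝ → ℂ, IsCAS φ₁ ∧ IsCAS φ₂ ∧ IsCAS φ₃ ∧
      ∃ h₀ > (0 : ℝ), ∀ h : ℝ, 0 < h → h < h₀ →
        (S h 0 0 = S h 1 1 ∧
          S h 0 0 = (1 + (h : ℂ) * φ₁ h)
            * Complex.exp (-((SAct m c E V t₁ t₂ : ℝ) : ℂ) / (h : ℂ))
            * Complex.exp (Complex.I * ((TPhase m c E Vm Vp V t₁ t₂ : ℝ) : ℂ) / (h : ℂ))) ∧
        S h 1 0 = (Complex.I + (h : ℂ) * φ₂ h)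
          * Complex.exp (2 * Complex.I / (h : ℂ)
            * (((t₁ * Real.sqrt (Esym m c E Vm) + ∫ t in Set.Iic t₁, Qsym m c E Vm V t : ℝ)) : ℂ)) ∧
        S h 0 1 = (Complex.I + (h : ℂ) * φ₃ h)
          * Complex.exp (2 * Complex.I / (h : ℂ)
            * (((t₂ * Real.sqrt (Esym m c E Vp) - ∫ t in Set.Ici t₂, Qsym m c E Vp V t : ℝ)) : ℂ)) := by

  have D : KleinWKB.KleinPotential m c Vm Vp E V t₁ t₂ :=
    ⟨hA, hm, hc, hE1, hE2, ht12, hzeros, hsimp1, hsimp2⟩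
  have hV := hA.real_on_real
  obtain ⟨x₀, h1, h2⟩ := exists_between ht12
  obtain ⟨C, a, b, hC, ha, hb, HR⟩ := D.expansion_right h1 h2
  obtain ⟨C', a', b', hC', ha', hb', HL⟩ := D.expansion_left h1 h2
  obtain ⟨f, g, hf, hg, voutp⟩ := HR _ (fun h hh => (hsol h hh).2.2.1) fun h hh => (hjost h hh).2.2.1
  obtain ⟨f', g', hf', hg', vinp⟩ := HR (fun h => KleinWKB.conjSymm (ωinp h))
    (fun h hh => KleinWKB.isDiracSolution_conjSymm hc hh hV (hsol h hh).2.1)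
    fun h hh => KleinWKB.jostCond_conjSymm (hjost h hh).2.1
  obtain ⟨k, l, hk, hl, vinm⟩ := HL _ (fun h hh => (hsol h hh).1) fun h hh => (hjost h hh).1
  obtain ⟨k', l', hk', hl', voutm⟩ := HL (fun h => KleinWKB.conjSymm (ωoutm h))
    (fun h hh => KleinWKB.isDiracSolution_conjSymm hc hh hV (hsol h hh).2.2.2)
    fun h hh => KleinWKB.jostCond_conjSymm (hjost h hh).2.2.2
  have hM : 1 ≤ max C C' := hC.trans (le_max_left _ _)
  have hR : ∀ {u : ℝ → ℂ} {d : ℕ → ℂ}, KleinWKB.Gevrey 1 C u d → KleinWKB.Gevrey 1 (max C C') u d :=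
    fun hu => hu.mono (by linarith) (le_max_left _ _) le_rfl
  have hL : ∀ {u : ℝ → ℂ} {d : ℕ → ℂ}, KleinWKB.Gevrey 1 C' u d → KleinWKB.Gevrey 1 (max C C') u d :=
    fun hu => hu.mono (by linarith) (le_max_right _ _) le_rfl
  obtain ⟨C₁, d₁, hC₁, hd₁, hF₁⟩ := KleinWKB.Gevrey.exists_dot hM (hR hf) (hR hg) (hL hk').conj
    (hL hl').conj ha (by simp [ha']) hb
  obtain ⟨C₂, d₂, hC₂, hd₂, hF₂⟩ := KleinWKB.Gevrey.exists_dot hM (hR hf) (hR hg) (hL hk) (hL hl)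
    ha ha' hb
  obtain ⟨C₃, d₃, hC₃, hd₃, hF₃⟩ := KleinWKB.Gevrey.exists_dot hM (hR hf').conj (hR hg').conj
    (hL hk').conj (hL hl').conj (by simp [ha]) (by simp [ha']) (by simp [hb])
  obtain ⟨φ₁, hφ₁, r₁, hr₁, H₁⟩ := KleinWKB.gevrey_one.exists_isCAS_div hF₁ le_rfl hC₁ (if_pos rfl)
    hd₁ norm_one
  obtain ⟨φ₂, hφ₂, r₂, hr₂, H₂⟩ := hF₂.exists_isCAS_div hF₁ hC₂ hC₁ hd₂ hd₁ norm_I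
  obtain ⟨φ₃, hφ₃, r₃, hr₃, H₃⟩ := hF₃.exists_isCAS_div hF₁ hC₃ hC₁ hd₃ hd₁ norm_I
  refine ⟨φ₁, φ₂, φ₃, hφ₁, hφ₂, hφ₃, min r₁ (min r₂ r₃), lt_min hr₁ (lt_min hr₂ hr₃),
    fun h hh hhr => ?_⟩
  obtain ⟨hlt₁, hlt₂, hlt₃⟩ : h < r₁ ∧ h < r₂ ∧ h < r₃ := by simpa using hhr
  obtain ⟨hF0, e₁⟩ := H₁ h hh hlt₁
  obtain ⟨-, e₂⟩ := H₂ h hh hlt₂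
  obtain ⟨-, e₃⟩ := H₃ h hh hlt₃
  have hB : ((Bsym m c E (V x₀).re : ℝ) : ℂ) ≠ 0 := by
    have p1 := D.pattern.lt_of_left x₀ h1
    have p2 := D.pattern.gt_of_right x₀ h2
    have : 0 < (m * c ^ 2 + E - (V x₀).re) / (m * c ^ 2 - E + (V x₀).re) :=
      div_pos (by linarith) (by linarith)
    exact_mod_cast (Real.rpow_pos_of_pos this _).ne'
  have w1 := KleinWKB.wron_jost hc hh (hsol h hh).1 (hsol h hh).2.2.2 (hjost h hh).1
    (hjost h hh).2.2.2 (KleinWKB.AmpF_ne_zero hm hc (Or.inl (by linarith))) x₀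
  have w2 := KleinWKB.wron_jost hc hh (hsol h hh).2.2.1 (hsol h hh).2.1 (hjost h hh).2.2.1
    (hjost h hh).2.1 (KleinWKB.AmpF_ne_zero hm hc (Or.inr (by linarith))) x₀
  have vinp' := KleinWKB.eq_of_conjSymm_eq (vinp h hh)
  have voutm' := KleinWKB.eq_of_conjSymm_eq (voutm h hh)
  simp only [map_mul, map_add, map_sub, map_inv₀, KleinWKB.conj_exp_neg_pi_div_four, conj_ofReal]
    at vinp' voutm'
  obtain ⟨s00, s11, s10, s01⟩ := KleinWKB.scattering_of_values KleinWKB.exp_neg_pi_div_four_sq hB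
    (voutp h hh) (vinm h hh) vinp' voutm' ((hScat h hh).1 x₀) ((hScat h hh).2 x₀) w1 w2
  have hT : TPhase m c E Vm Vp V t₁ t₂ = (t₁ * √(Esym m c E Vm) + ∫ t in Iic t₁, Qsym m c E Vm V t) +
      (t₂ * √(Esym m c E Vp) - ∫ t in Ici t₂, Qsym m c E Vp V t) := by
    rw [TPhase]; ring
  rw [hT, D.sAct_eq x₀]
  generalize t₁ * √(Esym m c E Vm) + ∫ t in Iic t₁, Qsym m c E Vm V t = Y at *
  generalize t₂ * √(Esym m c E Vp) - ∫ t in Ici t₂, Qsym m c E Vp V t = X at *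
  generalize ∫ t in t₁..x₀, √((m ^ 2 * c ^ 4 - ((V t).re - E) ^ 2) / c ^ 2) = A' at *
  generalize ∫ t in x₀..t₂, √((m ^ 2 * c ^ 4 - ((V t).re - E) ^ 2) / c ^ 2) = A at *
  obtain ⟨q1, q2, q3⟩ := KleinWKB.phase_relations h X Y A A'
  have hP := exp_ne_zero (I / h * (-X - I * A))
  have hQ : starRingEnd ℂ (exp (I / h * (Y - I * A'))) ≠ 0 := (map_ne_zero _).2 (exp_ne_zero _)
  generalize exp (I / h * (-X - I * A)) = P at *
  generalize exp (I / h * (Y - I * A')) = Q at *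
  generalize starRingEnd ℂ Q = Q' at *
  rw [q2] at s10
  rw [q3] at s01
  rw [mul_assoc (1 + h * φ₁ h), e₁, e₂, e₃]
  generalize exp (-((A' + A : ℝ) : ℂ) / h) * exp (I * ((Y + X : ℝ) : ℂ) / h) = z at *
  generalize exp (2 * I / h * Y) = y at *
  generalize exp (2 * I / h * X) = x at *
  generalize f h * starRingEnd ℂ (k' h) + g h * starRingEnd ℂ (l' h) = F at *
  have hPQ : P * Q' * F ≠ 0 := mul_ne_zero (mul_ne_zero hP hQ) hF0
  refine ⟨⟨mul_right_cancel₀ hPQ (s00.trans s11.symm), mul_right_cancel₀ hPQ ?_⟩,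
    mul_right_cancel₀ hPQ ?_, mul_right_cancel₀ hPQ ?_⟩
  · rw [s00]; field_simp; linear_combination -q1
  · rw [s10]; field_simp
  · rw [s01]; field_simp
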